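/- Let n > 3. Every continuous section t of F_n(ℝ²) : PConf_{n+1}(ℝ²)/Σ_n → Conf_n(ℝ²) is homotopic through sections to a section whose image is contained in the image of W_∞ under the quotient map PConf_{n+1}(ℝ²) → PConf_{n+1}(ℝ²)/Σ_n, i.e. every section of F_n(ℝ²) is 'adding a point at infinity'. -/

import Mathlib

/-- The ordered configuration space of `n` points in `S`. -/
abbrev PConf (n : ℕ) (S : Type*) : Type _ := {x : Fin n → S // Function.Injective x}

/-- The forgetful map `f_n(S)` forgetting the 0th point. -/
def forgetPoint (n : ℕ) {S : Type*} (x : PConf (n + 1) S) : PConf n S :=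
  ⟨x.1 ∘ Fin.succ, x.2.comp (Fin.succ_injective n)⟩

/-- Extension of a permutation of `{1,…,n}` to a permutation of `{0,1,…,n}` fixing `0`. -/
def extendPerm (n : ℕ) (σ : Equiv.Perm (Fin n)) : Equiv.Perm (Fin (n + 1)) where
  toFun := Fin.cases 0 (fun j => (σ j).succ)
  invFun := Fin.cases 0 (fun j => (σ.symm j).succ)
  left_inv i := by induction i using Fin.cases <;> simp
  right_inv i := by induction i using Fin.cases <;> simp

/-- The orbit setoid of the permutation action `(σ • x) i = x (σ⁻¹ i)` on `PConf n S`. -/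
def confSetoid (n : ℕ) (S : Type*) : Setoid (PConf n S) where
  r x y := ∃ σ : Equiv.Perm (Fin n), x.1 = y.1 ∘ σ
  iseqv := by
    constructor
    · exact fun x => ⟨Equiv.refl _, rfl⟩
    · rintro x y ⟨σ, h⟩
      refine ⟨σ.symm, funext fun i => ?_⟩
      simp [h]
    · rintro x y z ⟨σ, h⟩ ⟨τ, h'⟩
      refine ⟨σ.trans τ, funext fun i => ?_⟩
      simp [h, h']

/-- The orbit setoid on `PConf (n+1) S` for the action of `Perm (Fin n)` permuting the
coordinates `1,…,n` and fixing the 0th coordinate. -/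
def uconfSetoid (n : ℕ) (S : Type*) : Setoid (PConf (n + 1) S) where
  r x y := ∃ σ : Equiv.Perm (Fin n), x.1 = y.1 ∘ (extendPerm n σ)
  iseqv := by
    constructor
    · refine fun x => ⟨Equiv.refl _, funext fun i => ?_⟩
      induction i using Fin.cases <;> simp [extendPerm]
    · rintro x y ⟨σ, h⟩
      refine ⟨σ.symm, funext fun i => ?_⟩
      rw [h]
      induction i using Fin.cases <;> simp [extendPerm]
    · rintro x y z ⟨σ, h⟩ ⟨τ, h'⟩
      refine ⟨σ.trans τ, funext fun i => ?_⟩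
      rw [h, h']
      induction i using Fin.cases <;> simp [extendPerm]

/-- The unordered configuration space `Conf_n(S)`. -/
abbrev Conf (n : ℕ) (S : Type*) : Type _ := Quotient (confSetoid n S)

/-- The quotient of `PConf_{n+1}(S)` by the action of `Σ_n` on the coordinates `1,…,n`. -/
abbrev UConf (n : ℕ) (S : Type*) : Type _ := Quotient (uconfSetoid n S)

/-- The map `F_n(S)` induced by `f_n(S)` on the quotients. -/
def forgetQ (n : ℕ) (S : Type*) : UConf n S → Conf n S :=
  Quotient.map (forgetPoint n) (by
    rintro x y ⟨σ, h⟩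
    refine ⟨σ, funext fun i => ?_⟩
    have hi := congrFun h i.succ
    simpa [forgetPoint, extendPerm] using hi)

/-- The set `W_∞`: configurations where the 0th point has larger norm than all others. -/
def Winfty (n : ℕ) (x : PConf (n + 1) (EuclideanSpace ℝ (Fin 2))) : Prop :=
  ∀ i : Fin (n + 1), i ≠ 0 → ‖x.1 i‖ < ‖x.1 0‖

/-- Two sections of `F_n(S)` are homotopic through sections. -/
def HomotopicThroughSectionsQ (n : ℕ) (S : Type*) [TopologicalSpace S]
    (t t' : Conf n S → UConf n S) : Prop :=
  ∃ H : Conf n S × unitInterval → UConf n S,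
    Continuous H ∧ (∀ x, H (x, 0) = t x) ∧ (∀ x, H (x, 1) = t' x) ∧
      ∀ x τ, forgetQ n S (H (x, τ)) = x

set_option linter.unusedSectionVars false
set_option linter.unusedSimpArgs false
set_option linter.unnecessarySeqFocus false

section FreeGroupWords

open FreeGroup

variable {α : Type*} [DecidableEq α]

lemma toWord_mul_of_isReduced {g h : FreeGroup α} (H : IsReduced (g.toWord ++ h.toWord)) :
    (g * h).toWord = g.toWord ++ h.toWord := by
  rw [toWord_mul, H.reduce_eq]

lemma isReduced_append_iff {L L' : List (α × Bool)} :
    IsReduced (L ++ L') ↔ IsReduced L ∧ IsReduced L' ∧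
      ∀ a ∈ L.getLast?, ∀ b ∈ L'.head?, a.1 = b.1 → a.2 = b.2 :=
  List.isChain_append

lemma toWord_mk_of_isReduced {L : List (α × Bool)} (H : IsReduced L) : (mk L).toWord = L := by
  rw [toWord_mk, H.reduce_eq]

lemma norm_mk_of_isReduced {L : List (α × Bool)} (H : IsReduced L) : (mk L).norm = L.length := by
  rw [FreeGroup.norm, toWord_mk_of_isReduced H]

lemma mk_pow_eq (L : List (α × Bool)) (n : ℕ) :
    (mk L) ^ n = mk (List.replicate n L).flatten := by
  induction n with
  | zero => rfl
  | succ n ih => rw [pow_succ', ih, mul_mk, List.replicate_succ, List.flatten_cons]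

/-- An element of a free group is supported on `M` if its reduced word only uses letters of `M`. -/
def SuppOn (M : Set α) (g : FreeGroup α) : Prop := ∀ q ∈ g.toWord, q.1 ∈ M

lemma SuppOn.one {M : Set α} : SuppOn M (1 : FreeGroup α) := by simp [SuppOn]

lemma SuppOn.mul {M : Set α} {g h : FreeGroup α} (hg : SuppOn M g) (hh : SuppOn M h) :
    SuppOn M (g * h) := by
  intro q hq
  rcases List.mem_append.1 ((toWord_mul_sublist g h).subset hq) with h1 | h1
  exacts [hg q h1, hh q h1]

lemma SuppOn.inv {M : Set α} {g : FreeGroup α} (hg : SuppOn M g) : SuppOn M g⁻¹ := by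
  intro q hq
  rw [toWord_inv] at hq
  simp only [invRev, List.mem_reverse, List.mem_map] at hq
  obtain ⟨a, ha, rfl⟩ := hq
  exact hg a ha

lemma SuppOn.pow {M : Set α} {g : FreeGroup α} (hg : SuppOn M g) (n : ℕ) : SuppOn M (g ^ n) := by
  induction n with
  | zero => simpa using SuppOn.one
  | succ n ih => rw [pow_succ]; exact ih.mul hg

lemma SuppOn.zpow {M : Set α} {g : FreeGroup α} (hg : SuppOn M g) (n : ℤ) : SuppOn M (g ^ n) := by
  cases n with
  | ofNat n => simpa using hg.pow n
  | negSucc n => rw [zpow_negSucc]; exact (hg.pow _).inv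

lemma SuppOn.of {M : Set α} {a : α} (ha : a ∈ M) : SuppOn M (FreeGroup.of a) := by
  simp [SuppOn, ha]

lemma SuppOn.mk_of_forall {M : Set α} {L : List (α × Bool)} (h : ∀ q ∈ L, q.1 ∈ M) :
    SuppOn M (mk L) := by
  intro q hq
  rw [toWord_mk] at hq
  exact h q ((reduce.red (L := L)).sublist.subset hq)

lemma mk_singleton_eq (a : α) (b : Bool) :
    (mk [(a, b)] : FreeGroup α) = if b then FreeGroup.of a else (FreeGroup.of a)⁻¹ := by
  cases b <;> rfl

lemma mk_append_eq (L L' : List (α × Bool)) : (mk (L ++ L') : FreeGroup α) = mk L * mk L' := rfl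

lemma mk_cons_eq (q : α × Bool) (L : List (α × Bool)) :
    (mk (q :: L) : FreeGroup α) = mk [q] * mk L := rfl

lemma SuppOn.map {M : Set α} {Φ : FreeGroup α →* FreeGroup α}
    (hM : ∀ l ∈ M, SuppOn M (Φ (FreeGroup.of l))) {L : List (α × Bool)} (h : ∀ q ∈ L, q.1 ∈ M) :
    SuppOn M (Φ (mk L)) := by
  induction L with
  | nil => simpa [← one_eq_mk] using SuppOn.one
  | cons q L ih =>
    rw [mk_cons_eq, _root_.map_mul]
    refine SuppOn.mul ?_ (ih fun q hq => h q (List.mem_cons_of_mem _ hq))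
    have hq := hM q.1 (h q List.mem_cons_self)
    rcases q with ⟨a, _ | _⟩
    · rw [mk_singleton_eq]; simpa using hq.inv
    · rw [mk_singleton_eq]; simpa using hq

/-- A homomorphism preserving the letters outside `M` and the words in `M`. -/
structure IsRelHom (M : Set α) (Φ : FreeGroup α →* FreeGroup α) : Prop where
  ofParts ::
  inj : Function.Injective Φ
  fix : ∀ b ∉ M, Φ (FreeGroup.of b) = FreeGroup.of b
  supp : ∀ l ∈ M, SuppOn M (Φ (FreeGroup.of l))

variable {M : Set α} {Φ : FreeGroup α →* FreeGroup α}

lemma IsRelHom.map_letter (hΦ : IsRelHom M Φ) {β : α × Bool} (hβ : β.1 ∉ M) :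
    Φ (mk [β]) = mk [β] := by
  rcases β with ⟨a, _ | _⟩ <;> simp [mk_singleton_eq, hΦ.fix a hβ]

lemma getLast?_of_suppOn {g : FreeGroup α} (hg : SuppOn M g) (q : α × Bool)
    (hq : q ∈ g.toWord.getLast?) : q.1 ∈ M :=
  hg q (List.mem_of_getLast? hq)

lemma toWord_mk_singleton (β : α × Bool) : (mk [β] : FreeGroup α).toWord = [β] := rfl

/-- Splitting off the maximal suffix with letters in `M`. -/
lemma exists_suffix_split (M : Set α) (w : List (α × Bool)) :
    ∃ y u, w = y ++ u ∧ (∀ q ∈ u, q.1 ∈ M) ∧ (∀ β ∈ y.getLast?, β.1 ∉ M) := by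
  classical
  induction w using List.reverseRecOn with
  | nil => exact ⟨[], [], rfl, by simp, by simp⟩
  | append_singleton w q ih =>
    by_cases hq : q.1 ∈ M
    · obtain ⟨y, u, rfl, hu, hy⟩ := ih
      refine ⟨y, u ++ [q], by simp, ?_, hy⟩
      intro q' hq'
      rcases List.mem_append.1 hq' with h | h
      · exact hu _ h
      · rw [List.mem_singleton.1 h]; exact hq
    · exact ⟨w ++ [q], [], by simp, by simp, by simpa using hq⟩

lemma IsRelHom.getLast?_iff (hΦ : IsRelHom M Φ) : ∀ (n : ℕ) (w : List (α × Bool)),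
    w.length ≤ n → IsReduced w → ∀ β : α × Bool, β.1 ∉ M →
      (β ∈ (Φ (mk w)).toWord.getLast? ↔ β ∈ w.getLast?) := by
  intro n
  induction n with
  | zero =>
    intro w hw _ β _
    obtain rfl : w = [] := List.length_eq_zero_iff.1 (by omega)
    simp [← one_eq_mk]
  | succ n ih =>
    intro w hw hr β hβ
    obtain ⟨y, u, rfl, hu, hy⟩ := exists_suffix_split M w
    rcases List.eq_nil_or_concat u with rfl | ⟨u', q, rfl⟩
    · rcases List.eq_nil_or_concat y with rfl | ⟨y', β', rfl⟩
      · simp [← one_eq_mk]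
      · simp only [List.concat_eq_append, List.append_nil, List.length_append,
          List.length_singleton] at hw hr hy ⊢
        have hβ' : β'.1 ∉ M := by simpa using hy
        have hy' := isReduced_append_iff.1 hr
        have key : IsReduced ((Φ (mk y')).toWord ++ (mk [β'] : FreeGroup α).toWord) := by
          refine isReduced_append_iff.2 ⟨isReduced_toWord, isReduced_toWord, ?_⟩
          intro a ha b hb hab
          simp only [toWord_mk_singleton, List.head?_cons, Option.mem_def, Option.some.injEq] at hb
          subst hb
          have := (ih y' (by omega) hy'.1 a (by rwa [hab])).1 ha
          exact hy'.2.2 a this _ (by simp) hab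
        rw [mk_append_eq, _root_.map_mul, hΦ.map_letter hβ', toWord_mul_of_isReduced key]
        simp [toWord_mk_singleton]
    · have hr' := isReduced_append_iff.1 hr
      have hsupp := SuppOn.map hΦ.supp hu
      have hne : (Φ (mk (u'.concat q))).toWord ≠ [] := by
        rw [Ne, toWord_eq_nil_iff, map_eq_one_iff _ hΦ.inj, ← toWord_eq_nil_iff,
          toWord_mk_of_isReduced hr'.2.1]
        simp
      have key : IsReduced ((Φ (mk y)).toWord ++ (Φ (mk (u'.concat q))).toWord) := by
        refine isReduced_append_iff.2 ⟨isReduced_toWord, isReduced_toWord, ?_⟩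
        intro a ha b hb hab
        exfalso
        have hbM : b.1 ∈ M := hsupp b (List.mem_of_mem_head? hb)
        rcases List.eq_nil_or_concat y with rfl | ⟨y', β', rfl⟩
        · simp [← one_eq_mk] at ha
        · have hβ' : β'.1 ∉ M := by simpa using hy
          have h1 := (ih (y'.concat β') (by simp at hw ⊢; omega) hr'.1 β' hβ').2 (by simp)
          have : a = β' := Option.some_injective _ (ha.symm.trans h1)
          subst this
          exact hβ' (hab ▸ hbM)
      rw [mk_append_eq, _root_.map_mul, toWord_mul_of_isReduced key, List.getLast?_append_of_ne_nil _ hne]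
      constructor
      · intro h; exact absurd (getLast?_of_suppOn hsupp _ h) hβ
      · intro h
        have : β = q := by simpa using h.symm
        subst this
        exact absurd (hu β (by simp)) hβ

lemma invRev_head? (L : List (α × Bool)) (a : α) (b : Bool) :
    (a, b) ∈ (invRev L).getLast? ↔ (a, !b) ∈ L.head? := by
  simp only [invRev, List.getLast?_reverse, List.head?_map, Option.mem_def, Option.map_eq_some_iff]
  constructor
  · rintro ⟨⟨a', b'⟩, h, h'⟩
    simp only [Prod.mk.injEq] at h'
    rw [h, ← h'.1, ← h'.2]; simp
  · intro h; exact ⟨_, h, by simp⟩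

lemma isReduced_invRev {L : List (α × Bool)} (h : IsReduced L) : IsReduced (invRev L) := by
  rw [isReduced_iff_reduce_eq, reduce_invRev, h.reduce_eq]

lemma IsRelHom.head?_iff (hΦ : IsRelHom M Φ) {w : List (α × Bool)} (hw : IsReduced w)
    {β : α × Bool} (hβ : β.1 ∉ M) : (β ∈ (Φ (mk w)).toWord.head? ↔ β ∈ w.head?) := by
  have := hΦ.getLast?_iff _ (invRev w) le_rfl (isReduced_invRev hw) (β.1, !β.2) hβ
  rw [invRev_head?, ← inv_mk, _root_.map_inv, toWord_inv, invRev_head?] at this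
  simpa using this

lemma IsRelHom.toWord_split (hΦ : IsRelHom M Φ) {x z : List (α × Bool)} {β : α × Bool}
    (hβ : β.1 ∉ M) (h : IsReduced (x ++ [β] ++ z)) :
    (Φ (mk (x ++ [β] ++ z))).toWord = (Φ (mk x)).toWord ++ [β] ++ (Φ (mk z)).toWord := by
  have h1 := isReduced_append_iff.1 h
  have h2 := isReduced_append_iff.1 h1.1
  have k1 : IsReduced ((Φ (mk x)).toWord ++ (mk [β] : FreeGroup α).toWord) := by
    refine isReduced_append_iff.2 ⟨isReduced_toWord, isReduced_toWord, ?_⟩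
    intro a ha b hb hab
    simp only [toWord_mk_singleton, List.head?_cons, Option.mem_def, Option.some.injEq] at hb
    subst hb
    exact h2.2.2 a ((hΦ.getLast?_iff _ x le_rfl h2.1 a (by rwa [hab])).1 ha) _ (by simp) hab
  have e1 := toWord_mul_of_isReduced k1
  have k2 : IsReduced ((Φ (mk x) * mk [β]).toWord ++ (Φ (mk z)).toWord) := by
    refine isReduced_append_iff.2 ⟨isReduced_toWord, isReduced_toWord, ?_⟩
    intro a ha b hb hab
    rw [e1] at ha
    have : β = a := by simpa [toWord_mk_singleton] using ha
    subst this
    exact h1.2.2 β (by simp) b ((hΦ.head?_iff h1.2.1 (by rwa [← hab])).1 hb) hab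
  rw [mk_append_eq, mk_append_eq, _root_.map_mul, _root_.map_mul, hΦ.map_letter hβ, toWord_mul_of_isReduced k2,
    e1]
  rfl

lemma IsRelHom.norm_split (hΦ : IsRelHom M Φ) {x z : List (α × Bool)} {β : α × Bool}
    (hβ : β.1 ∉ M) (h : IsReduced (x ++ [β] ++ z)) :
    (Φ (mk (x ++ [β] ++ z))).norm = (Φ (mk x)).norm + 1 + (Φ (mk z)).norm := by
  simp only [FreeGroup.norm, hΦ.toWord_split hβ h, List.length_append, List.length_singleton]

/-- A reduced word containing a letter of `M` has an `M`-syllable containing it. -/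
lemma exists_syllable (M : Set α) {i : α} (hi : i ∈ M) : ∀ (n : ℕ) (w : List (α × Bool)),
    w.length ≤ n → IsReduced w → (∃ q ∈ w, q.1 = i) → ∃ u, u <:+: w ∧ (∀ q ∈ u, q.1 ∈ M) ∧
      (∃ q ∈ u, q.1 = i) ∧ ∀ Φ : FreeGroup α →* FreeGroup α, IsRelHom M Φ →
        (Φ (mk u)).norm ≤ (Φ (mk w)).norm := by
  intro n
  induction n with
  | zero =>
    rintro w hw - ⟨q, hq, -⟩
    obtain rfl : w = [] := List.length_eq_zero_iff.1 (by omega)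
    simp at hq
  | succ n ih =>
    rintro w hw hr ⟨q, hq, hqi⟩
    by_cases hall : ∀ q ∈ w, q.1 ∈ M
    · exact ⟨w, List.infix_rfl, hall, ⟨q, hq, hqi⟩, fun _ _ => le_rfl⟩
    · push Not at hall
      obtain ⟨β, hβw, hβ⟩ := hall
      obtain ⟨x, z, rfl⟩ := List.append_of_mem hβw
      have hr' : IsReduced (x ++ [β] ++ z) := by simpa using hr
      have h1 := isReduced_append_iff.1 hr'
      have h2 := isReduced_append_iff.1 h1.1
      rw [← List.singleton_append, ← List.append_assoc] at hq hw ⊢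
      simp only [List.length_append, List.length_singleton] at hw
      rcases List.mem_append.1 hq with hq | hq
      · rcases List.mem_append.1 hq with hq | hq
        · obtain ⟨u, hu, huM, hui, hle⟩ := ih x (by omega) h2.1 ⟨q, hq, hqi⟩
          refine ⟨u, hu.trans ⟨[], [β] ++ z, by simp⟩, huM, hui, fun Φ hΦ => ?_⟩
          rw [hΦ.norm_split hβ hr']
          have := hle Φ hΦ
          omega
        · rw [List.mem_singleton] at hq
          subst hq
          exact absurd (hqi ▸ hi) hβ
      · obtain ⟨u, hu, huM, hui, hle⟩ := ih z (by omega) h1.2.1 ⟨q, hq, hqi⟩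
        refine ⟨u, hu.trans ⟨x ++ [β], [], by simp⟩, huM, hui, fun Φ hΦ => ?_⟩
        rw [hΦ.norm_split hβ hr']
        have := hle Φ hΦ
        omega

/-- Norm bound on a syllable of a cyclically reduced word whose conjugacy class is preserved. -/
lemma IsRelHom.norm_le_of_isConj (hΦ : IsRelHom M Φ) {x z : List (α × Bool)} {β : α × Bool}
    (hβ : β.1 ∉ M) (hC : IsCyclicallyReduced (x ++ [β] ++ z))
    (hconj : IsConj (mk (x ++ [β] ++ z)) (Φ (mk (x ++ [β] ++ z)))) :
    (Φ (mk (z ++ x))).norm ≤ (x ++ [β] ++ z).length := by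
  set C := x ++ [β] ++ z with hCdef
  have hred : ∀ q, IsReduced (List.replicate q C).flatten := fun q => (hC.flatten_replicate q).1
  have step : ∀ q : ℕ, q * (Φ (mk (z ++ x))).norm ≤ (Φ (mk (z ++ (List.replicate q C).flatten))).norm := by
    intro q
    induction q with
    | zero => simp
    | succ q ih =>
      have e : z ++ (List.replicate (q + 1) C).flatten =
          (z ++ x) ++ [β] ++ (z ++ (List.replicate q C).flatten) := by
        simp [List.replicate_succ, hCdef]
      have hr : IsReduced (z ++ (List.replicate (q + 1) C).flatten) := by
        refine (hred (q + 2)).infix ⟨x ++ [β], [], ?_⟩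
        simp [List.replicate_succ, hCdef]
      rw [e] at hr ⊢
      rw [hΦ.norm_split hβ hr]
      linarith
  have step' : ∀ q : ℕ, q * (Φ (mk (z ++ x))).norm ≤ (Φ (mk C ^ (q + 1))).norm := by
    intro q
    have e : (List.replicate (q + 1) C).flatten =
        x ++ [β] ++ (z ++ (List.replicate q C).flatten) := by
      simp [List.replicate_succ, hCdef]
    have hr := hred (q + 1)
    rw [mk_pow_eq]
    rw [e] at hr ⊢
    rw [hΦ.norm_split hβ hr]
    have := step q
    omega
  obtain ⟨d, hd⟩ := isConj_iff.1 hconj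
  have up : ∀ q : ℕ, (Φ (mk C ^ q)).norm ≤ 2 * d.norm + q * C.length := by
    intro q
    rw [_root_.map_pow, ← hd, conj_pow]
    have h1 := norm_mul_le (d * mk C ^ q) d⁻¹
    have h2 := norm_mul_le d (mk C ^ q)
    have h3 : (mk C ^ q).norm ≤ q * C.length := by
      rw [mk_pow_eq]
      refine norm_mk_le.trans ?_
      simp
    rw [norm_inv_eq] at h1
    omega
  by_contra hlt
  push Not at hlt
  have h1 := step' (2 * d.norm + C.length + 1)
  have h2 := up (2 * d.norm + C.length + 1 + 1)
  have h3 : (2 * d.norm + C.length + 1) * (C.length + 1) ≤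
      (2 * d.norm + C.length + 1) * (Φ (mk (z ++ x))).norm := Nat.mul_le_mul_left _ hlt
  nlinarith

end FreeGroupWords

section Twists

open FreeGroup

/-- The effect on gate generators of exchanging the two punctures adjacent to gate `i`. -/
def halfTwist (i : ℕ) : FreeGroup ℕ →* FreeGroup ℕ :=
  FreeGroup.lift fun m =>
    if m = i then FreeGroup.of (i + 1) * (FreeGroup.of i)⁻¹ * FreeGroup.of (i - 1)
    else FreeGroup.of m

/-- The projection onto the subgroup of words of alternating sign. -/
def evenHom (N : ℕ) : FreeGroup ℕ →* FreeGroup ℕ :=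
  FreeGroup.lift fun m => if m ≤ N then (FreeGroup.of 0)⁻¹ * FreeGroup.of m else 1

/-- The winding number around the `j`-th puncture. -/
def windHom (j : ℕ) : FreeGroup ℕ →* Multiplicative ℤ :=
  FreeGroup.lift fun m => if m ≤ j then Multiplicative.ofAdd 1 else 1

lemma halfTwist_of_self (i : ℕ) :
    halfTwist i (FreeGroup.of i) = FreeGroup.of (i + 1) * (FreeGroup.of i)⁻¹ * FreeGroup.of (i - 1) := by
  simp [halfTwist]

lemma halfTwist_of_ne {i m : ℕ} (h : m ≠ i) : halfTwist i (FreeGroup.of m) = FreeGroup.of m := by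
  simp [halfTwist, h]

lemma evenHom_of {N m : ℕ} (h : m ≤ N) :
    evenHom N (FreeGroup.of m) = (FreeGroup.of 0)⁻¹ * FreeGroup.of m := by
  simp [evenHom, h]

lemma evenHom_of_lt {N m : ℕ} (h : N < m) : evenHom N (FreeGroup.of m) = 1 := by
  simp [evenHom, not_le.2 h]

lemma windHom_of (j m : ℕ) :
    windHom j (FreeGroup.of m) = if m ≤ j then Multiplicative.ofAdd 1 else 1 := by
  simp [windHom]

lemma windHom_halfTwist {i : ℕ} (hi : 1 ≤ i) (g : FreeGroup ℕ) :
    windHom (i - 1) (halfTwist i g) = windHom i g := by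
  suffices h : (windHom (i - 1)).comp (halfTwist i) = windHom i from DFunLike.congr_fun h g
  ext m
  simp only [MonoidHom.comp_apply]
  by_cases hm : m = i
  · subst hm
    rw [halfTwist_of_self]
    simp only [_root_.map_mul, _root_.map_inv, windHom_of]
    rw [if_neg (by omega), if_neg (by omega)]
    simp
  · rw [halfTwist_of_ne hm, windHom_of, windHom_of]
    have : m ≤ i - 1 ↔ m ≤ i := by omega
    simp only [this]

/-- Words of alternating sign. -/
def Alt (L : List (ℕ × Bool)) : Prop := L.IsChain fun a b => a.2 ≠ b.2

lemma Alt.infix {L L' : List (ℕ × Bool)} (h : Alt L') (hL : L <:+: L') : Alt L :=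
  List.IsChain.infix h hL

lemma Alt.step {L L' : List (ℕ × Bool)} (h : Alt L) (s : Red.Step L L') : Alt L' := by
  cases s with
  | @not L₁ L₂ x b =>
    unfold Alt at *
    rw [List.isChain_append] at h ⊢
    obtain ⟨h1, h2, h3⟩ := h
    rw [List.isChain_cons, List.isChain_cons] at h2
    refine ⟨h1, h2.2.2, ?_⟩
    intro a ha c hc
    have e1 := h3 a ha (x, b) (by simp)
    have e2 := h2.2.1 c hc
    clear h1 h2 h3 ha hc
    rcases a with ⟨_, a2⟩
    rcases c with ⟨_, c2⟩
    cases a2 <;> cases c2 <;> cases b <;> simp_all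

lemma Alt.reduce {L : List (ℕ × Bool)} (h : Alt L) : Alt (FreeGroup.reduce L) := by
  have key : ∀ L', Red L L' → Alt L' := by
    intro L' hL'
    induction hL' with
    | refl => exact h
    | tail _ s ih => exact ih.step s
  exact key _ reduce.red

lemma exists_alt_evenHom (N : ℕ) (g : FreeGroup ℕ) : ∃ L : List (ℕ × Bool), Alt L ∧
    (∀ a ∈ L.head?, a.2 = false) ∧ (∀ a ∈ L.getLast?, a.2 = true) ∧ mk L = evenHom N g := by
  have hmul : ∀ x y : FreeGroup ℕ, (∃ L : List (ℕ × Bool), Alt L ∧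
      (∀ a ∈ L.head?, a.2 = false) ∧ (∀ a ∈ L.getLast?, a.2 = true) ∧ mk L = x) →
      (∃ L : List (ℕ × Bool), Alt L ∧
      (∀ a ∈ L.head?, a.2 = false) ∧ (∀ a ∈ L.getLast?, a.2 = true) ∧ mk L = y) →
      (∃ L : List (ℕ × Bool), Alt L ∧
      (∀ a ∈ L.head?, a.2 = false) ∧ (∀ a ∈ L.getLast?, a.2 = true) ∧ mk L = x * y) := by
    rintro x y ⟨L, h1, h2, h3, rfl⟩ ⟨L', h1', h2', h3', rfl⟩
    refine ⟨L ++ L', ?_, ?_, ?_, rfl⟩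
    · refine List.isChain_append.2 ⟨h1, h1', fun a ha b hb => ?_⟩
      rw [h3 a ha, h2' b hb]; simp
    · intro a ha
      cases L with
      | nil => exact h2' a (by simpa using ha)
      | cons q L => exact h2 a (by simpa using ha)
    · intro a ha
      rcases List.eq_nil_or_concat L' with rfl | ⟨L', q, rfl⟩
      · exact h3 a (by simpa using ha)
      · exact h3' a (by rwa [List.getLast?_append_of_ne_nil _ (by simp)] at ha)
  have hone : (∃ L : List (ℕ × Bool), Alt L ∧
      (∀ a ∈ L.head?, a.2 = false) ∧ (∀ a ∈ L.getLast?, a.2 = true) ∧ mk L = (1 : FreeGroup ℕ)) :=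
    ⟨[], by simp [Alt], by simp, by simp, rfl⟩
  have hpos : ∀ m, ∃ L : List (ℕ × Bool), Alt L ∧
      (∀ a ∈ L.head?, a.2 = false) ∧ (∀ a ∈ L.getLast?, a.2 = true) ∧
        mk L = evenHom N (FreeGroup.of m) := by
    intro m
    by_cases hm : m ≤ N
    · exact ⟨[(0, false), (m, true)], by simp [Alt], by simp, by simp, by rw [evenHom_of hm]; rfl⟩
    · rw [evenHom_of_lt (by omega)]; exact hone
  have hneg : ∀ m, ∃ L : List (ℕ × Bool), Alt L ∧
      (∀ a ∈ L.head?, a.2 = false) ∧ (∀ a ∈ L.getLast?, a.2 = true) ∧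
        mk L = evenHom N (FreeGroup.of m)⁻¹ := by
    intro m
    by_cases hm : m ≤ N
    · refine ⟨[(m, false), (0, true)], by simp [Alt], by simp, by simp, ?_⟩
      rw [_root_.map_inv, evenHom_of hm, mul_inv_rev, inv_inv]; rfl
    · rw [_root_.map_inv, evenHom_of_lt (by omega), inv_one]; exact hone
  induction g using FreeGroup.induction_on with
  | C1 => rw [_root_.map_one]; exact hone
  | of m => exact hpos m
  | inv_of m _ => exact hneg m
  | mul x y hx hy => rw [_root_.map_mul]; exact hmul _ _ hx hy

lemma alt_toWord_evenHom (N : ℕ) (g : FreeGroup ℕ) : Alt (evenHom N g).toWord := by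
  obtain ⟨L, h, -, -, e⟩ := exists_alt_evenHom N g
  rw [← e, toWord_mk]
  exact h.reduce

lemma suppOn_evenHom (N : ℕ) (g : FreeGroup ℕ) : SuppOn {m | m ≤ N} (evenHom N g) := by
  induction g using FreeGroup.induction_on with
  | C1 => rw [_root_.map_one]; exact .one
  | of m =>
    by_cases hm : m ≤ N
    · rw [evenHom_of hm]; exact (SuppOn.of (by simp)).inv.mul (SuppOn.of hm)
    · rw [evenHom_of_lt (by omega)]; exact .one
  | inv_of m h => rw [_root_.map_inv]; exact h.inv
  | mul x y hx hy => rw [_root_.map_mul]; exact hx.mul hy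

/-- The left twisting element at gate `i`. -/
def twA (i : ℕ) : FreeGroup ℕ := FreeGroup.of (i + 1) * (FreeGroup.of (i - 1))⁻¹

/-- The right twisting element at gate `i`. -/
def twB (i : ℕ) : FreeGroup ℕ := (FreeGroup.of (i + 1))⁻¹ * FreeGroup.of (i - 1)

/-- The `n`-th power of the full twist at gate `i`. -/
def fullTwist (i : ℕ) (n : ℤ) : FreeGroup ℕ →* FreeGroup ℕ :=
  FreeGroup.lift fun m => if m = i then twA i ^ n * FreeGroup.of i * twB i ^ n else FreeGroup.of m

lemma fullTwist_of_self (i : ℕ) (n : ℤ) :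
    fullTwist i n (FreeGroup.of i) = twA i ^ n * FreeGroup.of i * twB i ^ n := by
  simp [fullTwist]

lemma fullTwist_of_ne {i m : ℕ} (n : ℤ) (h : m ≠ i) :
    fullTwist i n (FreeGroup.of m) = FreeGroup.of m := by
  simp [fullTwist, h]

lemma fullTwist_twA {i : ℕ} (hi : 1 ≤ i) (n : ℤ) : fullTwist i n (twA i) = twA i := by
  rw [twA, _root_.map_mul, _root_.map_inv, fullTwist_of_ne n (by omega), fullTwist_of_ne n (by omega)]

lemma fullTwist_twB {i : ℕ} (hi : 1 ≤ i) (n : ℤ) : fullTwist i n (twB i) = twB i := by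
  rw [twB, _root_.map_mul, _root_.map_inv, fullTwist_of_ne n (by omega), fullTwist_of_ne n (by omega)]

lemma fullTwist_comp {i : ℕ} (hi : 1 ≤ i) (n n' : ℤ) (g : FreeGroup ℕ) :
    fullTwist i n (fullTwist i n' g) = fullTwist i (n + n') g := by
  suffices h : (fullTwist i n).comp (fullTwist i n') = fullTwist i (n + n') from
    DFunLike.congr_fun h g
  ext m
  simp only [MonoidHom.comp_apply]
  by_cases hm : m = i
  · subst hm
    rw [fullTwist_of_self, fullTwist_of_self, _root_.map_mul, _root_.map_mul, map_zpow, map_zpow,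
      fullTwist_twA hi, fullTwist_twB hi, fullTwist_of_self, add_comm n n', zpow_add, add_comm n' n,
      zpow_add]
    group
  · rw [fullTwist_of_ne _ hm, fullTwist_of_ne _ hm, fullTwist_of_ne _ hm]

lemma fullTwist_zero (i : ℕ) (g : FreeGroup ℕ) : fullTwist i 0 g = g := by
  suffices h : fullTwist i 0 = MonoidHom.id _ from DFunLike.congr_fun h g
  ext m
  by_cases hm : m = i
  · subst hm; simp [fullTwist_of_self]
  · simp [fullTwist_of_ne _ hm]

lemma fullTwist_one {i : ℕ} (hi : 1 ≤ i) (g : FreeGroup ℕ) :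
    fullTwist i 1 g = halfTwist i (halfTwist i g) := by
  suffices h : fullTwist i 1 = (halfTwist i).comp (halfTwist i) from DFunLike.congr_fun h g
  ext m
  simp only [MonoidHom.comp_apply]
  by_cases hm : m = i
  · subst hm
    rw [fullTwist_of_self, halfTwist_of_self]
    simp only [_root_.map_mul, _root_.map_inv]
    rw [halfTwist_of_self, halfTwist_of_ne (by omega), halfTwist_of_ne (by omega), twA, twB]
    group
  · rw [fullTwist_of_ne _ hm, halfTwist_of_ne hm, halfTwist_of_ne hm]

lemma fullTwist_injective {i : ℕ} (hi : 1 ≤ i) (n : ℤ) : Function.Injective (fullTwist i n) := by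
  refine Function.LeftInverse.injective (g := fullTwist i (-n)) fun g => ?_
  rw [fullTwist_comp hi, neg_add_cancel, fullTwist_zero]

/-- The gates meeting the support of the twist at gate `i`. -/
def gateNbhd (i : ℕ) : Set ℕ := {m | m = i - 1 ∨ m = i ∨ m = i + 1}

lemma suppOn_twA (i : ℕ) {M : Set ℕ} (h1 : i - 1 ∈ M) (h2 : i + 1 ∈ M) : SuppOn M (twA i) :=
  (SuppOn.of h2).mul (SuppOn.of h1).inv

lemma suppOn_twB (i : ℕ) {M : Set ℕ} (h1 : i - 1 ∈ M) (h2 : i + 1 ∈ M) : SuppOn M (twB i) :=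
  (SuppOn.of h2).inv.mul (SuppOn.of h1)

lemma fullTwist_isRelHom {i : ℕ} (hi : 1 ≤ i) (n : ℤ) : IsRelHom (gateNbhd i) (fullTwist i n) where
  inj := fullTwist_injective hi n
  fix b hb := fullTwist_of_ne n fun h => hb (by simp [gateNbhd, h])
  supp l hl := by
    have h1 : i - 1 ∈ gateNbhd i := by simp [gateNbhd]
    have h2 : i + 1 ∈ gateNbhd i := by simp [gateNbhd]
    by_cases h : l = i
    · subst h
      rw [fullTwist_of_self]
      exact (((suppOn_twA l h1 h2).zpow n).mul (SuppOn.of hl)).mul ((suppOn_twB l h1 h2).zpow n)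
    · rw [fullTwist_of_ne n h]; exact SuppOn.of hl

lemma fullTwist_of_mem {i : ℕ} (hi : 1 ≤ i) (n : ℤ) {l : ℕ} (hl : l ∈ gateNbhd i) :
    fullTwist i n (FreeGroup.of l) = twA i ^ n * FreeGroup.of l * twB i ^ n := by
  rcases hl with rfl | rfl | rfl
  · rw [fullTwist_of_ne n (by omega)]
    have : twA i = FreeGroup.of (i - 1) * (twB i)⁻¹ * (FreeGroup.of (i - 1))⁻¹ := by
      rw [twA, twB]; group
    rw [this, conj_zpow]; group
  · rw [fullTwist_of_self]
  · rw [fullTwist_of_ne n (by omega)]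
    have : twA i = FreeGroup.of (i + 1) * (twB i)⁻¹ * (FreeGroup.of (i + 1))⁻¹ := by
      rw [twA, twB]; group
    rw [this, conj_zpow]; group

/-- The left factor created by the full twist in front of a word of alternating sign. -/
def leftTw (i : ℕ) (b : Bool) : FreeGroup ℕ := if b then twA i else (twB i)⁻¹

lemma fullTwist_alt {i : ℕ} (hi : 1 ≤ i) (n : ℤ) : ∀ (L : List (ℕ × Bool)) (q : ℕ × Bool),
    Alt (q :: L) → (∀ a ∈ q :: L, a.1 ∈ gateNbhd i) →
      ∃ y, SuppOn {i}ᶜ y ∧ fullTwist i n (mk (q :: L)) = leftTw i q.2 ^ n * mk (q :: L) * y := by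
  have h1 : i - 1 ∈ ({i}ᶜ : Set ℕ) := by simp; omega
  have h2 : i + 1 ∈ ({i}ᶜ : Set ℕ) := by simp
  have letter : ∀ q : ℕ × Bool, q.1 ∈ gateNbhd i →
      fullTwist i n (mk [q]) = leftTw i q.2 ^ n * mk [q] * (leftTw i (!q.2) ^ n)⁻¹ := by
    rintro ⟨a, _ | _⟩ ha
    · rw [mk_singleton_eq]
      simp only [Bool.false_eq_true, if_false, _root_.map_inv, leftTw, Bool.not_false, if_true]
      rw [fullTwist_of_mem hi n ha]; group
    · rw [mk_singleton_eq]
      simp only [if_true, leftTw, Bool.not_true, Bool.false_eq_true, if_false]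
      rw [fullTwist_of_mem hi n ha]; group
  intro L
  induction L with
  | nil =>
    intro q _ hq
    refine ⟨(leftTw i (!q.2) ^ n)⁻¹, ?_, letter q (hq q (by simp))⟩
    refine (SuppOn.zpow ?_ n).inv
    rw [leftTw]
    split_ifs
    exacts [suppOn_twA i h1 h2, (suppOn_twB i h1 h2).inv]
  | cons q' L ih =>
    intro q hA hq
    have hA' : Alt (q' :: L) := List.IsChain.tail hA
    obtain ⟨y, hy, e⟩ := ih q' hA' fun a ha => hq a (List.mem_cons_of_mem _ ha)
    refine ⟨y, hy, ?_⟩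
    have hs : (!q.2) = q'.2 := by
      have := (List.isChain_cons.1 hA).1 q' (by simp)
      cases h : q.2 <;> cases h' : q'.2 <;> simp_all
    rw [mk_cons_eq q, _root_.map_mul, letter q (hq q (by simp)), e, hs]
    group

lemma head?_mul_of_suppOn {i : ℕ} {y : FreeGroup ℕ} (hy : SuppOn {i}ᶜ y) (g : FreeGroup ℕ)
    (b : Bool) (h : (i, b) ∈ (g * y).toWord.head?) : (i, b) ∈ g.toWord.head? := by
  have key : ∀ (L : List (ℕ × Bool)), (∀ q ∈ L, q.1 ≠ i) → ∀ g : FreeGroup ℕ,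
      (i, b) ∈ (g * mk L).toWord.head? → (i, b) ∈ g.toWord.head? := by
    intro L
    induction L with
    | nil => intro _ g hg; simpa [← one_eq_mk] using hg
    | cons q L ih =>
      intro hq g hg
      rw [mk_cons_eq, ← mul_assoc] at hg
      have h1 := ih (fun a ha => hq a (List.mem_cons_of_mem _ ha)) _ hg
      have hqi := hq q (by simp)
      by_cases hr : IsReduced (g.toWord ++ (mk [q] : FreeGroup ℕ).toWord)
      · rw [toWord_mul_of_isReduced hr, toWord_mk_singleton] at h1
        cases hgw : g.toWord with
        | nil =>
          rw [hgw] at h1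
          simp at h1
          simp [h1] at hqi
        | cons a l => rw [hgw] at h1; simpa using h1
      · rcases List.eq_nil_or_concat g.toWord with hgw | ⟨w, a, hgw⟩
        · rw [hgw] at hr
          exact absurd (by simp) hr
        · have hga : a = (q.1, !q.2) := by
            by_contra hne
            refine hr (isReduced_append_iff.2 ⟨isReduced_toWord, isReduced_toWord, ?_⟩)
            intro a' ha' q' hq' e
            rw [hgw] at ha'
            have e1 : a = a' := by simpa using ha'
            have e2 : q = q' := by simpa [toWord_mk_singleton] using hq'
            subst e1 e2
            by_contra h2
            refine hne (Prod.ext e ?_)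
            cases h : a.2 <;> cases h' : q.2 <;> simp_all
          have hg2 : g * mk [q] = mk w := by
            conv_lhs => rw [← mk_toWord (x := g), hgw, List.concat_eq_append, mk_append_eq, hga]
            rcases q with ⟨c, _ | _⟩ <;> simp [mk_singleton_eq]
          have hwr : IsReduced w := by
            have := isReduced_toWord (x := g)
            rw [hgw, List.concat_eq_append] at this
            exact (isReduced_append_iff.1 this).1
          rw [hg2, toWord_mk_of_isReduced hwr] at h1
          rw [hgw, List.concat_eq_append]
          cases w with
          | nil => simp at h1
          | cons a' w => simpa using h1
  have := key y.toWord (fun q hq => hy q hq) g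
  rw [mk_toWord] at this
  exact this h

lemma norm_leftTw_pow {i : ℕ} (hi : 1 ≤ i) (b : Bool) (m : ℕ) :
    (leftTw i b ^ (m : ℤ)).norm = 2 * m := by
  have key : ∀ q q' : ℕ × Bool, q.1 ≠ q'.1 → ((mk [q, q'] : FreeGroup ℕ) ^ (m : ℤ)).norm = 2 * m := by
    intro q q' hne
    have hc : IsCyclicallyReduced [q, q'] :=
      ⟨by simp [FreeGroup.IsReduced, hne], by simp [hne.symm]⟩
    rw [zpow_natCast, mk_pow_eq, norm_mk_of_isReduced (hc.flatten_replicate m).1]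
    simp [mul_comm]
  cases b
  · have : leftTw i false = mk [(i - 1, false), (i + 1, true)] := by
      simp only [leftTw, Bool.false_eq_true, if_false, twB, mul_inv_rev, inv_inv]; rfl
    rw [this]; exact key _ _ (show i - 1 ≠ i + 1 by omega)
  · have : leftTw i true = mk [(i + 1, true), (i - 1, false)] := rfl
    rw [this]; exact key _ _ (show i + 1 ≠ i - 1 by omega)

lemma le_norm_fullTwist {i : ℕ} (hi : 1 ≤ i) (m : ℕ) {u : List (ℕ × Bool)} (hu : Alt u)
    (hr : IsReduced u) (hM : ∀ q ∈ u, q.1 ∈ gateNbhd i) (hui : ∃ q ∈ u, q.1 = i) :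
    2 * m ≤ (fullTwist i m (mk u)).norm + u.length := by
  obtain ⟨x, q, z, rfl, hqi, hx⟩ : ∃ x q z, u = x ++ q :: z ∧ q.1 = i ∧ ∀ a ∈ x, a.1 ≠ i := by
    clear hM hr hu
    induction u with
    | nil => simp at hui
    | cons a u ih =>
      by_cases ha : a.1 = i
      · exact ⟨[], a, u, rfl, ha, by simp⟩
      · obtain ⟨x, q, z, rfl, hq, hx⟩ := ih (by simpa [ha] using hui)
        refine ⟨a :: x, q, z, rfl, hq, ?_⟩
        intro b hb
        rcases List.mem_cons.1 hb with rfl | hb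
        exacts [ha, hx b hb]
  obtain ⟨b, y, hy, e⟩ : ∃ b y, SuppOn {i}ᶜ y ∧
      fullTwist i m (mk (x ++ q :: z)) = leftTw i b ^ (m : ℤ) * mk (x ++ q :: z) * y := by
    cases x with
    | nil => obtain ⟨y, hy, e⟩ := fullTwist_alt hi m z q hu hM; exact ⟨_, y, hy, e⟩
    | cons a x => obtain ⟨y, hy, e⟩ := fullTwist_alt hi m (x ++ q :: z) a hu hM; exact ⟨_, y, hy, e⟩
  have h1 : i - 1 ∈ ({i}ᶜ : Set ℕ) := by simp; omega
  have h2 : i + 1 ∈ ({i}ᶜ : Set ℕ) := by simp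
  set p := leftTw i b ^ (m : ℤ) * mk x with hp
  have hpsupp : SuppOn {i}ᶜ p := by
    refine SuppOn.mul (SuppOn.zpow ?_ _) (SuppOn.mk_of_forall fun a ha => hx a ha)
    rw [leftTw]
    split_ifs
    exacts [suppOn_twA i h1 h2, (suppOn_twB i h1 h2).inv]
  have hr1 := isReduced_append_iff.1 hr
  have hr2 : IsReduced ([q] ++ z) := hr1.2.1
  have hr3 := isReduced_append_iff.1 hr2
  have k1 : IsReduced ((mk [q] : FreeGroup ℕ).toWord ++ (mk z * y).toWord) := by
    refine isReduced_append_iff.2 ⟨isReduced_toWord, isReduced_toWord, ?_⟩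
    intro a ha c hc hac
    have e1 : q = a := by simpa [toWord_mk_singleton] using ha
    subst e1
    have hc' : c = (i, c.2) := Prod.ext (hac.symm.trans hqi) rfl
    rw [hc'] at hc
    have := head?_mul_of_suppOn hy _ _ hc
    rw [toWord_mk_of_isReduced hr3.2.1, ← hc'] at this
    exact hr3.2.2 q (by simp) c this hac
  have k2 : IsReduced (p.toWord ++ (mk [q] * (mk z * y)).toWord) := by
    refine isReduced_append_iff.2 ⟨isReduced_toWord, isReduced_toWord, ?_⟩
    intro a ha c hc hac
    exfalso
    rw [toWord_mul_of_isReduced k1, toWord_mk_singleton] at hc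
    have e1 : q = c := by simpa using hc
    subst e1
    exact hpsupp a (List.mem_of_getLast? ha) (hac.trans hqi)
  have e2 : fullTwist i m (mk (x ++ q :: z)) = p * (mk [q] * (mk z * y)) := by
    rw [e, mk_append_eq, mk_cons_eq, hp]; group
  have h3 : p.norm ≤ (fullTwist i m (mk (x ++ q :: z))).norm := by
    rw [e2, FreeGroup.norm, FreeGroup.norm, toWord_mul_of_isReduced k2]; simp
  have h4 : (leftTw i b ^ (m : ℤ)).norm ≤ p.norm + x.length := by
    have : leftTw i b ^ (m : ℤ) = p * (mk x)⁻¹ := by rw [hp]; group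
    rw [this]
    refine (FreeGroup.norm_mul_le _ _).trans ?_
    rw [norm_inv_eq]
    have := norm_mk_le (L₁ := x)
    omega
  rw [norm_leftTw_pow hi] at h4
  simp only [List.length_append, List.length_cons]
  omega

end Twists

section Labels

open FreeGroup

/-- Annular labels: gate sequences without repetition whose last entry is an inner gate. -/
def Lab (N : ℕ) : Type :=
  {l : List ℕ // l.IsChain (· ≠ ·) ∧ ∀ m ∈ l.getLast?, m ≠ 0 ∧ m ≠ N}

/-- Crossing gate `m`, on lists. -/
def pushList (N m : ℕ) : List ℕ → List ℕ
  | [] => if m = 0 ∨ m = N then [] else [m]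
  | h :: t => if h = m then t else m :: h :: t

lemma pushList_valid {N m : ℕ} {l : List ℕ}
    (h : l.IsChain (· ≠ ·) ∧ ∀ m ∈ l.getLast?, m ≠ 0 ∧ m ≠ N) :
    (pushList N m l).IsChain (· ≠ ·) ∧ ∀ q ∈ (pushList N m l).getLast?, q ≠ 0 ∧ q ≠ N := by
  cases l with
  | nil =>
    by_cases hm : m = 0 ∨ m = N
    · simp [pushList, hm]
    · simp only [pushList, hm, if_false]
      simpa [not_or] using hm
  | cons a t =>
    by_cases ha : a = m
    · simp only [pushList, ha, if_true]
      refine ⟨h.1.tail, fun q hq => h.2 q ?_⟩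
      cases t with
      | nil => simp at hq
      | cons b t => simpa using hq
    · simp only [pushList, ha, if_false]
      exact ⟨List.isChain_cons_cons.2 ⟨Ne.symm ha, h.1⟩, fun q hq => h.2 q (by simpa using hq)⟩

lemma pushList_pushList {N m : ℕ} {l : List ℕ}
    (h : l.IsChain (· ≠ ·) ∧ ∀ m ∈ l.getLast?, m ≠ 0 ∧ m ≠ N) :
    pushList N m (pushList N m l) = l := by
  cases l with
  | nil =>
    by_cases hm : m = 0 ∨ m = N
    · simp [pushList, hm]
    · simp [pushList, hm]
  | cons a t =>
    by_cases ha : a = m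
    · subst ha
      simp only [pushList, if_true]
      cases t with
      | nil =>
        have := h.2 a (by simp)
        simp [pushList, this]
      | cons b t =>
        have := (List.isChain_cons_cons.1 h.1).1
        simp [pushList, this.symm]
    · simp [pushList, ha]

/-- Crossing gate `m`, as a permutation of the labels. -/
def push (N m : ℕ) : Equiv.Perm (Lab N) where
  toFun l := ⟨pushList N m l.1, pushList_valid l.2⟩
  invFun l := ⟨pushList N m l.1, pushList_valid l.2⟩
  left_inv l := Subtype.ext (pushList_pushList l.2)
  right_inv l := Subtype.ext (pushList_pushList l.2)

/-- The action of the gate group on labels. -/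
def labHom (N : ℕ) : FreeGroup ℕ →* Equiv.Perm (Lab N) := FreeGroup.lift (push N)

/-- The empty label. -/
def Lab.nil (N : ℕ) : Lab N := ⟨[], by simp⟩

lemma push_push (N m : ℕ) (l : Lab N) : push N m (push N m l) = l :=
  Subtype.ext (pushList_pushList l.2)

lemma labHom_of (N m : ℕ) : labHom N (FreeGroup.of m) = push N m := by simp [labHom]

lemma push_inv (N m : ℕ) : (push N m)⁻¹ = push N m := by
  ext1 l
  rw [Equiv.Perm.inv_eq_iff_eq, push_push]

lemma labHom_letter (N : ℕ) (q : ℕ × Bool) : labHom N (mk [q]) = push N q.1 := by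
  rcases q with ⟨a, _ | _⟩ <;> simp [mk_singleton_eq, labHom_of, push_inv]

/-- The signed length of the maximal outer prefix of a label. -/
def outerPos (N : ℕ) : List ℕ → ℤ
  | [] => 0
  | m :: t => if m = 0 then 1 - outerPos N t else if m = N then -1 - outerPos N t else 0

lemma outerPos_push_zero {N : ℕ} {l : Lab N} (hl : l.1 ≠ []) :
    outerPos N (push N 0 l).1 = 1 - outerPos N l.1 ∧ (push N 0 l).1 ≠ [] := by
  obtain ⟨l, hc⟩ := l
  change outerPos N (pushList N 0 l) = _ ∧ pushList N 0 l ≠ []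
  cases l with
  | nil => exact absurd rfl hl
  | cons a t =>
    by_cases ha : a = 0
    · subst ha
      refine ⟨by simp [pushList, outerPos], ?_⟩
      simp only [pushList, if_true]
      rintro rfl
      exact (hc.2 0 (by simp)).1 rfl
    · simp [pushList, ha, outerPos]

lemma outerPos_push_last {N : ℕ} (hN : N ≠ 0) {l : Lab N} (hl : l.1 ≠ []) :
    outerPos N (push N N l).1 = -1 - outerPos N l.1 ∧ (push N N l).1 ≠ [] := by
  obtain ⟨l, hc⟩ := l
  change outerPos N (pushList N N l) = _ ∧ pushList N N l ≠ []
  cases l with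
  | nil => exact absurd rfl hl
  | cons a t =>
    by_cases ha : a = N
    · subst ha
      refine ⟨by simp [pushList, outerPos, hN], ?_⟩
      simp only [pushList, if_true]
      rintro rfl
      exact (hc.2 a (by simp)).2 rfl
    · simp [pushList, ha, outerPos, hN]

lemma push_nil_outer {N m : ℕ} (hm : m = 0 ∨ m = N) : push N m (Lab.nil N) = Lab.nil N :=
  Subtype.ext (show pushList N m [] = [] by simp [pushList, hm])

/-- Displacement of `outerPos` under strictly alternating words in the outer gates. -/
lemma outerPos_labHom {N : ℕ} (hN : N ≠ 0) (l : Lab N) (hl : l.1 ≠ []) :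
    ∀ w : List (ℕ × Bool), (∀ q ∈ w, q.1 = 0 ∨ q.1 = N) → w.IsChain (fun a b => a.1 ≠ b.1) →
      (labHom N (mk w) l).1 ≠ [] ∧
      (w.length % 2 = 0 → ∃ e : ℤ, (∀ q ∈ w.head?, e = if q.1 = 0 then 1 else -1) ∧
        outerPos N (labHom N (mk w) l).1 = outerPos N l.1 + e * w.length) ∧
      (w.length % 2 = 1 → ∃ e : ℤ, (∀ q ∈ w.head?, e = if q.1 = 0 then 1 else -1) ∧
        outerPos N (labHom N (mk w) l).1 = e * w.length - outerPos N l.1) := by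
  intro w
  induction w with
  | nil => intro _ _; refine ⟨by simpa [← one_eq_mk] using hl, fun _ => ⟨0, by simp [← one_eq_mk]⟩, by simp⟩
  | cons q w ih =>
    intro hq hc
    obtain ⟨h1, h2, h3⟩ := ih (fun a ha => hq a (List.mem_cons_of_mem _ ha)) hc.tail
    rw [mk_cons_eq, _root_.map_mul, Equiv.Perm.mul_apply, labHom_letter]
    have hhead : ∀ (e : ℤ), (∀ q' ∈ w.head?, e = if q'.1 = 0 then 1 else -1) → w ≠ [] →
        e = - (if q.1 = 0 then 1 else -1) := by
      intro e he hw
      cases w with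
      | nil => exact absurd rfl hw
      | cons a w =>
        have e1 := he a (by simp)
        have e2 := (List.isChain_cons_cons.1 hc).1
        have e3 := hq a (by simp)
        have e4 := hq q (by simp)
        rw [e1]
        rcases e3 with e3 | e3 <;> rcases e4 with e4 | e4 <;> simp_all
    have hstep : outerPos N (push N q.1 (labHom N (mk w) l)).1 =
        (if q.1 = 0 then 1 else -1) - outerPos N (labHom N (mk w) l).1 ∧
        (push N q.1 (labHom N (mk w) l)).1 ≠ [] := by
      rcases hq q (by simp) with e | e
      · rw [e]; simpa using outerPos_push_zero h1
      · rw [e]; simpa [hN] using outerPos_push_last hN h1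
    refine ⟨hstep.2, fun hp => ?_, fun hp => ?_⟩
    · obtain ⟨e, he, he'⟩ := h3 (by simp at hp; omega)
      have := hhead e he (by rintro rfl; simp at hp)
      refine ⟨if q.1 = 0 then 1 else -1, by simp, ?_⟩
      rw [hstep.1, he', this]; push_cast [List.length_cons]; ring
    · obtain ⟨e, he, he'⟩ := h2 (by simp at hp; omega)
      refine ⟨if q.1 = 0 then 1 else -1, by simp, ?_⟩
      rw [hstep.1, he']
      by_cases hw : w = []
      · subst hw; simp
      · rw [hhead e he hw]; push_cast [List.length_cons]; ring

lemma labHom_outer_ne {N : ℕ} (hN : N ≠ 0) (l : Lab N) (hl : l.1 ≠ []) {w : List (ℕ × Bool)}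
    (hw : w ≠ []) (hq : ∀ q ∈ w, q.1 = 0 ∨ q.1 = N) (hc : w.IsChain (fun a b => a.1 ≠ b.1)) :
    labHom N (mk w) l ≠ l := by
  intro hfix
  obtain ⟨-, h2, h3⟩ := outerPos_labHom hN l hl w hq hc
  rw [hfix] at h2 h3
  have hlen : 0 < w.length := List.length_pos_iff.2 hw
  obtain ⟨q, hqh⟩ : ∃ q, q ∈ w.head? := by
    cases w with
    | nil => exact absurd rfl hw
    | cons a w => exact ⟨a, by simp⟩
  rcases Nat.mod_two_eq_zero_or_one w.length with hp | hp
  · obtain ⟨e, he, h⟩ := h2 hp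
    have := he q hqh
    split_ifs at this <;> subst this <;> omega
  · obtain ⟨e, he, h⟩ := h3 hp
    have := he q hqh
    split_ifs at this <;> subst this <;> omega

lemma labHom_outer_nil {N : ℕ} {w : List (ℕ × Bool)} (hq : ∀ q ∈ w, q.1 = 0 ∨ q.1 = N) :
    labHom N (mk w) (Lab.nil N) = Lab.nil N := by
  induction w with
  | nil => simp [← one_eq_mk]
  | cons q w ih =>
    rw [mk_cons_eq, _root_.map_mul, Equiv.Perm.mul_apply,
      ih fun a ha => hq a (List.mem_cons_of_mem _ ha), labHom_letter,
      push_nil_outer (hq q (by simp))]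

/-- `windHom` on alternating words all of whose letters have the same weight. -/
lemma windHom_eq_of_alt {j : ℕ} {P : Prop} {C : List (ℕ × Bool)} (hP : ∀ q ∈ C, q.1 ≤ j ↔ P)
    (hC : Alt (C ++ C)) : windHom j (mk C) = 1 := by
  have key : ∀ n (w : List (ℕ × Bool)), w.length ≤ n → Alt w → (∀ q ∈ w, q.1 ≤ j ↔ P) →
      w.length % 2 = 0 → windHom j (mk w) = 1 := by
    intro n
    induction n with
    | zero =>
      intro w hw _ _ _
      obtain rfl : w = [] := List.length_eq_zero_iff.1 (by omega)
      simp [← one_eq_mk]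
    | succ n ih =>
      intro w hw hA hq hp
      match w, hw, hA, hq, hp with
      | [], _, _, _, _ => simp [← one_eq_mk]
      | [a], _, _, _, hp => simp at hp
      | a :: b :: w, hw, hA, hq, hp =>
        rw [mk_cons_eq, mk_cons_eq b, _root_.map_mul, _root_.map_mul,
          ih w (by simp at hw; omega) (hA.infix ⟨[a, b], [], by simp⟩)
            (fun q h => hq q (by simp [h])) (by simp at hp; omega), mul_one]
        have ha := hq a (by simp)
        have hb := hq b (by simp)
        have hab := (List.isChain_cons_cons.1 hA).1
        obtain ⟨a1, a2⟩ := a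
        obtain ⟨b1, b2⟩ := b
        rw [mk_singleton_eq, mk_singleton_eq]
        simp only at ha hb hab
        have e : windHom j (of a1) = windHom j (of b1) := by
          have hiff : b1 ≤ j ↔ a1 ≤ j := hb.trans ha.symm
          simp only [windHom_of, hiff]
        cases a2 <;> cases b2 <;> simp_all
  refine key _ C le_rfl (hC.infix ⟨[], C, by simp⟩) hP ?_
  have par : ∀ (w : List (ℕ × Bool)) (q : ℕ × Bool), Alt (q :: w) → ∀ b ∈ (q :: w).getLast?,
      (w.length % 2 = 0 ↔ b.2 = q.2) := by
    intro w
    induction w with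
    | nil => intro q _ b hb; simp at hb; simp [hb]
    | cons a w ih =>
      intro q hA b hb
      have := ih a (List.IsChain.tail hA) b (by simpa using hb)
      have hqa := (List.isChain_cons_cons.1 hA).1
      simp only [List.length_cons]
      have h2 : b.2 = q.2 ↔ ¬ b.2 = a.2 := by
        cases h : b.2 <;> cases h' : q.2 <;> cases h'' : a.2 <;> simp_all
      rw [h2, ← this]; omega
  cases C with
  | nil => simp
  | cons q C =>
    obtain ⟨b, hb⟩ : ∃ b, b ∈ (q :: C).getLast? := ⟨_, List.getLast?_eq_some_getLast (by simp)⟩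
    have h1 := par C q (hC.infix ⟨[], q :: C, by simp⟩) b hb
    have h2 := (List.isChain_append.1 hC).2.2 b hb q (by simp)
    simp only [List.length_cons]
    have : ¬ C.length % 2 = 0 := fun h => h2 (h1.1 h)
    omega

/-- A cyclic word which is invariant under all half twists only involves the outer gates. -/
theorem existsUnique_labHom_fixed {k : ℕ} (hk : 2 ≤ k) (c₀ : FreeGroup ℕ)
    (hconj : ∀ i, 1 ≤ i → i ≤ k →
      IsConj (evenHom (k + 1) c₀) (halfTwist i (evenHom (k + 1) c₀)))
    {j : ℕ} (hjk : j ≤ k) (hj : windHom j (evenHom (k + 1) c₀) ≠ 1) :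
    ∃! l : Lab (k + 1), labHom (k + 1) (evenHom (k + 1) c₀) l = l := by
  set N := k + 1 with hN
  set c := evenHom N c₀ with hc
  have hwind : ∀ i ≤ k, windHom i c = windHom 0 c := by
    intro i
    induction i with
    | zero => simp
    | succ i ih =>
      intro hi
      rw [← ih (by omega), ← windHom_halfTwist (by omega)]
      obtain ⟨d, hd⟩ := isConj_iff.1 (hconj (i + 1) (by omega) hi)
      rw [← hd]
      simp [mul_comm]
  have hwne : ∀ i ≤ k, windHom i c ≠ 1 := fun i hi => by
    rw [hwind i hi, ← hwind j hjk]; exact hj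
  set C := reduceCyclically c.toWord with hC
  set u := reduceCyclically.conjugator c.toWord with hu
  have hCred : IsCyclicallyReduced C := reduceCyclically.isCyclicallyReduced isReduced_toWord
  have hword : u ++ C ++ invRev u = c.toWord :=
    reduceCyclically.conj_conjugator_reduceCyclically c.toWord
  have hcC : c = mk u * mk C * (mk u)⁻¹ := by
    rw [inv_mk, ← mk_append_eq, ← mk_append_eq, hword, mk_toWord]
  have hcong : IsConj (mk C) c := isConj_iff.2 ⟨mk u, hcC.symm⟩
  have hwindC : ∀ i ≤ k, windHom i (mk C) ≠ 1 := by
    intro i hi h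
    refine hwne i hi ?_
    rw [hcC, _root_.map_mul, _root_.map_mul, _root_.map_inv, h, mul_one, mul_inv_cancel]
  have hCne : C ≠ [] := by
    intro h
    refine hwindC 0 (by omega) ?_
    rw [h, ← one_eq_mk, _root_.map_one]
  have hCN : ∀ q ∈ C, q.1 ≤ N := by
    intro q hq
    refine suppOn_evenHom N c₀ q ?_
    rw [← hc, ← hword]
    simp [hq]
  have hAlt : Alt (C ++ C) := by
    have h1 : IsReduced (u ++ (List.replicate 2 C).flatten ++ invRev u) := by
      refine IsReduced.append_flatten_replicate_append hCred ?_ (by omega)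
      rw [hword]; exact isReduced_toWord
    have h2 : (c ^ 2).toWord = u ++ (List.replicate 2 C).flatten ++ invRev u := by
      rw [← toWord_mk_of_isReduced h1, mk_append_eq, mk_append_eq, ← mk_pow_eq, ← inv_mk, hcC,
        conj_pow]
    have h3 : Alt (c ^ 2).toWord := by
      rw [hc, ← _root_.map_pow]; exact alt_toWord_evenHom N _
    rw [h2] at h3
    exact h3.infix ⟨u, invRev u, by simp [List.replicate_succ]⟩
  have hCAlt : Alt C := hAlt.infix ⟨[], C, by simp⟩
  have houter : ∀ q ∈ C, q.1 = 0 ∨ q.1 = N := by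
    by_contra hcon
    push Not at hcon
    obtain ⟨q, hqC, hq0, hqN⟩ := hcon
    set i := q.1 with hi
    have hi1 : 1 ≤ i := by omega
    have hik : i ≤ k := by have := hCN q hqC; omega
    have hpow : ∀ m : ℕ, IsConj (mk C) (fullTwist i m (mk C)) := by
      have hhalf : IsConj (mk C) (halfTwist i (mk C)) :=
        (hcong.trans (hconj i hi1 hik)).trans
          (MonoidHom.map_isConj (halfTwist i) hcong.symm)
      have hfull : IsConj (mk C) (fullTwist i 1 (mk C)) := by
        rw [fullTwist_one hi1]
        exact hhalf.trans (MonoidHom.map_isConj (halfTwist i) hhalf)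
      intro m
      induction m with
      | zero => simp only [Nat.cast_zero, fullTwist_zero]; exact IsConj.refl _
      | succ m ih =>
        rw [Nat.cast_succ, add_comm, ← fullTwist_comp hi1]
        exact hfull.trans (MonoidHom.map_isConj (fullTwist i 1) ih)
    obtain ⟨β, hβC, hβ⟩ : ∃ β ∈ C, β.1 ∉ gateNbhd i := by
      by_contra hall
      push Not at hall
      by_cases hik' : i + 1 ≤ k
      · refine hwindC k le_rfl (windHom_eq_of_alt (P := True) (fun q hq => ?_) hAlt)
        have := hall q hq
        simp only [gateNbhd, Set.mem_ofPred_eq] at this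
        simp only [iff_true]
        omega
      · refine hwindC 0 (by omega) (windHom_eq_of_alt (P := False) (fun q hq => ?_) hAlt)
        have := hall q hq
        simp only [gateNbhd, Set.mem_ofPred_eq] at this
        simp only [iff_false]
        omega
    obtain ⟨x, z, hxz⟩ := List.append_of_mem hβC
    have hxz' : C = x ++ [β] ++ z := by simp [hxz]
    have hzxinf : z ++ x <:+: C ++ C := ⟨x ++ [β], [β] ++ z, by simp [hxz']⟩
    have hCC : IsReduced (C ++ C) := by
      simpa [List.replicate_succ] using (hCred.flatten_replicate 2).1
    have hzxr : IsReduced (z ++ x) := hCC.infix hzxinf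
    have hqzx : ∃ a ∈ z ++ x, a.1 = i := by
      refine ⟨q, ?_, rfl⟩
      rw [hxz'] at hqC
      have hqβ : q ≠ β := by
        rintro rfl
        exact hβ (by simp [gateNbhd, hi])
      simp only [List.mem_append, List.mem_singleton, hqβ, or_false] at hqC ⊢
      exact hqC.symm
    obtain ⟨w, hwinf, hwM, hwi, hwle⟩ := exists_syllable (gateNbhd i) (by simp [gateNbhd]) _ _ le_rfl
      hzxr hqzx
    have hwA : Alt w := hAlt.infix (hwinf.trans hzxinf)
    set m := C.length + w.length + 1 with hm
    have b1 := le_norm_fullTwist hi1 m hwA (hzxr.infix hwinf) hwM hwi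
    have hrel := fullTwist_isRelHom hi1 (m : ℤ)
    have b2 := hwle _ hrel
    have b3 := hrel.norm_le_of_isConj hβ (x := x) (z := z) (by rw [← hxz']; exact hCred)
      (by rw [← hxz']; exact hpow m)
    rw [← hxz'] at b3
    omega
  have hchain : C.IsChain (fun a b => a.1 ≠ b.1) := by
    have h1 : C.IsChain (fun a b => a.2 ≠ b.2) := hCAlt
    have h2 : C.IsChain (fun a b => a.1 = b.1 → a.2 = b.2) := hCred.1
    rw [List.isChain_iff_getElem] at h1 h2 ⊢
    intro n hn h
    exact h1 n hn (h2 n hn h)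
  have hiff : ∀ l : Lab N, labHom N c l = l ↔
      labHom N (mk C) ((labHom N (mk u))⁻¹ l) = (labHom N (mk u))⁻¹ l := by
    intro l
    rw [hcC, _root_.map_mul, _root_.map_mul, _root_.map_inv, Equiv.Perm.mul_apply,
      Equiv.Perm.mul_apply, Equiv.Perm.eq_inv_iff_eq]
  refine ⟨labHom N (mk u) (Lab.nil N), ?_, ?_⟩
  · change labHom N c _ = _
    rw [hiff]; simpa using labHom_outer_nil houter
  · intro l hl
    have hl' := (hiff l).1 hl
    by_cases hne : ((labHom N (mk u))⁻¹ l).1 = []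
    · have : (labHom N (mk u))⁻¹ l = Lab.nil N := Subtype.ext hne
      rw [← this]; simp
    · exact absurd hl' (labHom_outer_ne (by omega) _ hne hCne houter hchain)

end Labels

open Topology Filter

section Lifts

/-- `L` trivialises the locally constant cocycle with potentials `pot i` on the charts `U i`. -/
def IsPotLift {Y ι G : Type*} [TopologicalSpace Y] [Group G] (U : ι → Set Y) (pot : ι → Y → G)
    (L : Y → G) : Prop :=
  ∀ i, ∀ y ∈ U i, ∀ᶠ z in 𝓝 y, pot i z * L z = pot i y * L y

/-- On a simply connected space every locally constant cocycle is trivial. -/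
theorem exists_isPotLift {Y ι G : Type*} [TopologicalSpace Y] [Group G] [SimplyConnectedSpace Y]
    [LocallyPathConnectedSpace Y] (U : ι → Set Y) (pot : ι → Y → G) (hU : ∀ i, IsOpen (U i))
    (hcov : ∀ y, ∃ i, y ∈ U i)
    (hpot : ∀ i j, ∀ y ∈ U i, y ∈ U j →
      ∀ᶠ z in 𝓝 y, pot j z * (pot i z)⁻¹ = pot j y * (pot i y)⁻¹) :
    ∃ L : Y → G, IsPotLift U pot L := by
  let _ : TopologicalSpace G := ⊥
  have _ : DiscreteTopology G := ⟨rfl⟩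
  choose ix hix using hcov
  let Z : FiberBundleCore ι Y G :=
    { baseSet := U
      isOpen_baseSet := hU
      indexAt := ix
      mem_baseSet_at := hix
      coordChange := fun i j y v => pot j y * (pot i y)⁻¹ * v
      coordChange_self := by intro i x _ v; simp
      continuousOn_coordChange := by
        rintro i j ⟨y, v⟩ ⟨⟨hi, hj⟩, -⟩
        refine ContinuousAt.continuousWithinAt ?_
        refine ContinuousAt.congr (f := fun q : Y × G => pot j y * (pot i y)⁻¹ * q.2) ?_ ?_
        · fun_prop
        · rw [nhds_prod_eq]
          exact (hpot i j y hi hj).prod_inl _ |>.mono fun q hq => by simp only [hq]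
      coordChange_comp := by
        intro i j k x _ v
        group }
  obtain ⟨y₀⟩ : Nonempty Y := inferInstance
  have hc : IsCoveringMap (Bundle.TotalSpace.proj (F := G) (E := Z.Fiber)) :=
    FiberBundle.isCoveringMap
  obtain ⟨F, ⟨-, hF⟩, -⟩ := hc.existsUnique_continuousMap_lifts (ContinuousMap.id Y) y₀
    (⟨y₀, (1 : G)⟩ : Bundle.TotalSpace G Z.Fiber) rfl
  have hF' : ∀ y, (F y).1 = y := fun y => congrFun hF y
  refine ⟨fun y => (pot (ix y) y)⁻¹ * ((Z.localTriv (ix y)) (F y)).2, fun i y hy => ?_⟩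
  have key : ∀ z ∈ U i, pot i z * ((pot (ix z) z)⁻¹ * ((Z.localTriv (ix z)) (F z)).2)
      = ((Z.localTriv i) (F z)).2 := by
    intro z hz
    have happ : ∀ (i : ι) (w : Bundle.TotalSpace G Z.Fiber), ((Z.localTriv i) w).2 =
        pot i w.1 * (pot (ix w.1) w.1)⁻¹ * (id w.2 : G) := fun _ _ => rfl
    rw [happ, happ, hF' z]
    group
  have hcont : ContinuousAt (fun z => ((Z.localTriv i) (F z)).2) y := by
    have h1 : ContinuousAt (Z.localTriv i) (F y) := by
      refine (Z.localTriv i).continuousAt ?_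
      rw [Z.mem_localTriv_source]
      change (F y).1 ∈ U i
      rwa [hF' y]
    exact continuous_snd.continuousAt.comp (h1.comp F.continuous.continuousAt)
  have h2 : ∀ᶠ z in 𝓝 y, ((Z.localTriv i) (F z)).2 = ((Z.localTriv i) (F y)).2 :=
    hcont.eventually (p := fun v => v = ((Z.localTriv i) (F y)).2) (by rw [nhds_discrete]; simp)
  filter_upwards [h2, (hU i).mem_nhds hy] with z hz hzU
  rw [key z hzU, key y hy, hz]

theorem IsPotLift.exists_eq_mul {Y ι G : Type*} [TopologicalSpace Y] [Group G]
    [PreconnectedSpace Y] [Nonempty Y] {U : ι → Set Y} {pot : ι → Y → G}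
    (hcov : ∀ y, ∃ i, y ∈ U i) {L L' : Y → G} (hL : IsPotLift U pot L)
    (hL' : IsPotLift U pot L') : ∃ c, ∀ y, L' y = L y * c := by
  have h : IsLocallyConstant fun y => (L y)⁻¹ * L' y := by
    rw [IsLocallyConstant.iff_eventually_eq]
    intro y
    obtain ⟨i, hi⟩ := hcov y
    filter_upwards [hL i y hi, hL' i y hi] with z h1 h2
    have : (L z)⁻¹ * L' z = (pot i z * L z)⁻¹ * (pot i z * L' z) := by group
    rw [this, h1, h2]
    group
  obtain ⟨y₀⟩ := ‹Nonempty Y›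
  refine ⟨(L y₀)⁻¹ * L' y₀, fun y => ?_⟩
  rw [← h.apply_eq_of_isPreconnected isPreconnected_univ (Set.mem_univ y) (Set.mem_univ y₀)]
  group

/-- If a lift on the line is multiplied by `c` over a period, all lifts are multiplied by
a conjugate of `c`. -/
theorem IsPotLift.isConj {ι G : Type*} [Group G] {U : ι → Set ℝ} {pot : ι → ℝ → G}
    (hcov : ∀ y, ∃ i, y ∈ U i) {L L' : ℝ → G} (hL : IsPotLift U pot L)
    (hL' : IsPotLift U pot L') {T : ℝ} {c c' : G} (hc : L T = L 0 * c)
    (hc' : L' T = L' 0 * c') : IsConj c c' := by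
  obtain ⟨d, hd⟩ := hL.exists_eq_mul hcov hL'
  rw [hd, hd, hc] at hc'
  refine isConj_iff.2 ⟨d⁻¹, ?_⟩
  have : c' = (L 0 * d)⁻¹ * (L 0 * c * d) := by rw [hc']; group
  rw [this]; group

variable {n : ℕ}

/-- `p` is not on a downward vertical ray starting at a puncture. -/
def InP (a : Fin n → ℂ) (p : ℂ) : Prop := ∀ j, p.re = (a j).re → (a j).im < p.im

/-- `p` is not on an upward vertical ray starting at a puncture. -/
def InQ (a : Fin n → ℂ) (p : ℂ) : Prop := ∀ j, p.re = (a j).re → p.im < (a j).im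

/-- The number of punctures to the left of `p`. -/
noncomputable def str (a : Fin n → ℂ) (p : ℂ) : ℕ :=
  (Finset.univ.filter fun j => (a j).re < p.re).card

lemma str_le (a : Fin n → ℂ) (p : ℂ) : str a p ≤ n := by
  simpa [str] using Finset.card_filter_le (Finset.univ : Finset (Fin n)) (fun j => (a j).re < p.re)

lemma str_comp (a : Fin n → ℂ) (p : ℂ) (σ : Equiv.Perm (Fin n)) : str (a ∘ σ) p = str a p := by
  unfold str
  refine Finset.card_bij (fun j _ => σ j) ?_ ?_ ?_
  · simp
  · simp
  · intro b hb
    exact ⟨σ.symm b, by simpa using hb, by simp⟩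

lemma inP_comp {a : Fin n → ℂ} {p : ℂ} (σ : Equiv.Perm (Fin n)) : InP (a ∘ σ) p ↔ InP a p :=
  ⟨fun h j hj => by simpa using h (σ.symm j) (by simpa using hj), fun h j hj => h (σ j) hj⟩

lemma inQ_comp {a : Fin n → ℂ} {p : ℂ} (σ : Equiv.Perm (Fin n)) : InQ (a ∘ σ) p ↔ InQ a p :=
  ⟨fun h j hj => by simpa using h (σ.symm j) (by simpa using hj), fun h j hj => h (σ j) hj⟩

/-- Configurations listed from left to right. -/
def Chamber (n : ℕ) : Set (Fin n → ℂ) := {a | StrictMono fun j => (a j).re}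

lemma chamber_inP_or_inQ {a : Fin n → ℂ} (ha : a ∈ Chamber n) {p : ℂ} (hp : ∀ j, p ≠ a j) :
    InP a p ∨ InQ a p := by
  by_contra! h
  obtain ⟨h1, h2⟩ := h
  simp only [InP, InQ, not_forall, not_lt] at h1 h2
  obtain ⟨i, hi, hi'⟩ := h1
  obtain ⟨j, hj, hj'⟩ := h2
  obtain rfl : i = j := StrictMono.injective ha (hi.symm.trans hj)
  exact hp i (Complex.ext hi (le_antisymm hi' hj'))

lemma isOpen_chamber : IsOpen (Chamber n) := by
  have : Chamber n = ⋂ i, ⋂ j, ⋂ (_ : i < j), {a : Fin n → ℂ | (a i).re < (a j).re} := by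
    ext a
    simp only [Chamber, Set.mem_ofPred_eq, Set.mem_iInter]
    exact ⟨fun h i j hij => h hij, fun h i j hij => h i j hij⟩
  rw [this]
  refine isOpen_iInter_of_finite fun i => isOpen_iInter_of_finite fun j =>
    isOpen_iInter_of_finite fun _ => isOpen_lt (by fun_prop) (by fun_prop)

lemma convex_chamber : Convex ℝ (Chamber n) := by
  intro a ha b hb s t hs ht hst i j hij
  have h1 : (a i).re < (a j).re := ha hij
  have h2 : (b i).re < (b j).re := hb hij
  simp only [Pi.add_apply, Pi.smul_apply, Complex.add_re, Complex.real_smul, Complex.mul_re,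
    Complex.ofReal_re, Complex.ofReal_im, zero_mul, sub_zero]
  rcases hs.eq_or_lt with rfl | hs
  · have : t = 1 := by linarith
    subst this; simpa using h2
  · nlinarith [mul_lt_mul_of_pos_left h1 hs, mul_le_mul_of_nonneg_left h2.le ht]

lemma nonempty_chamber : (Chamber n).Nonempty :=
  ⟨fun j => (j : ℕ), fun i j h => by simpa using h⟩

instance : LocallyPathConnectedSpace (Chamber n) := isOpen_chamber.locallyPathConnectedSpace

instance : ContractibleSpace (Chamber n) := convex_chamber.contractibleSpace nonempty_chamber

variable {Y : Type*} [TopologicalSpace Y]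

lemma eventually_str_eq {A : Y → Fin n → ℂ} {p : Y → ℂ} (hA : Continuous A) (hp : Continuous p)
    {y : Y} (h : ∀ j, (p y).re ≠ (A y j).re) : ∀ᶠ z in 𝓝 y, str (A z) (p z) = str (A y) (p y) := by
  have hc : ∀ j, Continuous fun z => (A z j).re := fun j => by fun_prop
  have hc' : Continuous fun z => (p z).re := by fun_prop
  have : ∀ j, ∀ᶠ z in 𝓝 y, ((A z j).re < (p z).re ↔ (A y j).re < (p y).re) := by
    intro j
    rcases lt_or_gt_of_ne (h j) with hlt | hlt
    · filter_upwards [(isOpen_lt hc' (hc j)).mem_nhds hlt] with z hz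
      exact iff_of_false (not_lt.2 (le_of_lt hz)) (not_lt.2 hlt.le)
    · filter_upwards [(isOpen_lt (hc j) hc').mem_nhds hlt] with z hz
      exact iff_of_true hz hlt
  filter_upwards [eventually_all.2 this] with z hz
  unfold str
  congr 1
  ext j
  simp [hz j]

lemma isOpen_inP {A : Y → Fin n → ℂ} {p : Y → ℂ} (hA : Continuous A) (hp : Continuous p) :
    IsOpen {y | InP (A y) (p y)} := by
  have : {y | InP (A y) (p y)} =
      ⋂ j, ({y | (p y).re ≠ (A y j).re} ∪ {y | (A y j).im < (p y).im}) := by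
    ext y
    simp only [InP, Set.mem_ofPred_eq, Set.mem_iInter, Set.mem_union]
    exact forall_congr' fun j => by tauto
  rw [this]
  exact isOpen_iInter_of_finite fun j =>
    (isOpen_ne_fun (by fun_prop) (by fun_prop)).union (isOpen_lt (by fun_prop) (by fun_prop))

lemma isOpen_inQ {A : Y → Fin n → ℂ} {p : Y → ℂ} (hA : Continuous A) (hp : Continuous p) :
    IsOpen {y | InQ (A y) (p y)} := by
  have : {y | InQ (A y) (p y)} =
      ⋂ j, ({y | (p y).re ≠ (A y j).re} ∪ {y | (p y).im < (A y j).im}) := by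
    ext y
    simp only [InQ, Set.mem_ofPred_eq, Set.mem_iInter, Set.mem_union]
    exact forall_congr' fun j => by tauto
  rw [this]
  exact isOpen_iInter_of_finite fun j =>
    (isOpen_ne_fun (by fun_prop) (by fun_prop)).union (isOpen_lt (by fun_prop) (by fun_prop))

lemma re_ne_of_inP_inQ {a : Fin n → ℂ} {p : ℂ} (h1 : InP a p) (h2 : InQ a p) (j : Fin n) :
    p.re ≠ (a j).re := fun h => lt_asymm (h1 j h) (h2 j h)

/-- The two charts of the plane minus the punctures. -/
def pqChart (A : Y → Fin n → ℂ) (p : Y → ℂ) : Bool → Set Y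
  | true => {y | InP (A y) (p y)}
  | false => {y | InQ (A y) (p y)}

/-- The potentials on the two charts. -/
noncomputable def pqPot {G : Type*} [Group G] (s : ℕ → G) (A : Y → Fin n → ℂ) (p : Y → ℂ) :
    Bool → Y → G
  | true, _ => 1
  | false, y => s (str (A y) (p y))

/-- Gate-crossing lifts of a moving point in the complement of moving punctures. -/
def GateLift {G : Type*} [Group G] (s : ℕ → G) (A : Y → Fin n → ℂ) (p : Y → ℂ) (L : Y → G) :
    Prop := IsPotLift (pqChart A p) (pqPot s A p) L

variable {G : Type*} [Group G] {s : ℕ → G} {A : Y → Fin n → ℂ} {p : Y → ℂ} {L : Y → G}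

lemma GateLift.inP (h : GateLift s A p L) {y : Y} (hy : InP (A y) (p y)) :
    ∀ᶠ z in 𝓝 y, L z = L y := by
  simpa [pqPot] using h true y hy

lemma GateLift.inQ (h : GateLift s A p L) {y : Y} (hy : InQ (A y) (p y)) :
    ∀ᶠ z in 𝓝 y, s (str (A z) (p z)) * L z = s (str (A y) (p y)) * L y :=
  h false y hy

lemma gateLift_iff : GateLift s A p L ↔ (∀ y, InP (A y) (p y) → ∀ᶠ z in 𝓝 y, L z = L y) ∧
    ∀ y, InQ (A y) (p y) →
      ∀ᶠ z in 𝓝 y, s (str (A z) (p z)) * L z = s (str (A y) (p y)) * L y := by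
  refine ⟨fun h => ⟨fun y hy => h.inP hy, fun y hy => h.inQ hy⟩, fun h i y hy => ?_⟩
  cases i
  · exact h.2 y hy
  · simpa [pqPot] using h.1 y hy

lemma pqChart_cover (hA : ∀ y, A y ∈ Chamber n) (hne : ∀ y j, p y ≠ A y j) (y : Y) :
    ∃ i, y ∈ pqChart A p i := by
  rcases chamber_inP_or_inQ (hA y) (hne y) with h | h
  exacts [⟨true, h⟩, ⟨false, h⟩]

theorem exists_gateLift [SimplyConnectedSpace Y] [LocallyPathConnectedSpace Y] (s : ℕ → G)
    (hAc : Continuous A) (hpc : Continuous p) (hA : ∀ y, A y ∈ Chamber n)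
    (hne : ∀ y j, p y ≠ A y j) : ∃ L, GateLift s A p L := by
  refine exists_isPotLift _ _ ?_ (pqChart_cover hA hne) ?_
  · rintro (_ | _)
    exacts [isOpen_inQ hAc hpc, isOpen_inP hAc hpc]
  · rintro (_ | _) (_ | _) y hi hj
    · simp
    · filter_upwards [eventually_str_eq hAc hpc (re_ne_of_inP_inQ hj hi)] with z hz
      simp only [pqPot, hz]
    · filter_upwards [eventually_str_eq hAc hpc (re_ne_of_inP_inQ hi hj)] with z hz
      simp only [pqPot, hz]
    · simp

lemma GateLift.comp {X : Type*} [TopologicalSpace X] (h : GateLift s A p L) {f : X → Y}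
    (hf : Continuous f) : GateLift s (A ∘ f) (p ∘ f) (L ∘ f) := fun i x hx => by
  have := hf.continuousAt.eventually (h i (f x) (by cases i <;> exact hx))
  cases i <;> exact this

lemma GateLift.map {H : Type*} [Group H] (h : GateLift s A p L) (φ : G →* H) :
    GateLift (fun m => φ (s m)) A p (fun y => φ (L y)) := by
  rw [gateLift_iff]
  refine ⟨fun y hy => (h.inP hy).mono fun z hz => by rw [hz], fun y hy => (h.inQ hy).mono
    fun z hz => ?_⟩
  rw [← _root_.map_mul, hz, _root_.map_mul]

lemma GateLift.congr_of_left {s' : ℕ → G} {g : G} (h : GateLift s A p L)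
    (hs : ∀ m ≤ n, s' m = g * s m) : GateLift s' A p L := by
  rw [gateLift_iff]
  refine ⟨fun y hy => h.inP hy, fun y hy => (h.inQ hy).mono fun z hz => ?_⟩
  rw [hs _ (str_le _ _), hs _ (str_le _ _), mul_assoc, hz, mul_assoc]

lemma GateLift.exists_eq_mul [PreconnectedSpace Y] [Nonempty Y] (hA : ∀ y, A y ∈ Chamber n)
    (hne : ∀ y j, p y ≠ A y j) {L' : Y → G} (h : GateLift s A p L) (h' : GateLift s A p L') :
    ∃ c, ∀ y, L' y = L y * c :=
  IsPotLift.exists_eq_mul (pqChart_cover hA hne) h h'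

end Lifts

section Sections

/-- Rotation by `t` full turns. -/
noncomputable def rot (t : ℝ) : ℂ := Complex.exp (2 * Real.pi * t * Complex.I)

lemma rot_add (s t : ℝ) : rot (s + t) = rot s * rot t := by
  rw [rot, rot, rot, ← Complex.exp_add]; congr 1; push_cast; ring

@[simp] lemma rot_zero : rot 0 = 1 := by simp [rot]

@[simp] lemma rot_one : rot 1 = 1 := by simp [rot, Complex.exp_two_pi_mul_I]

lemma rot_ne_zero (t : ℝ) : rot t ≠ 0 := Complex.exp_ne_zero _

@[simp] lemma norm_rot (t : ℝ) : ‖rot t‖ = 1 := by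
  have : 2 * (Real.pi : ℂ) * t * Complex.I = ((2 * Real.pi * t : ℝ) : ℂ) * Complex.I := by
    push_cast; ring
  rw [rot, this, Complex.norm_exp_ofReal_mul_I]

lemma rot_mul_rot_neg (t : ℝ) : rot t * rot (-t) = 1 := by rw [← rot_add]; simp

lemma rot_neg_mul_rot (t : ℝ) : rot (-t) * rot t = 1 := by rw [← rot_add]; simp

@[fun_prop] lemma continuous_rot : Continuous rot := by unfold rot; fun_prop

lemma rot_re_mul (t : ℝ) (w : ℂ) :
    (rot t * w).re = Real.cos (2 * Real.pi * t) * w.re - Real.sin (2 * Real.pi * t) * w.im := by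
  have : 2 * (Real.pi : ℂ) * t * Complex.I = ((2 * Real.pi * t : ℝ) : ℂ) * Complex.I := by
    push_cast; ring
  rw [Complex.mul_re, rot, this, Complex.exp_ofReal_mul_I_re, Complex.exp_ofReal_mul_I_im]

variable {n : ℕ}

lemma injective_smul {x : Fin n → ℂ} (hx : Function.Injective x) {c : ℂ} (hc : c ≠ 0) :
    Function.Injective (c • x) := fun _ _ h => hx (mul_left_cancel₀ hc h)

/-- A finite family of directions. -/
noncomputable def dir (n l : ℕ) : ℝ := l / (2 * (n ^ 2 + 1))

/-- Every configuration has distinct real parts after one of the finitely many rotations. -/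
lemma exists_dir {x : Fin n → ℂ} (hx : Function.Injective x) :
    ∃ l < n ^ 2 + 1, Function.Injective fun j => (rot (-dir n l) * x j).re := by
  by_contra! h
  have h' : ∀ l : Fin (n ^ 2 + 1), ∃ q : Fin n × Fin n,
      q.1 ≠ q.2 ∧ (rot (-dir n l) * (x q.1 - x q.2)).re = 0 := by
    intro l
    have := h l l.2
    simp only [Function.Injective, not_forall] at this
    obtain ⟨i, j, hij, hne⟩ := this
    exact ⟨(i, j), hne, by rw [mul_sub, Complex.sub_re]; linarith⟩
  choose f hf1 hf2 using h'
  obtain ⟨l, l', hne, heq⟩ := Fintype.exists_ne_map_eq_of_card_lt f (by simp [sq])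
  set w := rot (-dir n l') * (x (f l').1 - x (f l').2) with hw
  have hw0 : w ≠ 0 := mul_ne_zero (rot_ne_zero _) (sub_ne_zero.2 (hx.ne (hf1 l')))
  have h1 : w.re = 0 := hf2 l'
  have h2 := hf2 l
  have h3 : rot (-dir n l) * (x (f l).1 - x (f l).2) = rot (dir n l' - dir n l) * w := by
    rw [heq, hw, ← mul_assoc, ← rot_add]; congr 2; ring
  rw [h3, rot_re_mul, h1] at h2
  have h4 : w.im ≠ 0 := fun h => hw0 (Complex.ext h1 h)
  have h5 : Real.sin (2 * Real.pi * (dir n l' - dir n l)) = 0 := by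
    have : Real.sin (2 * Real.pi * (dir n l' - dir n l)) * w.im = 0 := by linarith
    exact (mul_eq_zero.1 this).resolve_right h4
  have hb : ∀ m : Fin (n ^ 2 + 1), 0 ≤ dir n m ∧ dir n m < 1 / 2 := by
    intro m
    have hm : ((m : ℕ) : ℝ) < n ^ 2 + 1 := by exact_mod_cast m.2
    refine ⟨by unfold dir; positivity, ?_⟩
    unfold dir
    rw [div_lt_div_iff₀ (by positivity) (by norm_num)]
    linarith
  have hpi := Real.pi_pos
  have h6 := (Real.sin_eq_zero_iff_of_lt_of_lt
    (by nlinarith [hb l, hb l']) (by nlinarith [hb l, hb l'])).1 h5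
  have h7 : dir n l' = dir n l := by
    have := (mul_eq_zero.1 h6).resolve_left (by positivity)
    linarith
  unfold dir at h7
  have h8 : ((l' : ℕ) : ℝ) = ((l : ℕ) : ℝ) := by
    field_simp at h7
    exact h7
  exact hne (Fin.ext (by exact_mod_cast h8.symm))

/-- A section of the forgetful map, in terms of its added point. -/
structure IsSec (g : (Fin n → ℂ) → ℂ) : Prop where
  cont : ContinuousOn g {x | Function.Injective x}
  avoid : ∀ x, Function.Injective x → ∀ j, g x ≠ x j
  symm : ∀ x, Function.Injective x → ∀ σ : Equiv.Perm (Fin n), g (x ∘ σ) = g x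

/-- The loop described by the added point when the configuration rotates, seen from a
co-rotating frame. -/
noncomputable def loop (g : (Fin n → ℂ) → ℂ) (x : Fin n → ℂ) (t : ℝ) : ℂ :=
  rot (-t) * g (rot t • x)

variable {g : (Fin n → ℂ) → ℂ} {Y : Type*} [TopologicalSpace Y]

lemma IsSec.continuous_comp (hg : IsSec g) {A : Y → Fin n → ℂ} (hA : Continuous A)
    (hi : ∀ y, Function.Injective (A y)) : Continuous fun y => g (A y) :=
  hg.cont.comp_continuous hA hi

lemma IsSec.continuous_loop (hg : IsSec g) {A : Y → Fin n → ℂ} {t : Y → ℝ} (hA : Continuous A)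
    (hi : ∀ y, Function.Injective (A y)) (ht : Continuous t) :
    Continuous fun y => loop g (A y) (t y) := by
  unfold loop
  refine Continuous.mul (by fun_prop) (hg.continuous_comp (by fun_prop) fun y => ?_)
  exact injective_smul (hi y) (rot_ne_zero _)

lemma IsSec.loop_ne (hg : IsSec g) {x : Fin n → ℂ} (hx : Function.Injective x) (t : ℝ)
    (j : Fin n) : loop g x t ≠ x j := by
  intro h
  refine hg.avoid _ (injective_smul hx (rot_ne_zero t)) j ?_
  rw [Pi.smul_apply, smul_eq_mul, ← h, loop, ← mul_assoc, rot_mul_rot_neg, one_mul]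

@[simp] lemma loop_zero (x : Fin n → ℂ) : loop g x 0 = g x := by simp [loop]

lemma loop_rot (x : Fin n → ℂ) (s t : ℝ) : loop g (rot s • x) t = rot s * loop g x (t + s) := by
  rw [loop, loop, smul_smul, ← rot_add, ← mul_assoc, ← rot_add]; congr 2; ring

lemma loop_add_one (x : Fin n → ℂ) (t : ℝ) : loop g x (t + 1) = loop g x t := by
  have h : rot (-(t + 1)) = rot (-t) := by
    have := rot_add (-(t + 1)) 1
    rw [rot_one, mul_one] at this
    rw [← this]; congr 1; ring
  rw [loop, loop, h, rot_add, rot_one, mul_one]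

lemma IsSec.loop_comp (hg : IsSec g) {x : Fin n → ℂ} (hx : Function.Injective x)
    (σ : Equiv.Perm (Fin n)) (t : ℝ) : loop g (x ∘ σ) t = loop g x t := by
  rw [loop, loop, ← hg.symm _ (injective_smul hx (rot_ne_zero t)) σ]; rfl

lemma chamber_injective {a : Fin n → ℂ} (ha : a ∈ Chamber n) : Function.Injective a :=
  fun _ _ h => StrictMono.injective ha (congrArg Complex.re h)

lemma exists_sort {x : Fin n → ℂ} (h : Function.Injective fun j => (x j).re) :
    ∃ σ : Equiv.Perm (Fin n), x ∘ σ ∈ Chamber n :=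
  ⟨Tuple.sort fun j => (x j).re, (Tuple.monotone_sort fun j => (x j).re).strictMono_of_injective
    (h.comp (Equiv.injective _))⟩

/-- The gate lift of the rotation loops of a section over a chamber, with its holonomy. -/
theorem IsSec.exists_lift (hg : IsSec g) :
    ∃ (L : Chamber n × ℝ → FreeGroup ℕ) (c₀ : FreeGroup ℕ),
      GateLift FreeGroup.of (fun y => (y.1 : Fin n → ℂ)) (fun y => loop g y.1 y.2) L ∧
      ∀ a t, L (a, t + 1) = L (a, t) * evenHom n c₀ := by
  have hA : Continuous fun y : Chamber n × ℝ => (y.1 : Fin n → ℂ) := by fun_prop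
  have hAi : ∀ y : Chamber n × ℝ, Function.Injective (y.1 : Fin n → ℂ) :=
    fun y => chamber_injective y.1.2
  have hne : ∀ (y : Chamber n × ℝ) j, loop g y.1 y.2 ≠ y.1.1 j :=
    fun y j => hg.loop_ne (hAi y) _ j
  obtain ⟨L, hL⟩ := exists_gateLift FreeGroup.of hA (hg.continuous_loop hA hAi continuous_snd)
    (fun y => y.1.2) hne
  have hL' := hL.comp (f := fun y : Chamber n × ℝ => (y.1, y.2 + 1)) (by fun_prop)
  have e : (fun y : Chamber n × ℝ => loop g y.1 y.2) ∘
      (fun y : Chamber n × ℝ => (y.1, y.2 + 1)) = fun y => loop g y.1 y.2 := by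
    funext y; exact loop_add_one _ _
  rw [e] at hL'
  have _ : Nonempty (Chamber n × ℝ) := inferInstance
  obtain ⟨c, hc⟩ := hL.exists_eq_mul (fun y => y.1.2) hne hL'
  refine ⟨fun y => evenHom n (L y), c, (hL.map (evenHom n)).congr_of_left (g := FreeGroup.of 0) ?_,
    fun a t => ?_⟩
  · intro m hm
    rw [evenHom_of hm]; group
  · rw [← _root_.map_mul, ← hc (a, t)]; rfl

lemma str_le_iff {a : Fin n → ℂ} (ha : a ∈ Chamber n) (p : ℂ) (j : Fin n) :
    str a p ≤ j ↔ p.re ≤ (a j).re := by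
  constructor
  · intro h
    by_contra! hlt
    have : Finset.Iic j ⊆ Finset.univ.filter fun l => (a l).re < p.re := by
      intro l hl
      simp only [Finset.mem_filter, Finset.mem_univ, true_and]
      exact lt_of_le_of_lt (StrictMono.monotone ha (Finset.mem_Iic.1 hl)) hlt
    have h2 := Finset.card_le_card this
    rw [Fin.card_Iic] at h2
    unfold str at h
    omega
  · intro h
    have : (Finset.univ.filter fun l => (a l).re < p.re) ⊆ Finset.Iio j := by
      intro l hl
      simp only [Finset.mem_filter, Finset.mem_univ, true_and] at hl
      exact Finset.mem_Iio.2 ((StrictMono.lt_iff_lt ha).1 (lt_of_lt_of_le hl h))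
    have h2 := Finset.card_le_card this
    rw [Fin.card_Iio] at h2
    exact h2

lemma log_neg_eq {z : ℂ} (hz : z ∈ Complex.slitPlane) :
    Complex.log (-z) = Complex.log z - Real.pi * Complex.I +
      2 * Real.pi * Complex.I * (if z.im ≤ 0 then 1 else 0) := by
  have h1 : Complex.log (-z) = Real.log ‖z‖ + (-z).arg * Complex.I := by
    rw [Complex.log, norm_neg]
  rw [h1, Complex.log]
  rcases lt_trichotomy z.im 0 with h | h | h
  · rw [Complex.arg_neg_eq_arg_add_pi_of_im_neg h, if_pos h.le]; push_cast; ring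
  · have hre : 0 < z.re := by
      rcases hz with h' | h'
      · exact h'
      · exact absurd h h'
    have e : z = (z.re : ℂ) := Complex.ext rfl (by simp [h])
    have e2 : (-z).arg = Real.pi := by
      rw [e, ← Complex.ofReal_neg]
      exact Complex.arg_ofReal_of_neg (by linarith)
    have e3 : z.arg = 0 := by rw [e]; exact Complex.arg_ofReal_of_nonneg hre.le
    rw [e2, e3, if_pos h.le]; push_cast; ring
  · rw [Complex.arg_neg_eq_arg_sub_pi_of_im_pos h, if_neg (not_le.2 h)]; push_cast; ring

/-- A gate lift provides a continuous logarithm of the position relative to a puncture. -/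
lemma GateLift.continuous_log {a : Fin n → ℂ} (ha : a ∈ Chamber n) {p : Y → ℂ}
    (hp : Continuous p) (hne : ∀ y j, p y ≠ a j) {L : Y → FreeGroup ℕ}
    (hL : GateLift FreeGroup.of (fun _ => a) p L) (j : Fin n) :
    Continuous fun y => Complex.log (-(Complex.I * (p y - a j))) +
      2 * Real.pi * Complex.I * ((windHom j (L y)).toAdd : ℂ) := by
  rw [continuous_iff_continuousAt]
  intro y
  rcases chamber_inP_or_inQ ha (hne y) with h | h
  · have h1 : -(Complex.I * (p y - a j)) ∈ Complex.slitPlane := by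
      rw [Complex.mem_slitPlane_iff]
      simp only [Complex.neg_re, Complex.mul_re, Complex.I_re, Complex.sub_re, zero_mul,
        Complex.I_im, Complex.sub_im, one_mul, Complex.neg_im, Complex.mul_im]
      by_cases h' : (p y).re = (a j).re
      · left; linarith [h j h']
      · right; intro h''; exact h' (by linarith)
    have h2 : ContinuousAt (fun z => Complex.log (-(Complex.I * (p z - a j))) +
        2 * Real.pi * Complex.I * ((windHom j (L y)).toAdd : ℂ)) y := by
      refine ContinuousAt.add (ContinuousAt.clog (by fun_prop) h1) continuousAt_const
    refine h2.congr ?_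
    filter_upwards [hL.inP h] with z hz
    simp only [hz]
  · have h1 : Complex.I * (p y - a j) ∈ Complex.slitPlane := by
      rw [Complex.mem_slitPlane_iff]
      simp only [Complex.mul_re, Complex.I_re, Complex.sub_re, zero_mul,
        Complex.I_im, Complex.sub_im, one_mul, Complex.mul_im]
      by_cases h' : (p y).re = (a j).re
      · left; linarith [h j h']
      · right; intro h''; exact h' (by linarith)
    set C : ℂ := ((windHom j (FreeGroup.of (str a (p y)) * L y)).toAdd : ℂ) with hC
    have h2 : ContinuousAt (fun z => Complex.log (Complex.I * (p z - a j)) -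
        Real.pi * Complex.I + 2 * Real.pi * Complex.I * C) y := by
      refine ContinuousAt.add (ContinuousAt.sub (ContinuousAt.clog (by fun_prop) h1)
        continuousAt_const) continuousAt_const
    refine h2.congr ?_
    have hs : ∀ᶠ z in 𝓝 y, Complex.I * (p z - a j) ∈ Complex.slitPlane :=
      (by fun_prop : ContinuousAt (fun z => Complex.I * (p z - a j)) y).eventually
        (Complex.isOpen_slitPlane.mem_nhds h1)
    filter_upwards [hL.inQ h, hs] with z hz hz'
    rw [log_neg_eq hz', hC, ← hz, _root_.map_mul, windHom_of]
    have e : (Complex.I * (p z - a j)).im ≤ 0 ↔ str a (p z) ≤ j := by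
      rw [str_le_iff ha]; simp
    simp only [e]
    split_ifs <;> simp <;> ring

end Sections

section Winding

lemma exists_perm_of_range_subset {n : ℕ} {X : Type*} {x y : Fin n → X} (hy : Function.Injective y)
    (h : ∀ i, ∃ j, x j = y i) : ∃ σ : Equiv.Perm (Fin n), y = x ∘ σ := by
  choose f hf using h
  have hfi : Function.Injective f := fun i j hij => hy (by rw [← hf, ← hf, hij])
  exact ⟨Equiv.ofBijective f (Finite.injective_iff_bijective.1 hfi), funext fun i => (hf i).symm⟩

/-- The configuration consisting of the origin and the `k`-th roots of unity. -/
noncomputable def rootsCfg (k : ℕ) : Fin (k + 1) → ℂ :=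
  Fin.cons 0 fun j : Fin k => rot (1 / k) ^ (j : ℕ)

lemma isPrimitiveRoot_rot {k : ℕ} (hk : k ≠ 0) : IsPrimitiveRoot (rot (1 / k)) k := by
  have := Complex.isPrimitiveRoot_exp k hk
  convert this using 1
  rw [rot]; congr 1; push_cast; ring

lemma injective_rootsCfg {k : ℕ} (hk : k ≠ 0) : Function.Injective (rootsCfg k) := by
  refine Fin.cons_injective_iff.2 ⟨?_, ?_⟩
  · rintro ⟨j, hj⟩
    exact pow_ne_zero _ (rot_ne_zero _) hj
  · intro i j hij
    exact Fin.ext ((isPrimitiveRoot_rot hk).pow_inj i.2 j.2 hij)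

lemma rot_smul_rootsCfg {k : ℕ} (hk : k ≠ 0) :
    ∃ σ : Equiv.Perm (Fin (k + 1)), rot (1 / k) • rootsCfg k = rootsCfg k ∘ σ := by
  refine exists_perm_of_range_subset (injective_smul (injective_rootsCfg hk) (rot_ne_zero _)) ?_
  intro i
  induction i using Fin.cases with
  | zero => exact ⟨0, by simp [rootsCfg]⟩
  | succ i =>
    by_cases h : (i : ℕ) + 1 < k
    · exact ⟨Fin.succ ⟨i + 1, h⟩, pow_succ' (rot (1 / k)) i⟩
    · refine ⟨Fin.succ ⟨0, by omega⟩, ?_⟩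
      have e : (i : ℕ) + 1 = k := by omega
      have : rot (1 / k) * rot (1 / k) ^ (i : ℕ) = 1 := by
        rw [← pow_succ', e, (isPrimitiveRoot_rot hk).pow_eq_one]
      exact (pow_zero _).trans this.symm

/-- A loop with a rotational symmetry of order `k ≥ 2` has non-zero winding number. -/
lemma false_of_periodic_log {k : ℕ} (hk : 2 ≤ k) {H : ℝ → ℂ} (hH : Continuous H)
    (hper : ∀ t, H (t + 1) = H t)
    (hrot : ∀ t, Complex.exp (H (t + 1 / k)) = rot (-(1 / k)) * Complex.exp (H t)) : False := by
  have hk0 : (k : ℝ) ≠ 0 := by positivity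
  have hpi : (Real.pi : ℂ) ≠ 0 := by exact_mod_cast Real.pi_ne_zero
  have h1 : ∀ t, ∃ m : ℤ, H (t + 1 / k) - H t + 2 * Real.pi * Complex.I / k =
      m * (2 * Real.pi * Complex.I) := by
    intro t
    rw [← Complex.exp_eq_one_iff, Complex.exp_add, Complex.exp_sub, hrot, rot,
      mul_div_assoc, div_self (Complex.exp_ne_zero _), mul_one, ← Complex.exp_add]
    rw [Complex.exp_eq_one_iff]
    exact ⟨0, by push_cast; ring⟩
  choose m hm using h1
  have hmc : Continuous m := by
    rw [Int.isClosedEmbedding_coe_real.isInducing.continuous_iff]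
    have e : (fun x : ℤ => (x : ℝ)) ∘ m = fun t => ((H (t + 1 / k) - H t +
        2 * Real.pi * Complex.I / k) / (2 * Real.pi * Complex.I)).re := by
      funext t
      rw [hm, mul_div_cancel_right₀ _ (by simp [hpi])]
      simp
    rw [e]
    fun_prop
  have hconst : ∀ t, m t = m 0 := fun t => PreconnectedSpace.constant inferInstance hmc
  have hstep : ∀ i : ℕ, H (0 + i * (1 / k)) = H 0 + i * (2 * Real.pi * Complex.I * (m 0 - 1 / k)) := by
    intro i
    induction i with
    | zero => simp
    | succ i ih =>
      have := hm (0 + i * (1 / k))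
      rw [hconst, ih] at this
      have e : (0 + ((i + 1 : ℕ) : ℝ) * (1 / k) : ℝ) = 0 + i * (1 / k) + 1 / k := by push_cast; ring
      rw [e]
      push_cast
      linear_combination this
  have h2 := hstep k
  have e : (0 + (k : ℝ) * (1 / k)) = 0 + 1 := by field_simp
  rw [e, hper] at h2
  have hk0' : (k : ℂ) ≠ 0 := by exact_mod_cast hk0
  have h3 : (k : ℂ) * (2 * Real.pi * Complex.I * (m 0 - 1 / k)) = 0 := by
    linear_combination -h2
  have h4 : (k : ℂ) * m 0 = 1 := by
    have h5 : (2 * Real.pi * Complex.I) * ((k : ℂ) * m 0 - 1) = 0 := by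
      rw [← h3]; field_simp
    have := (mul_eq_zero.1 h5).resolve_left (by simp [hpi])
    linear_combination this
  have h5 : (k : ℤ) * m 0 = 1 := by exact_mod_cast h4
  have h6 := Int.eq_one_or_neg_one_of_mul_eq_one h5
  omega

theorem IsSec.exists_wind_ne {k : ℕ} (hk : 2 ≤ k) {g : (Fin (k + 1) → ℂ) → ℂ} (hg : IsSec g)
    {L : Chamber (k + 1) × ℝ → FreeGroup ℕ} {c : FreeGroup ℕ}
    (hL : GateLift FreeGroup.of (fun y => (y.1 : Fin (k + 1) → ℂ)) (fun y => loop g y.1 y.2) L)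
    (hc : ∀ a t, L (a, t + 1) = L (a, t) * c) : ∃ j ≤ k, windHom j c ≠ 1 := by
  have hk0 : k ≠ 0 := by omega
  obtain ⟨l, -, hl⟩ := exists_dir (injective_rootsCfg hk0)
  set x := rot (-dir (k + 1) l) • rootsCfg k with hx
  have hxi : Function.Injective x := injective_smul (injective_rootsCfg hk0) (rot_ne_zero _)
  obtain ⟨σ, hσ⟩ := exists_sort (x := x) hl
  obtain ⟨ρ, hρ⟩ := rot_smul_rootsCfg hk0
  have hloop : ∀ t, loop g x (t + 1 / k) = rot (-(1 / k)) * loop g x t := by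
    intro t
    have h1 : rot (1 / k) • x = x ∘ ρ := by
      rw [hx, smul_comm, hρ]; rfl
    have h2 := loop_rot (g := g) x (1 / k) t
    rw [h1, hg.loop_comp hxi] at h2
    rw [h2, ← mul_assoc, rot_neg_mul_rot, one_mul]
  set a : Chamber (k + 1) := ⟨x ∘ σ, hσ⟩ with ha
  set j := σ.symm 0 with hj
  have haj : a.1 j = 0 := by simp [ha, hj, hx, rootsCfg]
  have hpa : ∀ t, loop g a t = loop g x t := fun t => hg.loop_comp hxi σ t
  refine ⟨j, by omega, fun hw => ?_⟩
  have hLa := hL.comp (f := fun t : ℝ => (a, t)) (by fun_prop)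
  have hai := chamber_injective a.2
  have hH := GateLift.continuous_log a.2 (hg.continuous_loop continuous_const (fun _ => hai)
    continuous_id) (fun t i => hg.loop_ne hai t i) hLa j
  refine false_of_periodic_log hk hH (fun t => ?_) (fun t => ?_)
  · simp only [id, Function.comp, hc, loop_add_one, _root_.map_mul, hw, mul_one]
  · have hexp : ∀ (z : ℂ) (v : ℤ), z ≠ 0 →
        Complex.exp (Complex.log z + 2 * Real.pi * Complex.I * (v : ℂ)) = z := by
      intro z v hz
      rw [Complex.exp_add, Complex.exp_log hz, mul_comm (2 * (Real.pi : ℂ) * Complex.I),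
        Complex.exp_int_mul_two_pi_mul_I, mul_one]
    have hne : ∀ t, -(Complex.I * (loop g a (id t) - a.1 j)) ≠ 0 := fun t =>
      neg_ne_zero.2 (mul_ne_zero Complex.I_ne_zero (sub_ne_zero.2 (hg.loop_ne hai _ _)))
    rw [hexp _ _ (hne _), hexp _ _ (hne _), haj]
    simp only [id, hpa, hloop]
    ring

end Winding

section HalfTwist

variable {n : ℕ}

/-- A family of configurations in which the puncture `i` passes above the puncture `i + 1`. -/
noncomputable def swapCfg (n i : ℕ) (h : ℝ) : Fin n → ℂ := fun j =>
  if (j : ℕ) = i then ⟨4 * i + h, 1⟩ else if (j : ℕ) = i + 1 then ⟨4 * i, 0⟩ else ⟨4 * j, 0⟩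

lemma continuous_swapCfg (n i : ℕ) : Continuous (swapCfg n i) := by
  refine continuous_pi fun j => ?_
  unfold swapCfg
  split_ifs
  · have : (fun h : ℝ => (⟨4 * i + h, 1⟩ : ℂ)) = fun h : ℝ => (4 * i + h : ℂ) + Complex.I := by
      funext h; apply Complex.ext <;> simp
    rw [this]; fun_prop
  · fun_prop
  · fun_prop

lemma injective_swapCfg (n i : ℕ) (h : ℝ) : Function.Injective (swapCfg n i h) := by
  intro j l hjl
  have h1 := congrArg Complex.re hjl
  have h2 := congrArg Complex.im hjl
  unfold swapCfg at h1 h2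
  apply Fin.ext
  split_ifs at h1 h2 with h3 h4 h5 h6 h7 h8 h9 h10 <;> simp at h1 h2 <;> try omega

lemma swapCfg_re_of_lt {i : ℕ} {h : ℝ} {j : Fin n} (hj : (j : ℕ) < i) :
    (swapCfg n i h j).re ≤ 4 * i - 4 := by
  have : ((j : ℕ) : ℝ) + 1 ≤ i := by exact_mod_cast hj
  unfold swapCfg
  rw [if_neg (by omega), if_neg (by omega)]
  simp only
  linarith

lemma swapCfg_re_of_gt {i : ℕ} {h : ℝ} {j : Fin n} (hj : i + 1 < (j : ℕ)) :
    4 * (i : ℝ) + 8 ≤ (swapCfg n i h j).re := by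
  have : (i : ℝ) + 2 ≤ ((j : ℕ) : ℝ) := by exact_mod_cast hj
  unfold swapCfg
  rw [if_neg (by omega), if_neg (by omega)]
  simp only
  linarith

lemma swapCfg_left {i : ℕ} (h : ℝ) (hi : i < n) : swapCfg n i h ⟨i, hi⟩ = ⟨4 * i + h, 1⟩ := by
  simp [swapCfg]

lemma swapCfg_right {i : ℕ} (h : ℝ) (hi : i + 1 < n) :
    swapCfg n i h ⟨i + 1, hi⟩ = ⟨4 * i, 0⟩ := by
  simp [swapCfg]

lemma fin_trichotomy {i : ℕ} (hi : i + 1 < n) (j : Fin n) : (j : ℕ) < i ∨ j = ⟨i, by omega⟩ ∨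
    j = ⟨i + 1, hi⟩ ∨ i + 1 < (j : ℕ) := by
  simp only [Fin.ext_iff]; omega

/-- The number of punctures to the left of a point in the central window. -/
lemma str_swapCfg {i : ℕ} (hi : i + 1 < n) {h : ℝ} {p : ℂ} (h1 : 4 * (i : ℝ) - 2 < p.re)
    (h2 : p.re < 4 * i + 2) : str (swapCfg n i h) p =
      i + (if 4 * (i : ℝ) + h < p.re then 1 else 0) + (if 4 * (i : ℝ) < p.re then 1 else 0) := by
  have hS : ∀ j : Fin n, (swapCfg n i h j).re < p.re ↔ (j : ℕ) < i ∨
      ((j : ℕ) = i ∧ 4 * (i : ℝ) + h < p.re) ∨ ((j : ℕ) = i + 1 ∧ 4 * (i : ℝ) < p.re) := by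
    intro j
    rcases fin_trichotomy hi j with hj | rfl | rfl | hj
    · have := swapCfg_re_of_lt (h := h) hj
      exact iff_of_true (by linarith) (Or.inl hj)
    · rw [swapCfg_left]; simp
    · rw [swapCfg_right]; simp
    · have := swapCfg_re_of_gt (h := h) hj
      refine iff_of_false (by linarith) (by omega)
  unfold str
  simp only [hS]
  split_ifs with h3 h4 h4
  · rw [show (Finset.univ.filter fun j : Fin n => _) = Finset.Iic ⟨i + 1, hi⟩ by
      ext j; simp [h3, h4, Fin.le_def]; omega, Fin.card_Iic]
  · rw [show (Finset.univ.filter fun j : Fin n => _) = Finset.Iic ⟨i, by omega⟩ by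
      ext j; simp [h3, h4, Fin.le_def]; omega, Fin.card_Iic]
  · rw [show (Finset.univ.filter fun j : Fin n => _) =
      insert ⟨i + 1, hi⟩ (Finset.Iio (⟨i, by omega⟩ : Fin n)) by
      ext j; simp [h3, h4, Fin.lt_def, Fin.ext_iff]; omega,
      Finset.card_insert_of_notMem (by simp [Fin.lt_def]), Fin.card_Iio]
  · rw [show (Finset.univ.filter fun j : Fin n => _) = Finset.Iio (⟨i, by omega⟩ : Fin n) by
      ext j; simp [h3, h4, Fin.lt_def], Fin.card_Iio]
    rfl

lemma str_swapCfg_zero_ne {i : ℕ} (hi : i + 1 < n) (p : ℂ) : str (swapCfg n i 0) p ≠ i + 1 := by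
  by_cases h : 4 * (i : ℝ) < p.re
  · have : Finset.Iic (⟨i + 1, hi⟩ : Fin n) ⊆
        Finset.univ.filter fun j => (swapCfg n i 0 j).re < p.re := by
      intro j hj
      simp only [Finset.mem_Iic, Fin.le_def] at hj
      simp only [Finset.mem_filter, Finset.mem_univ, true_and]
      rcases fin_trichotomy hi j with hj | rfl | rfl | hj
      · have := swapCfg_re_of_lt (h := 0) hj
        linarith
      · rw [swapCfg_left]; simpa using h
      · rw [swapCfg_right]; simpa using h
      · omega
    have h2 := Finset.card_le_card this
    rw [Fin.card_Iic] at h2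
    unfold str
    simp only at h2
    omega
  · have : (Finset.univ.filter fun j => (swapCfg n i 0 j).re < p.re) ⊆
        Finset.Iio (⟨i, by omega⟩ : Fin n) := by
      intro j hj
      simp only [Finset.mem_filter, Finset.mem_univ, true_and] at hj
      simp only [Finset.mem_Iio, Fin.lt_def]
      rcases fin_trichotomy hi j with hj' | rfl | rfl | hj'
      · exact hj'
      · rw [swapCfg_left] at hj; exact absurd (by simpa using hj) h
      · rw [swapCfg_right] at hj; exact absurd (by simpa using hj) h
      · have := swapCfg_re_of_gt (h := 0) hj'
        linarith
    have h2 := Finset.card_le_card this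
    rw [Fin.card_Iio] at h2
    unfold str
    simp only at h2
    omega

lemma swapCfg_mem_chamber {i : ℕ} (hi : i + 1 < n) : swapCfg n i (-1) ∈ Chamber n := by
  intro j l hjl
  have hjl' : (j : ℕ) < l := hjl
  rcases fin_trichotomy hi j with hj | rfl | rfl | hj
  · have h1 := swapCfg_re_of_lt (h := -1) hj
    rcases fin_trichotomy hi l with hl | rfl | rfl | hl
    · have : ((j : ℕ) : ℝ) < ((l : ℕ) : ℝ) := by exact_mod_cast hjl'
      simp only [swapCfg, if_neg (show ¬ (j : ℕ) = i by omega), if_neg (show ¬ (l : ℕ) = i by omega),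
        if_neg (show ¬ (j : ℕ) = i + 1 by omega), if_neg (show ¬ (l : ℕ) = i + 1 by omega)]
      linarith
    · simp only [swapCfg_left]; linarith
    · simp only [swapCfg_right]; linarith
    · have := swapCfg_re_of_gt (h := -1) hl
      simp only; linarith
  · rcases fin_trichotomy hi l with hl | rfl | rfl | hl
    · simp at hjl'; omega
    · simp at hjl'
    · simp only [swapCfg_left, swapCfg_right]; linarith
    · have := swapCfg_re_of_gt (h := -1) hl
      simp only [swapCfg_left]; linarith
  · rcases fin_trichotomy hi l with hl | rfl | rfl | hl
    · simp at hjl'; omega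
    · simp at hjl'
    · simp at hjl'
    · have := swapCfg_re_of_gt (h := -1) hl
      simp only [swapCfg_right]; linarith
  · have h1 : i + 1 < (l : ℕ) := by omega
    have : ((j : ℕ) : ℝ) < ((l : ℕ) : ℝ) := by exact_mod_cast hjl'
    simp only [swapCfg, if_neg (show ¬ (j : ℕ) = i by omega), if_neg (show ¬ (l : ℕ) = i by omega),
      if_neg (show ¬ (j : ℕ) = i + 1 by omega), if_neg (show ¬ (l : ℕ) = i + 1 by omega)]
    linarith

lemma exists_swapCfg_comp_mem_chamber {i : ℕ} (hi : i + 1 < n) :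
    ∃ σ : Equiv.Perm (Fin n), swapCfg n i 1 ∘ σ ∈ Chamber n := by
  refine exists_sort ?_
  intro j l hjl
  apply Fin.ext
  simp only at hjl
  rcases fin_trichotomy hi j with hj | rfl | rfl | hj <;>
  rcases fin_trichotomy hi l with hl | rfl | rfl | hl
  all_goals try have h1 := swapCfg_re_of_lt (n := n) (h := 1) hj
  all_goals try have h1' := swapCfg_re_of_gt (n := n) (h := 1) hj
  all_goals try have h2 := swapCfg_re_of_lt (n := n) (h := 1) hl
  all_goals try have h2' := swapCfg_re_of_gt (n := n) (h := 1) hl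
  all_goals try simp only [swapCfg_left, swapCfg_right] at hjl
  all_goals try (exfalso; linarith)
  all_goals try rfl
  all_goals
    unfold swapCfg at hjl
    rw [if_neg (by omega), if_neg (by omega), if_neg (by omega), if_neg (by omega)] at hjl
    have : ((j : ℕ) : ℝ) = ((l : ℕ) : ℝ) := by simp only at hjl; linarith
    exact_mod_cast this

/-- Truncation to `[-1, 1]`. -/
noncomputable def trunc (t : ℝ) : ℝ := max (-1) (min 1 t)

@[fun_prop] lemma continuous_trunc : Continuous trunc := by unfold trunc; fun_prop

/-- Charts for the exchange of two punctures. -/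
def swapChart (i : ℕ) (h : ℝ × ℝ → ℝ) (p : ℝ × ℝ → ℂ) : Option Bool → Set (ℝ × ℝ)
  | some true => {y | InP (swapCfg n i (h y)) (p y)}
  | some false => {y | InQ (swapCfg n i (h y)) (p y)}
  | none => {y | (0 < (p y).im ∧ (p y).im < 1) ∧ 4 * (i : ℝ) - 2 < (p y).re ∧ (p y).re < 4 * i + 2}

/-- Potentials for the exchange of two punctures. -/
noncomputable def swapPot (n i : ℕ) (h : ℝ × ℝ → ℝ) (p : ℝ × ℝ → ℂ) :
    Option Bool → ℝ × ℝ → FreeGroup ℕ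
  | some true, _ => 1
  | some false, y => if 0 < h y then
      halfTwist (i + 1) (FreeGroup.of (str (swapCfg n i (h y)) (p y)))
      else FreeGroup.of (str (swapCfg n i (h y)) (p y))
  | none, y => if (p y).re ≤ 4 * i + h y then 1 else (FreeGroup.of i)⁻¹ * FreeGroup.of (i + 1)

theorem exists_swapLift {i : ℕ} (hi : i + 1 < n) {h : ℝ × ℝ → ℝ} {p : ℝ × ℝ → ℂ}
    (hh : Continuous h) (hp : Continuous p) (hh1 : ∀ y, -1 ≤ h y) (hh2 : ∀ y, h y ≤ 1)
    (hne : ∀ y j, p y ≠ swapCfg n i (h y) j) :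
    (∀ y, ∃ o, y ∈ swapChart (n := n) i h p o) ∧
    ∃ L, IsPotLift (swapChart (n := n) i h p) (swapPot n i h p) L := by
  have hA : Continuous fun y => swapCfg n i (h y) := (continuous_swapCfg n i).comp hh
  have hPo := isOpen_inP hA hp
  have hQo := isOpen_inQ hA hp
  have hpre : Continuous fun y => (p y).re := by fun_prop
  have hpim : Continuous fun y => (p y).im := by fun_prop
  have hNo : IsOpen (swapChart (n := n) i h p none) :=
    ((isOpen_lt continuous_const hpim).inter (isOpen_lt hpim continuous_const)).inter
      ((isOpen_lt continuous_const hpre).inter (isOpen_lt hpre continuous_const))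
  have hcov : ∀ y, ∃ o, y ∈ swapChart (n := n) i h p o := by
    intro y
    by_cases hP : InP (swapCfg n i (h y)) (p y)
    · exact ⟨some true, hP⟩
    by_cases hQ : InQ (swapCfg n i (h y)) (p y)
    · exact ⟨some false, hQ⟩
    refine ⟨none, ?_⟩
    simp only [InP, InQ, not_forall, not_lt] at hP hQ
    obtain ⟨j, hj, hj'⟩ := hP
    obtain ⟨l, hl, hl'⟩ := hQ
    have hj'' := lt_of_le_of_ne hj' fun e => hne y j (Complex.ext hj e)
    have hl'' := lt_of_le_of_ne hl' fun e => hne y l (Complex.ext hl e.symm)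
    have himn : ∀ q : Fin n, (q : ℕ) ≠ i → (swapCfg n i (h y) q).im = 0 := by
      intro q hq; unfold swapCfg; rw [if_neg hq]; split_ifs <;> rfl
    have hji : (j : ℕ) = i := by
      by_contra hcon
      rw [himn j hcon] at hj''
      by_cases hli : (l : ℕ) = i
      · have e : l = ⟨i, by omega⟩ := Fin.ext hli
        rw [e, swapCfg_left] at hl''
        simp only at hl''; linarith
      · rw [himn l hli] at hl''; linarith
    have hli : (l : ℕ) ≠ i := by
      intro hcon
      have : j = l := Fin.ext (hji.trans hcon.symm)
      subst this; linarith
    have e : j = ⟨i, by omega⟩ := Fin.ext hji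
    rw [himn l hli] at hl''
    rw [e, swapCfg_left] at hj hj''
    simp only at hj hj''
    exact ⟨⟨hl'', hj''⟩, by linarith [hh1 y, hh2 y], by linarith [hh1 y, hh2 y]⟩
  refine ⟨hcov, exists_isPotLift _ _ ?_ hcov ?_⟩
  · rintro (_ | _ | _)
    · exact hNo
    · exact hQo
    · exact hPo
  have hPQ : ∀ y, InP (swapCfg n i (h y)) (p y) → InQ (swapCfg n i (h y)) (p y) →
      ∀ᶠ z in 𝓝 y, swapPot n i h p (some false) z = swapPot n i h p (some false) y := by
    intro y h1 h2
    have hs := eventually_str_eq hA hp (re_ne_of_inP_inQ h1 h2)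
    by_cases hst : str (swapCfg n i (h y)) (p y) = i + 1
    · have h0 : h y ≠ 0 := fun e => by
        rw [e] at hst; exact str_swapCfg_zero_ne hi _ hst
      have hsgn : ∀ᶠ z in 𝓝 y, (0 < h z ↔ 0 < h y) := by
        rcases lt_or_gt_of_ne h0 with hlt | hlt
        · filter_upwards [(isOpen_lt hh continuous_const).mem_nhds hlt] with z hz
          exact iff_of_false (not_lt.2 (le_of_lt hz)) (not_lt.2 hlt.le)
        · filter_upwards [(isOpen_lt continuous_const hh).mem_nhds hlt] with z hz
          exact iff_of_true hz hlt
      filter_upwards [hs, hsgn] with z hz hz'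
      simp only [swapPot, hz, hz']
    · filter_upwards [hs] with z hz
      simp only [swapPot, hz, halfTwist_of_ne hst, ite_self]
  have hPN : ∀ y ∈ swapChart (n := n) i h p none, InP (swapCfg n i (h y)) (p y) →
      ∀ᶠ z in 𝓝 y, swapPot n i h p none z = swapPot n i h p none y := by
    intro y hN h1
    have hre : (p y).re ≠ 4 * i + h y := by
      intro e
      have := h1 ⟨i, by omega⟩ (by rw [swapCfg_left, e])
      rw [swapCfg_left] at this
      simp only at this
      linarith [hN.1.2]
    have : ∀ᶠ z in 𝓝 y, ((p z).re ≤ 4 * i + h z ↔ (p y).re ≤ 4 * i + h y) := by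
      rcases lt_or_gt_of_ne hre with hlt | hlt
      · filter_upwards [(isOpen_lt (f := fun z => (p z).re) (g := fun z => 4 * (i : ℝ) + h z)
          (by fun_prop) (by fun_prop)).mem_nhds hlt] with z hz
        exact iff_of_true (le_of_lt hz) hlt.le
      · filter_upwards [(isOpen_lt (g := fun z => (p z).re) (f := fun z => 4 * (i : ℝ) + h z)
          (by fun_prop) (by fun_prop)).mem_nhds hlt] with z hz
        exact iff_of_false (not_le.2 hz) (not_le.2 hlt)
    filter_upwards [this] with z hz
    simp only [swapPot, hz]
  have hQNeq : ∀ y ∈ swapChart (n := n) i h p none, InQ (swapCfg n i (h y)) (p y) →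
      (p y).re ≠ 4 * i ∧ swapPot n i h p (some false) y * (swapPot n i h p none y)⁻¹ =
        if (p y).re < 4 * i then FreeGroup.of i
        else FreeGroup.of (i + 2) * (FreeGroup.of (i + 1))⁻¹ * FreeGroup.of i := by
    intro y hN h2
    have hre : (p y).re ≠ 4 * i := by
      intro e
      have := h2 ⟨i + 1, hi⟩ (by rw [swapCfg_right, e])
      rw [swapCfg_right] at this
      simp only at this
      linarith [hN.1.1]
    refine ⟨hre, ?_⟩
    have hst := str_swapCfg (h := h y) hi hN.2.1 hN.2.2
    rcases lt_or_gt_of_ne hre with hlt | hlt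
    · rw [if_neg (not_lt.2 hlt.le)] at hst
      rw [if_pos hlt]
      by_cases hz : (p y).re ≤ 4 * i + h y
      · rw [if_neg (not_lt.2 hz)] at hst
        simp only [swapPot, hst, if_pos hz, add_zero, halfTwist_of_ne (show i ≠ i + 1 by omega),
          ite_self]
        group
      · rw [if_pos (not_le.1 hz)] at hst
        simp only [swapPot, hst, if_neg hz, add_zero, if_neg (show ¬ 0 < h y by linarith)]
        group
    · rw [if_pos hlt] at hst
      rw [if_neg (not_lt.2 hlt.le)]
      by_cases hz : (p y).re ≤ 4 * i + h y
      · rw [if_neg (not_lt.2 hz)] at hst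
        simp only [swapPot, hst, if_pos hz, add_zero, if_pos (show 0 < h y by linarith),
          halfTwist_of_self, add_tsub_cancel_right]
        group
      · rw [if_pos (not_le.1 hz)] at hst
        simp only [swapPot, hst, if_neg hz, halfTwist_of_ne (show i + 1 + 1 ≠ i + 1 by omega),
          ite_self]
        group
  have hQN : ∀ y ∈ swapChart (n := n) i h p none, InQ (swapCfg n i (h y)) (p y) →
      ∀ᶠ z in 𝓝 y, swapPot n i h p (some false) z * (swapPot n i h p none z)⁻¹ =
        swapPot n i h p (some false) y * (swapPot n i h p none y)⁻¹ := by
    intro y hN h2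
    have hlt' : ∀ᶠ z in 𝓝 y, ((p z).re < 4 * i ↔ (p y).re < 4 * i) := by
      rcases lt_or_gt_of_ne (hQNeq y hN h2).1 with hlt | hlt
      · filter_upwards [(isOpen_lt (f := fun z => (p z).re) (by fun_prop)
          continuous_const).mem_nhds hlt] with z hz
        exact iff_of_true hz hlt
      · filter_upwards [(isOpen_lt (g := fun z => (p z).re) continuous_const
          (by fun_prop)).mem_nhds hlt] with z hz
        exact iff_of_false (not_lt.2 (le_of_lt hz)) (not_lt.2 hlt.le)
    filter_upwards [hNo.mem_nhds hN, hlt', hQo.mem_nhds h2] with z hz1 hz2 hz3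
    rw [(hQNeq y hN h2).2, (hQNeq z hz1 hz3).2]
    simp only [hz2]
  rintro (_ | _ | _) (_ | _ | _) y h1 h2
  · simp
  · exact hQN y h1 h2
  · filter_upwards [hPN y h1 h2] with z hz
    rw [hz]; rfl
  · filter_upwards [hQN y h2 h1] with z hz
    have := congrArg (·⁻¹) hz
    simpa using this
  · simp
  · filter_upwards [hPQ y h2 h1] with z hz
    rw [hz]; rfl
  · filter_upwards [hPN y h2 h1] with z hz
    rw [hz]; rfl
  · filter_upwards [hPQ y h1 h2] with z hz
    rw [hz]; rfl
  · simp

theorem IsSec.isConj_halfTwist {g : (Fin n → ℂ) → ℂ} (hg : IsSec g)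
    {L : Chamber n × ℝ → FreeGroup ℕ} {c : FreeGroup ℕ}
    (hL : GateLift FreeGroup.of (fun y => (y.1 : Fin n → ℂ)) (fun y => loop g y.1 y.2) L)
    (hc : ∀ a t, L (a, t + 1) = L (a, t) * c) {i : ℕ} (hi : i + 1 < n) :
    IsConj c (halfTwist (i + 1) c) := by
  set h : ℝ × ℝ → ℝ := fun y => trunc y.1 with hh
  have hinj := injective_swapCfg n i
  set p : ℝ × ℝ → ℂ := fun y => loop g (swapCfg n i (h y)) y.2 with hp
  have hhc : Continuous h := by fun_prop
  have hpc : Continuous p :=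
    hg.continuous_loop ((continuous_swapCfg n i).comp hhc) (fun _ => hinj _) continuous_snd
  obtain ⟨hcov, M, hM⟩ := exists_swapLift hi hhc hpc (fun y => le_max_left _ _)
    (fun y => max_le (by norm_num) (min_le_left _ _)) (fun y j => hg.loop_ne (hinj _) _ j)
  have hshift : ∀ y : ℝ × ℝ, h (y.1, y.2 + 1) = h y := fun y => rfl
  have hpshift : ∀ y : ℝ × ℝ, p (y.1, y.2 + 1) = p y := fun y => loop_add_one _ _
  have hM' : IsPotLift (swapChart (n := n) i h p) (swapPot n i h p)
      fun y => M (y.1, y.2 + 1) := by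
    intro o y hy
    have hcont : ContinuousAt (fun y : ℝ × ℝ => (y.1, y.2 + 1)) y := by fun_prop
    have hmem : (y.1, y.2 + 1) ∈ swapChart (n := n) i h p o := by
      rcases o with _ | _ | _ <;>
        simpa only [swapChart, Set.mem_ofPred_eq, hshift, hpshift] using hy
    have := hcont.eventually (hM o _ hmem)
    rcases o with _ | _ | _ <;> simpa only [swapPot, hshift, hpshift] using this
  obtain ⟨d, hd⟩ := hM.exists_eq_mul hcov hM'
  have hend : ∀ (τ : ℝ) (a : Chamber n) (σ : Equiv.Perm (Fin n)) (φ : FreeGroup ℕ →* FreeGroup ℕ),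
      swapCfg n i (trunc τ) ∘ σ = a → (∀ t, swapPot n i h p (some false) (τ, t) =
        φ (FreeGroup.of (str (swapCfg n i (trunc τ)) (p (τ, t))))) → IsConj d (φ c) := by
    intro τ a σ φ ha hφ
    have hpa : ∀ t, p (τ, t) = loop g a t := fun t => by
      rw [← ha, hg.loop_comp (hinj _)]
    have hMτ : GateLift (fun m => φ (FreeGroup.of m)) (fun _ => (a : Fin n → ℂ))
        (fun t => loop g a t) fun t => M (τ, t) := by
      have hcont : ∀ t : ℝ, ContinuousAt (fun t : ℝ => (τ, t)) t := fun t => by fun_prop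
      rw [gateLift_iff]
      constructor
      · intro t ht
        rw [← ha, inP_comp, ha, ← hpa] at ht
        have := (hcont t).eventually (hM (some true) (τ, t) ht)
        simpa only [swapPot, one_mul] using this
      · intro t ht
        rw [← ha, inQ_comp, ha, ← hpa] at ht
        have := (hcont t).eventually (hM (some false) (τ, t) ht)
        simp only [hφ] at this
        simp only [← ha, str_comp]
        simpa only [ha, hpa] using this
    have hLa := (hL.comp (f := fun t : ℝ => (a, t)) (by fun_prop)).map φ
    refine IsPotLift.isConj (T := 1) (pqChart_cover (fun _ => a.2)
      fun t j => hg.loop_ne (chamber_injective a.2) t j) hMτ hLa ?_ ?_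
    · have := hd (τ, 0)
      simpa using this
    · simp only [Function.comp]
      rw [← _root_.map_mul, ← hc, zero_add]
  have h1 : IsConj d c := by
    refine hend (-1) ⟨swapCfg n i (-1), swapCfg_mem_chamber hi⟩ 1 (MonoidHom.id _) ?_ ?_
    · simp [trunc]
    · intro t
      simp [swapPot, hh, trunc]
  obtain ⟨σ, hσ⟩ := exists_swapCfg_comp_mem_chamber hi
  have h2 : IsConj d (halfTwist (i + 1) c) := by
    refine hend 1 ⟨_, hσ⟩ σ (halfTwist (i + 1)) ?_ ?_
    · simp [trunc]
    · intro t
      simp [swapPot, hh, trunc]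
  exact h1.symm.trans h2

end HalfTwist

section LabelLifts

/-- A family of labels that is compatible with the gates. -/
def LabLift {Y : Type*} [TopologicalSpace Y] {n : ℕ} (A : Y → Fin n → ℂ) (p : Y → ℂ)
    (l : Y → Lab n) : Prop :=
  (∀ y, InP (A y) (p y) → ∀ᶠ z in 𝓝 y, l z = l y) ∧
    ∀ y, InQ (A y) (p y) →
      ∀ᶠ z in 𝓝 y, push n (str (A z) (p z)) (l z) = push n (str (A y) (p y)) (l y)

lemma GateLift.labLift {Y : Type*} [TopologicalSpace Y] {n : ℕ} {A : Y → Fin n → ℂ} {p : Y → ℂ}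
    {L : Y → FreeGroup ℕ} (hL : GateLift FreeGroup.of A p L) (l₀ : Lab n) :
    LabLift A p fun y => labHom n (L y) l₀ := by
  refine ⟨fun y hy => (hL.inP hy).mono fun z hz => by simp only [hz],
    fun y hy => (hL.inQ hy).mono fun z hz => ?_⟩
  have h : ∀ (m : ℕ) (w : FreeGroup ℕ),
      push n m (labHom n w l₀) = labHom n (FreeGroup.of m * w) l₀ := fun m w => by
    rw [_root_.map_mul, labHom_of]; rfl
  simp only [h, hz]

/-- The holonomy of the rotation loops of a section fixes exactly one label. -/
theorem IsSec.exists_lift_fixed {k : ℕ} (hk : 2 ≤ k) {g : (Fin (k + 1) → ℂ) → ℂ} (hg : IsSec g) :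
    ∃ (L : Chamber (k + 1) × ℝ → FreeGroup ℕ) (c : FreeGroup ℕ),
      GateLift FreeGroup.of (fun y => (y.1 : Fin (k + 1) → ℂ)) (fun y => loop g y.1 y.2) L ∧
      (∀ a t, L (a, t + 1) = L (a, t) * c) ∧ ∃! l : Lab (k + 1), labHom (k + 1) c l = l := by
  obtain ⟨L, c₀, hL, hc⟩ := hg.exists_lift
  obtain ⟨j, hjk, hj⟩ := hg.exists_wind_ne hk hL hc
  refine ⟨L, _, hL, hc, existsUnique_labHom_fixed hk c₀ (fun i h1 h2 => ?_) hjk hj⟩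
  obtain ⟨i, rfl⟩ : ∃ i', i = i' + 1 := ⟨i - 1, by omega⟩
  exact hg.isConj_halfTwist hL hc (by omega)

end LabelLifts

section Curve

variable {k : ℕ} {Y : Type*} [TopologicalSpace Y]

/-- The nearest point of the real interval spanned by the configuration. -/
noncomputable def clampU (a : Fin (k + 1) → ℂ) (u : ℝ) : ℝ :=
  max (a 0).re (min u (a (Fin.last k)).re)

/-- Interpolation weights. -/
noncomputable def wt (a : Fin (k + 1) → ℂ) (u : ℝ) (j : Fin (k + 1)) : ℝ :=
  ∏ l ∈ Finset.univ.erase j, |u - (a l).re|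

/-- The height of a curve running through all the punctures. -/
noncomputable def curve (a : Fin (k + 1) → ℂ) (u : ℝ) : ℝ :=
  (∑ j, wt a (clampU a u) j * (a j).im) / ∑ j, wt a (clampU a u) j

/-- The height of a point above the curve through the punctures. -/
noncomputable def yco (a : Fin (k + 1) → ℂ) (p : ℂ) : ℝ := p.im - curve a p.re

@[fun_prop] lemma continuous_clampU {A : Y → Fin (k + 1) → ℂ} {u : Y → ℝ} (hA : Continuous A)
    (hu : Continuous u) : Continuous fun y => clampU (A y) (u y) := by
  unfold clampU; fun_prop

lemma wt_nonneg (a : Fin (k + 1) → ℂ) (u : ℝ) (j : Fin (k + 1)) : 0 ≤ wt a u j :=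
  Finset.prod_nonneg fun _ _ => abs_nonneg _

lemma sum_wt_pos {a : Fin (k + 1) → ℂ} (ha : a ∈ Chamber (k + 1)) (u : ℝ) : 0 < ∑ j, wt a u j := by
  obtain ⟨j, hj⟩ : ∃ j, ∀ l, l ≠ j → u ≠ (a l).re := by
    by_cases h : ∃ j, u = (a j).re
    · obtain ⟨j, hj⟩ := h
      exact ⟨j, fun l hl e => hl (StrictMono.injective ha (e.symm.trans hj))⟩
    · push Not at h
      exact ⟨0, fun l _ => h l⟩
  refine Finset.sum_pos' (fun j _ => wt_nonneg a u j) ⟨j, Finset.mem_univ _, ?_⟩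
  exact Finset.prod_pos fun l hl => abs_pos.2 (sub_ne_zero.2 (hj l (Finset.ne_of_mem_erase hl)))

lemma continuous_curve {A : Y → Fin (k + 1) → ℂ} {u : Y → ℝ} (hA : Continuous A)
    (hu : Continuous u) (hC : ∀ y, A y ∈ Chamber (k + 1)) :
    Continuous fun y => curve (A y) (u y) := by
  have hc := continuous_clampU hA hu
  have hw : ∀ j, Continuous fun y => wt (A y) (clampU (A y) (u y)) j := fun j => by
    unfold wt
    refine continuous_finsetProd _ fun l _ => ?_
    fun_prop
  unfold curve
  refine Continuous.div (continuous_finsetSum _ fun j _ => (hw j).mul (by fun_prop))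
    (continuous_finsetSum _ fun j _ => hw j) fun y => (sum_wt_pos (hC y) _).ne'

lemma continuous_yco {A : Y → Fin (k + 1) → ℂ} {p : Y → ℂ} (hA : Continuous A)
    (hp : Continuous p) (hC : ∀ y, A y ∈ Chamber (k + 1)) :
    Continuous fun y => yco (A y) (p y) :=
  (Complex.continuous_im.comp hp).sub
    (continuous_curve hA (Complex.continuous_re.comp hp) hC)

lemma curve_congr {a : Fin (k + 1) → ℂ} {u v : ℝ} (h : clampU a u = clampU a v) :
    curve a u = curve a v := by rw [curve, curve, h]

lemma le_re {a : Fin (k + 1) → ℂ} (ha : a ∈ Chamber (k + 1)) (j : Fin (k + 1)) :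
    (a 0).re ≤ (a j).re := (StrictMono.monotone ha) (Fin.zero_le j)

lemma re_le {a : Fin (k + 1) → ℂ} (ha : a ∈ Chamber (k + 1)) (j : Fin (k + 1)) :
    (a j).re ≤ (a (Fin.last k)).re := (StrictMono.monotone ha) (Fin.le_last j)

lemma curve_apply {a : Fin (k + 1) → ℂ} (ha : a ∈ Chamber (k + 1)) (j : Fin (k + 1)) :
    curve a (a j).re = (a j).im := by
  have hcl : clampU a (a j).re = (a j).re := by
    rw [clampU, min_eq_left (re_le ha j), max_eq_right (le_re ha j)]
  have h0 : ∀ l, l ≠ j → wt a (a j).re l = 0 := fun l hl =>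
    Finset.prod_eq_zero (Finset.mem_erase.2 ⟨hl.symm, Finset.mem_univ _⟩) (by simp)
  have hpos := sum_wt_pos ha (a j).re
  rw [Finset.sum_eq_single j (fun l _ hl => h0 l hl) (by simp)] at hpos
  rw [curve, hcl, Finset.sum_eq_single j (fun l _ hl => by rw [h0 l hl, zero_mul]) (by simp),
    Finset.sum_eq_single j (fun l _ hl => h0 l hl) (by simp), mul_comm,
    mul_div_cancel_right₀ _ hpos.ne']

lemma abs_curve_le {a : Fin (k + 1) → ℂ} (ha : a ∈ Chamber (k + 1)) (u : ℝ) :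
    |curve a u| ≤ ‖a‖ := by
  have hpos := sum_wt_pos ha (clampU a u)
  rw [curve, abs_div, abs_of_pos hpos, div_le_iff₀ hpos, Finset.mul_sum]
  refine (Finset.abs_sum_le_sum_abs _ _).trans (Finset.sum_le_sum fun j _ => ?_)
  rw [abs_mul, abs_of_nonneg (wt_nonneg _ _ _), mul_comm]
  exact mul_le_mul_of_nonneg_right ((Complex.abs_im_le_norm _).trans (norm_le_pi_norm a j))
    (wt_nonneg _ _ _)

lemma abs_clampU_le (a : Fin (k + 1) → ℂ) (u : ℝ) : |clampU a u| ≤ ‖a‖ := by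
  have h0 := abs_le.1 ((Complex.abs_re_le_norm _).trans (norm_le_pi_norm a 0))
  have h1 := abs_le.1 ((Complex.abs_re_le_norm _).trans (norm_le_pi_norm a (Fin.last k)))
  rw [clampU, abs_le]
  exact ⟨h0.1.trans (le_max_left _ _), max_le h0.2 ((min_le_right _ _).trans h1.2)⟩

lemma inP_of_yco {a : Fin (k + 1) → ℂ} (ha : a ∈ Chamber (k + 1)) {p : ℂ} (hp : ∀ j, p ≠ a j)
    (h : 0 ≤ yco a p) : InP a p := by
  intro j hj
  rw [yco, hj, curve_apply ha] at h
  exact lt_of_le_of_ne (by linarith) fun e => hp j (Complex.ext hj e.symm)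

lemma inQ_of_yco {a : Fin (k + 1) → ℂ} (ha : a ∈ Chamber (k + 1)) {p : ℂ} (hp : ∀ j, p ≠ a j)
    (h : yco a p ≤ 0) : InQ a p := by
  intro j hj
  rw [yco, hj, curve_apply ha] at h
  exact lt_of_le_of_ne (by linarith) fun e => hp j (Complex.ext hj e)

/-- Functions given by compatible formulas above and below the curve vary continuously along
label lifts. -/
lemma LabLift.continuousAt_ite {W : Type*} [TopologicalSpace W] {A : Y → Fin (k + 1) → ℂ}
    {p : Y → ℂ} {l : Y → Lab (k + 1)} (hl : LabLift A p l) (hA : Continuous A) (hp : Continuous p)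
    (hC : ∀ y, A y ∈ Chamber (k + 1)) (hne : ∀ y j, p y ≠ A y j) (Φ Ψ : Lab (k + 1) → Y → W)
    {y : Y} (hΦ : ∀ l, ContinuousAt (Φ l) y) (hΨ : ∀ l, ContinuousAt (Ψ l) y)
    (hcompat : ∀ l, yco (A y) (p y) = 0 → Φ l y = Ψ (push (k + 1) (str (A y) (p y)) l) y) :
    ContinuousAt (fun z => if 0 ≤ yco (A z) (p z) then Φ (l z) z
      else Ψ (push (k + 1) (str (A z) (p z)) (l z)) z) y := by
  have hy := continuous_yco hA hp hC
  rcases lt_trichotomy (yco (A y) (p y)) 0 with h | h | h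
  · refine (hΨ (push (k + 1) (str (A y) (p y)) (l y))).congr ?_
    filter_upwards [hl.2 y (inQ_of_yco (hC y) (hne y) h.le),
      (isOpen_lt hy continuous_const).mem_nhds h] with z hz hz'
    rw [if_neg (not_le.2 hz'), hz]
  · have hP := hl.1 y (inP_of_yco (hC y) (hne y) h.ge)
    have hQ := hl.2 y (inQ_of_yco (hC y) (hne y) h.le)
    have hc := hcompat (l y) h
    rw [ContinuousAt, if_pos h.ge]
    have h1 : Tendsto (Φ (l y)) (𝓝 y) (𝓝 (Φ (l y) y)) := hΦ (l y)
    have h2 : Tendsto (Ψ (push (k + 1) (str (A y) (p y)) (l y))) (𝓝 y) (𝓝 (Φ (l y) y)) := by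
      rw [hc]; exact hΨ _
    refine (Tendsto.if' (p := fun z => 0 ≤ yco (A z) (p z)) h1 h2).congr' ?_
    filter_upwards [hP, hQ] with z hz hz'
    rw [hz', hz]
  · refine (hΦ (l y)).congr ?_
    filter_upwards [hl.1 y (inP_of_yco (hC y) (hne y) h.le),
      (isOpen_lt continuous_const hy).mem_nhds h] with z hz hz'
    rw [if_pos (le_of_lt hz'), hz]

end Curve

section Flow

variable {k : ℕ} {Y : Type*} [TopologicalSpace Y]

/-- The end points of the gates, where the unbounded gates are cut off away from `u`. -/
noncomputable def pad (a : Fin (k + 1) → ℂ) (u : ℝ) (m : ℕ) : ℝ :=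
  if m = 0 then min (a 0).re u - 1 else
    if h : m < k + 2 then (a ⟨m - 1, by omega⟩).re else max (a (Fin.last k)).re u + (m - (k + 1))

/-- The point of the gate `(lo, hi)` towards which the point at `u` and height `y` moves. -/
noncomputable def tgt (lo hi u y : ℝ) : ℝ :=
  max (lo + min (|y| + max 0 (max (lo - u) (u - hi))) ((hi - lo) / 2))
    (min u (hi - min (|y| + max 0 (max (lo - u) (u - hi))) ((hi - lo) / 2)))

/-- The distance to the ends of the real interval spanned by the configuration. -/
noncomputable def beta (a : Fin (k + 1) → ℂ) (u : ℝ) : ℝ :=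
  max 0 (min (u - (a 0).re) ((a (Fin.last k)).re - u))

/-- The flow on a half plane with a prescribed sequence of gates. -/
noncomputable def hat : List ℕ → (Fin (k + 1) → ℂ) → ℝ → ℝ → ℝ → ℝ × ℝ
  | [], a, u, y, s => (u + s * (u - clampU a u), |y| + s * (|y| + beta a u))
  | m :: l, a, u, y, s =>
    if s ≤ |tgt (pad a u m) (pad a u (m + 1)) u y - u| + |y| then
      (u + max (-s) (min s (tgt (pad a u m) (pad a u (m + 1)) u y - u)),
        max 0 (|y| - max 0 (s - |tgt (pad a u m) (pad a u (m + 1)) u y - u|)) +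
          max 0 (min s (|tgt (pad a u m) (pad a u (m + 1)) u y - u| - s)))
    else
      ((hat l a (tgt (pad a u m) (pad a u (m + 1)) u y) 0
        (s - (|tgt (pad a u m) (pad a u (m + 1)) u y - u| + |y|))).1,
       -(hat l a (tgt (pad a u m) (pad a u (m + 1)) u y) 0
        (s - (|tgt (pad a u m) (pad a u (m + 1)) u y - u| + |y|))).2)

/-- The time the flow needs to get far away. -/
noncomputable def hatTime : List ℕ → (Fin (k + 1) → ℂ) → ℝ → ℝ → ℝ
  | [], a, u, y => 10 * (‖a‖ + 1) / (|u - clampU a u| + |y| + beta a u)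
  | m :: l, a, u, y => |tgt (pad a u m) (pad a u (m + 1)) u y - u| + |y| +
      hatTime l a (tgt (pad a u m) (pad a u (m + 1)) u y) 0

@[fun_prop] lemma continuous_pad {A : Y → Fin (k + 1) → ℂ} {u : Y → ℝ} (hA : Continuous A)
    (hu : Continuous u) (m : ℕ) : Continuous fun y => pad (A y) (u y) m := by
  unfold pad; split_ifs <;> fun_prop

@[fun_prop] lemma continuous_tgt {lo hi u y : Y → ℝ} (h1 : Continuous lo) (h2 : Continuous hi)
    (h3 : Continuous u) (h4 : Continuous y) :
    Continuous fun z => tgt (lo z) (hi z) (u z) (y z) := by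
  unfold tgt; fun_prop

@[fun_prop] lemma continuous_beta {A : Y → Fin (k + 1) → ℂ} {u : Y → ℝ} (hA : Continuous A)
    (hu : Continuous u) : Continuous fun y => beta (A y) (u y) := by
  unfold beta; fun_prop

lemma beta_nonneg (a : Fin (k + 1) → ℂ) (u : ℝ) : 0 ≤ beta a u := le_max_left _ _

lemma hat_zero (l : List ℕ) (a : Fin (k + 1) → ℂ) (u y : ℝ) : hat l a u y 0 = (u, |y|) := by
  cases l with
  | nil => simp [hat]
  | cons m l =>
    rw [hat, if_pos (by positivity)]
    refine Prod.ext ?_ ?_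
    · rcases le_total (tgt (pad a u m) (pad a u (m + 1)) u y - u) 0 with h | h
      · simp [h]
      · simp [h]
    · simp

lemma clamp_eq_of_abs_le {x s : ℝ} (h : |x| ≤ s) : max (-s) (min s x) = x := by
  rw [min_eq_right (abs_le.1 h).2, max_eq_right (abs_le.1 h).1]

lemma continuous_hat (l : List ℕ) : ∀ {A : Y → Fin (k + 1) → ℂ} {u y s : Y → ℝ},
    Continuous A → Continuous u → Continuous y → Continuous s →
    Continuous fun z => hat l (A z) (u z) (y z) (s z) := by
  induction l with
  | nil => intro A u y s hA hu hy hs; unfold hat; fun_prop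
  | cons m l ih =>
    intro A u y s hA hu hy hs
    unfold hat
    have ht : Continuous fun z => tgt (pad (A z) (u z) m) (pad (A z) (u z) (m + 1)) (u z) (y z) := by
      fun_prop
    have hi := ih hA ht (continuous_const (y := (0 : ℝ)))
      (hs.sub ((ht.sub hu).abs.add hy.abs))
    refine Continuous.if_le (by fun_prop) (by fun_prop) hs (by fun_prop) fun z hz => ?_
    rw [hz, sub_self, hat_zero]
    have h0 := abs_nonneg (tgt (pad (A z) (u z) m) (pad (A z) (u z) (m + 1)) (u z) (y z) - u z)
    rw [clamp_eq_of_abs_le (by linarith [abs_nonneg (y z)])]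
    refine Prod.ext (by simp) ?_
    simp

lemma pad_lt {a : Fin (k + 1) → ℂ} (ha : a ∈ Chamber (k + 1)) (u : ℝ) (m : ℕ) :
    pad a u m < pad a u (m + 1) := by
  unfold pad
  rw [if_neg (Nat.succ_ne_zero m)]
  by_cases h0 : m = 0
  · subst h0
    rw [if_pos rfl, dif_pos (by omega)]
    exact (sub_one_lt _).trans_le (min_le_left _ _)
  · rw [if_neg h0]
    by_cases h1 : m < k + 1
    · rw [dif_pos (by omega), dif_pos (by omega)]
      exact ha (by rw [Fin.lt_def]; simp only; omega)
    · rw [dif_neg (show ¬ m + 1 < k + 2 by omega)]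
      by_cases h2 : m < k + 2
      · obtain rfl : m = k + 1 := by omega
        rw [dif_pos h2]
        have := le_max_left (a (Fin.last k)).re u
        have e : (a ⟨k + 1 - 1, by omega⟩).re = (a (Fin.last k)).re := rfl
        rw [e]; push_cast; linarith
      · rw [dif_neg h2]; push_cast; linarith

lemma exists_of_pad_eq {a : Fin (k + 1) → ℂ} {u : ℝ} {m : ℕ} (h : pad a u m = u) :
    ∃ j, u = (a j).re := by
  unfold pad at h
  split_ifs at h with h0 h1
  · linarith [min_le_right (a 0).re u]
  · exact ⟨_, h.symm⟩
  · have h2 : ((k + 2 : ℕ) : ℝ) ≤ m := by exact_mod_cast not_lt.1 h1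
    push_cast at h2
    linarith [le_max_right (a (Fin.last k)).re u]

lemma re_notMem_pad {a : Fin (k + 1) → ℂ} (ha : a ∈ Chamber (k + 1)) (u : ℝ) (m : ℕ)
    (j : Fin (k + 1)) : (a j).re ≤ pad a u m ∨ pad a u (m + 1) ≤ (a j).re := by
  by_cases h : m ≤ j
  · right
    rw [pad, if_neg (Nat.succ_ne_zero m), dif_pos (by omega)]
    exact (StrictMono.monotone ha) (by rw [Fin.le_def]; simpa using h)
  · left
    rw [pad, if_neg (by omega)]
    split_ifs with h1
    · exact (StrictMono.monotone ha) (by rw [Fin.le_def]; simp only; omega)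
    · have h2 : ((k + 2 : ℕ) : ℝ) ≤ m := by exact_mod_cast not_lt.1 h1
      push_cast at h2
      linarith [le_max_left (a (Fin.last k)).re u, re_le ha j]

lemma tgt_eq {lo hi u : ℝ} (h1 : lo ≤ u) (h2 : u ≤ hi) : tgt lo hi u 0 = u := by
  have h : max (0 : ℝ) (max (lo - u) (u - hi)) = 0 :=
    max_eq_left (max_le (by linarith) (by linarith))
  rw [tgt, h, abs_zero, add_zero, min_eq_left (by linarith)]
  simp [h1, h2]

lemma tgt_mem {lo hi u y : ℝ} (h : lo < hi) (hy : y = 0 → u ≠ lo ∧ u ≠ hi) :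
    lo < tgt lo hi u y ∧ tgt lo hi u y < hi := by
  by_cases hr : 0 < |y| + max 0 (max (lo - u) (u - hi))
  · have he : 0 < min (|y| + max 0 (max (lo - u) (u - hi))) ((hi - lo) / 2) :=
      lt_min hr (by linarith)
    have he' := min_le_right (|y| + max 0 (max (lo - u) (u - hi))) ((hi - lo) / 2)
    unfold tgt
    refine ⟨lt_max_of_lt_left (by linarith), max_lt (by linarith) ?_⟩
    exact (min_le_right _ _).trans_lt (by linarith)
  · have h1 := abs_nonneg y
    have h2 := le_max_left 0 (max (lo - u) (u - hi))
    have h3 : |y| = 0 := by linarith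
    have h4 : max 0 (max (lo - u) (u - hi)) ≤ 0 := by linarith
    have h5 : lo - u ≤ 0 := (le_max_left _ _).trans ((le_max_right _ _).trans h4)
    have h6 : u - hi ≤ 0 := (le_max_right _ _).trans ((le_max_right _ _).trans h4)
    have hy0 : y = 0 := abs_eq_zero.1 h3
    subst hy0
    rw [tgt_eq (by linarith) (by linarith)]
    exact ⟨lt_of_le_of_ne (by linarith) (hy rfl).1.symm, lt_of_le_of_ne (by linarith) (hy rfl).2⟩

lemma tgt_pad_ne {a : Fin (k + 1) → ℂ} (ha : a ∈ Chamber (k + 1)) {u y : ℝ}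
    (hu : ∀ j, u = (a j).re → y ≠ 0) (m : ℕ) (j : Fin (k + 1)) :
    tgt (pad a u m) (pad a u (m + 1)) u y ≠ (a j).re := by
  have hp : ∀ m, y = 0 → u ≠ pad a u m := fun m hy e => by
    obtain ⟨j, hj⟩ := exists_of_pad_eq e.symm
    exact hu j hj hy
  obtain ⟨h1, h2⟩ := tgt_mem (y := y) (pad_lt ha u m) fun hy => ⟨hp m hy, hp (m + 1) hy⟩
  rcases re_notMem_pad ha u m j with h | h
  · exact (h.trans_lt h1).ne'
  · exact (h2.trans_le h).ne

lemma eq_zero_of_beta {a : Fin (k + 1) → ℂ} (ha : a ∈ Chamber (k + 1)) {u s : ℝ} (hs : 0 ≤ s)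
    (h : s * beta a u = 0) {j : Fin (k + 1)} (hj : u + s * (u - clampU a u) = (a j).re) :
    ∃ j, u = (a j).re := by
  rcases hs.eq_or_lt with rfl | hs
  · exact ⟨j, by simpa using hj⟩
  have hb : beta a u = 0 := by
    rcases mul_eq_zero.1 h with h | h
    · exact absurd h hs.ne'
    · exact h
  have h01 := le_re ha (Fin.last k)
  have hb' : min (u - (a 0).re) ((a (Fin.last k)).re - u) ≤ 0 := by
    rw [← hb]; exact le_max_right _ _
  rcases min_le_iff.1 hb' with hb' | hb'
  · have hc : clampU a u = (a 0).re := by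
      rw [clampU, min_eq_left (by linarith), max_eq_left (by linarith)]
    rw [hc] at hj
    refine ⟨0, le_antisymm (by linarith) ?_⟩
    have := le_re ha j
    by_contra! hlt
    nlinarith
  · have hc : clampU a u = (a (Fin.last k)).re := by
      rw [clampU, min_eq_right (by linarith), max_eq_right (by linarith)]
    rw [hc] at hj
    refine ⟨Fin.last k, le_antisymm ?_ (by linarith)⟩
    have := re_le ha j
    by_contra! hlt
    nlinarith

/-- The flow avoids the punctures. -/
lemma hat_ne (l : List ℕ) {a : Fin (k + 1) → ℂ} (ha : a ∈ Chamber (k + 1)) : ∀ {u y s : ℝ},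
    0 ≤ s → (∀ j, u = (a j).re → y ≠ 0) → ∀ j, (hat l a u y s).1 = (a j).re →
    (hat l a u y s).2 ≠ 0 := by
  induction l with
  | nil =>
    intro u y s hs hu j hj h0
    simp only [hat] at hj h0
    have h1 := abs_nonneg y
    have h2 : 0 ≤ s * |y| := mul_nonneg hs h1
    have h3 : 0 ≤ s * beta a u := mul_nonneg hs (beta_nonneg a u)
    rw [mul_add] at h0
    have hy : y = 0 := abs_eq_zero.1 (by linarith)
    obtain ⟨i, hi⟩ := eq_zero_of_beta ha hs (by linarith) hj
    exact hu i hi hy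
  | cons m l ih =>
    intro u y s hs hu j hj h0
    have ht := tgt_pad_ne ha hu m
    unfold hat at hj h0
    split_ifs at hj h0 with hD
    · simp only at hj h0
      rcases hs.eq_or_lt with rfl | hs
      · refine hu j ?_ ?_
        · rw [← hj]
          rcases le_total (tgt (pad a u m) (pad a u (m + 1)) u y - u) 0 with h | h <;> simp [h]
        · simpa using h0
      · have h1 := le_max_left 0 (|y| - max 0 (s - |tgt (pad a u m) (pad a u (m + 1)) u y - u|))
        have h2 := le_max_right 0 (min s (|tgt (pad a u m) (pad a u (m + 1)) u y - u| - s))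
        have h3 : min s (|tgt (pad a u m) (pad a u (m + 1)) u y - u| - s) ≤ 0 := by linarith
        rcases min_le_iff.1 h3 with h3 | h3
        · linarith
        · rw [clamp_eq_of_abs_le (by linarith)] at hj
          exact ht j (by linarith)
    · simp only [neg_eq_zero] at hj h0
      exact ih (by linarith) (fun i hi => absurd hi (ht i)) j hj h0

/-- Passing through a gate. -/
lemma hat_cons {m : ℕ} {a : Fin (k + 1) → ℂ} {u s : ℝ} (h1 : pad a u m ≤ u)
    (h2 : u ≤ pad a u (m + 1)) (hs : 0 ≤ s) (l : List ℕ) :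
    hat (m :: l) a u 0 s = ((hat l a u 0 s).1, -(hat l a u 0 s).2) := by
  rcases hs.eq_or_lt with rfl | hs
  · simp [hat_zero]
  · rw [hat, tgt_eq h1 h2, if_neg (by simpa using hs)]
    simp

lemma hatTime_cons {m : ℕ} {a : Fin (k + 1) → ℂ} {u : ℝ} (h1 : pad a u m ≤ u)
    (h2 : u ≤ pad a u (m + 1)) (l : List ℕ) : hatTime (m :: l) a u 0 = hatTime l a u 0 := by
  rw [hatTime, tgt_eq h1 h2]; simp

lemma beta_of_outer {a : Fin (k + 1) → ℂ} {u : ℝ} {m : ℕ} (h1 : pad a u m ≤ u)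
    (h2 : u ≤ pad a u (m + 1)) (hm : m = 0 ∨ m = k + 1) : beta a u = 0 := by
  refine max_eq_left ?_
  rcases hm with rfl | rfl
  · refine (min_le_left _ _).trans ?_
    have : pad a u (0 + 1) = (a 0).re := by simp [pad]
    linarith
  · refine (min_le_right _ _).trans ?_
    have : pad a u (k + 1) = (a (Fin.last k)).re := by simp [pad]; rfl
    linarith

lemma hat_pushList {m : ℕ} {a : Fin (k + 1) → ℂ} {u s : ℝ} (h1 : pad a u m ≤ u)
    (h2 : u ≤ pad a u (m + 1)) (hs : 0 ≤ s) (l : List ℕ) :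
    hat l a u 0 s = ((hat (pushList (k + 1) m l) a u 0 s).1,
      -(hat (pushList (k + 1) m l) a u 0 s).2) := by
  cases l with
  | nil =>
    rw [pushList]
    split_ifs with hm
    · simp [hat, beta_of_outer h1 h2 hm]
    · rw [hat_cons h1 h2 hs]; simp
  | cons h t =>
    rw [pushList]
    split_ifs with hm
    · subst hm
      exact hat_cons h1 h2 hs t
    · rw [hat_cons h1 h2 hs]; simp

lemma hatTime_pushList {m : ℕ} {a : Fin (k + 1) → ℂ} {u : ℝ} (h1 : pad a u m ≤ u)
    (h2 : u ≤ pad a u (m + 1)) (l : List ℕ) :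
    hatTime l a u 0 = hatTime (pushList (k + 1) m l) a u 0 := by
  cases l with
  | nil =>
    rw [pushList]
    split_ifs with hm
    · rfl
    · rw [hatTime_cons h1 h2]
  | cons h t =>
    rw [pushList]
    split_ifs with hm
    · subst hm
      exact hatTime_cons h1 h2 t
    · rw [hatTime_cons h1 h2]

lemma clearance_pos {a : Fin (k + 1) → ℂ} (ha : a ∈ Chamber (k + 1)) {u y : ℝ}
    (hu : ∀ j, u = (a j).re → y ≠ 0) : 0 < |u - clampU a u| + |y| + beta a u := by
  have h1 := abs_nonneg (u - clampU a u)
  have h2 := abs_nonneg y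
  have h3 := beta_nonneg a u
  by_contra! h
  have h4 : u - clampU a u = 0 := abs_eq_zero.1 (by linarith)
  have h6 : y = 0 := abs_eq_zero.1 (by linarith)
  have h5 : min (u - (a 0).re) ((a (Fin.last k)).re - u) ≤ 0 :=
    (le_max_right _ _).trans (show beta a u ≤ 0 by linarith)
  have h7 : (a 0).re ≤ clampU a u := le_max_left _ _
  have h8 : clampU a u ≤ (a (Fin.last k)).re := max_le (le_re ha _) (min_le_right _ _)
  rcases min_le_iff.1 h5 with h5 | h5
  · exact hu 0 (by linarith) h6
  · exact hu (Fin.last k) (by linarith) h6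

lemma hatTime_pos (l : List ℕ) {a : Fin (k + 1) → ℂ} (ha : a ∈ Chamber (k + 1)) : ∀ {u y : ℝ},
    (∀ j, u = (a j).re → y ≠ 0) → 0 < hatTime l a u y := by
  induction l with
  | nil => intro u y hu; exact div_pos (by positivity) (clearance_pos ha hu)
  | cons m l ih =>
    intro u y hu
    have := ih (u := tgt (pad a u m) (pad a u (m + 1)) u y) (y := 0)
      fun j hj => absurd hj (tgt_pad_ne ha hu m j)
    rw [hatTime]; positivity

lemma continuousAt_hatTime (l : List ℕ) : ∀ {A : Y → Fin (k + 1) → ℂ} {u y : Y → ℝ} {z : Y},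
    Continuous A → Continuous u → Continuous y → A z ∈ Chamber (k + 1) →
    (∀ j, u z = (A z j).re → y z ≠ 0) →
    ContinuousAt (fun z => hatTime l (A z) (u z) (y z)) z := by
  induction l with
  | nil =>
    intro A u y z hA hu hy hz hne
    unfold hatTime
    refine ContinuousAt.div (by fun_prop) (by fun_prop) (clearance_pos hz hne).ne'
  | cons m l ih =>
    intro A u y z hA hu hy hz hne
    unfold hatTime
    refine ContinuousAt.add (by fun_prop) (ih hA (by fun_prop) continuous_const hz ?_)
    exact fun j hj => absurd hj (tgt_pad_ne hz hne m j)

lemma hat_hatTime (l : List ℕ) {a : Fin (k + 1) → ℂ} (ha : a ∈ Chamber (k + 1)) : ∀ {u y : ℝ},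
    (∀ j, u = (a j).re → y ≠ 0) → 4 * ‖a‖ + 5 ≤ |(hat l a u y (hatTime l a u y)).1| ∨
      5 * ‖a‖ + 5 ≤ |(hat l a u y (hatTime l a u y)).2| := by
  induction l with
  | nil =>
    intro u y hu
    have hs := hatTime_pos [] ha hu
    have hE := clearance_pos ha hu
    have hse : hatTime [] a u y * (|u - clampU a u| + |y| + beta a u) = 10 * (‖a‖ + 1) := by
      rw [hatTime, div_mul_cancel₀ _ hE.ne']
    generalize hatTime [] a u y = s at *
    simp only [hat]
    have hc := abs_clampU_le a u
    by_cases h : 5 * (‖a‖ + 1) ≤ s * |u - clampU a u|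
    · left
      have e : u + s * (u - clampU a u) = clampU a u + (1 + s) * (u - clampU a u) := by ring
      have h1 := abs_sub_abs_le_abs_sub ((1 + s) * (u - clampU a u)) (-clampU a u)
      rw [abs_neg, abs_mul, abs_of_pos (by linarith : 0 < 1 + s)] at h1
      rw [e, show clampU a u + (1 + s) * (u - clampU a u) =
        (1 + s) * (u - clampU a u) - -clampU a u by ring]
      have := abs_nonneg (u - clampU a u)
      linarith
    · right
      have := abs_nonneg y
      rw [abs_of_nonneg (by have := beta_nonneg a u; positivity)]
      linarith
  | cons m l ih =>
    intro u y hu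
    have hu' : ∀ j, tgt (pad a u m) (pad a u (m + 1)) u y = (a j).re → (0 : ℝ) ≠ 0 :=
      fun j hj => absurd hj (tgt_pad_ne ha hu m j)
    have h := ih hu'
    have hpos := hatTime_pos l ha hu'
    rw [hat, if_neg (by rw [hatTime]; linarith), hatTime, add_sub_cancel_left]
    simpa using h

end Flow

section PlaneFlow

variable {k : ℕ} {Y : Type*} [TopologicalSpace Y]

/-- `p` is far away from the configuration. -/
def Far {n : ℕ} (a : Fin n → ℂ) (p : ℂ) : Prop := 2 * ‖a‖ < ‖p‖

/-- The point with given coordinates relative to the curve through the punctures. -/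
noncomputable def pt (a : Fin (k + 1) → ℂ) (q : ℝ × ℝ) : ℂ := ⟨q.1, curve a q.1 + q.2⟩

/-- The flow along a label. -/
noncomputable def flow (a : Fin (k + 1) → ℂ) (p : ℂ) (l : Lab (k + 1)) (s : ℝ) : ℂ :=
  if 0 ≤ yco a p then pt a (hat l.1 a p.re (yco a p) (max s 0))
  else pt a ((hat (push (k + 1) (str a p) l).1 a p.re (yco a p) (max s 0)).1,
    -(hat (push (k + 1) (str a p) l).1 a p.re (yco a p) (max s 0)).2)

/-- The time after which the flow is far away. -/
noncomputable def flowTime (a : Fin (k + 1) → ℂ) (p : ℂ) (l : Lab (k + 1)) : ℝ :=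
  if 0 ≤ yco a p then hatTime l.1 a p.re (yco a p)
  else hatTime (push (k + 1) (str a p) l).1 a p.re (yco a p)

open Classical in
/-- No gate remains to be crossed. -/
noncomputable def atInfty (a : Fin (k + 1) → ℂ) (p : ℂ) (l : Lab (k + 1)) : Bool :=
  if 0 ≤ yco a p then decide (l = Lab.nil _)
  else decide (push (k + 1) (str a p) l = Lab.nil _)

lemma pt_yco (a : Fin (k + 1) → ℂ) (p : ℂ) : pt a (p.re, yco a p) = p := by
  apply Complex.ext <;> simp [pt, yco]

lemma pt_ne {a : Fin (k + 1) → ℂ} (ha : a ∈ Chamber (k + 1)) {q : ℝ × ℝ} {j : Fin (k + 1)}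
    (h : q.1 = (a j).re → q.2 ≠ 0) : pt a q ≠ a j := by
  intro e
  have h1 : q.1 = (a j).re := congrArg Complex.re e
  have h2 : curve a q.1 + q.2 = (a j).im := congrArg Complex.im e
  rw [h1, curve_apply ha] at h2
  exact h h1 (by linarith)

lemma yco_ne {a : Fin (k + 1) → ℂ} (ha : a ∈ Chamber (k + 1)) {p : ℂ} (hp : ∀ j, p ≠ a j)
    (j : Fin (k + 1)) (h : p.re = (a j).re) : yco a p ≠ 0 := by
  intro e
  rw [yco, h, curve_apply ha] at e
  exact hp j (Complex.ext h (by linarith))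

lemma continuous_pt {A : Y → Fin (k + 1) → ℂ} {q : Y → ℝ × ℝ} (hA : Continuous A)
    (hq : Continuous q) (hC : ∀ y, A y ∈ Chamber (k + 1)) :
    Continuous fun y => pt (A y) (q y) := by
  have h := continuous_curve hA hq.fst hC
  have : (fun y => pt (A y) (q y)) = fun y =>
      ((q y).1 : ℂ) + (curve (A y) (q y).1 + (q y).2 : ℝ) * Complex.I := by
    funext y; apply Complex.ext <;> simp [pt]
  rw [this]; fun_prop

lemma flow_zero (a : Fin (k + 1) → ℂ) (p : ℂ) (l : Lab (k + 1)) : flow a p l 0 = p := by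
  unfold flow
  split_ifs with h
  · rw [max_self, hat_zero, abs_of_nonneg h, pt_yco]
  · rw [max_self, hat_zero, abs_of_neg (not_le.1 h), neg_neg, pt_yco]

lemma flow_ne {a : Fin (k + 1) → ℂ} (ha : a ∈ Chamber (k + 1)) {p : ℂ} (hp : ∀ j, p ≠ a j)
    (l : Lab (k + 1)) (s : ℝ) (j : Fin (k + 1)) : flow a p l s ≠ a j := by
  have h := yco_ne ha hp
  unfold flow
  split_ifs
  · exact pt_ne ha (hat_ne _ ha (le_max_right _ _) h j)
  · refine pt_ne ha fun e => ?_
    exact neg_ne_zero.2 (hat_ne _ ha (le_max_right _ _) h j e)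

lemma flowTime_pos {a : Fin (k + 1) → ℂ} (ha : a ∈ Chamber (k + 1)) {p : ℂ} (hp : ∀ j, p ≠ a j)
    (l : Lab (k + 1)) : 0 < flowTime a p l := by
  unfold flowTime
  split_ifs <;> exact hatTime_pos _ ha (yco_ne ha hp)

lemma far_pt {a : Fin (k + 1) → ℂ} (ha : a ∈ Chamber (k + 1)) {q : ℝ × ℝ}
    (h : 4 * ‖a‖ + 5 ≤ |q.1| ∨ 5 * ‖a‖ + 5 ≤ |q.2|) : Far a (pt a q) := by
  have h0 := norm_nonneg a
  rcases h with h | h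
  · have : |q.1| ≤ ‖pt a q‖ := Complex.abs_re_le_norm (pt a q)
    unfold Far; linarith
  · have h1 : |curve a q.1 + q.2| ≤ ‖pt a q‖ := Complex.abs_im_le_norm (pt a q)
    have h2 := abs_curve_le ha q.1
    have h3 := abs_sub_abs_le_abs_sub q.2 (-curve a q.1)
    rw [abs_neg, sub_neg_eq_add, add_comm q.2] at h3
    unfold Far; linarith

lemma far_flow_flowTime {a : Fin (k + 1) → ℂ} (ha : a ∈ Chamber (k + 1)) {p : ℂ}
    (hp : ∀ j, p ≠ a j) (l : Lab (k + 1)) : Far a (flow a p l (flowTime a p l)) := by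
  rw [flow, max_eq_left (flowTime_pos ha hp l).le, flowTime]
  split_ifs
  · exact far_pt ha (hat_hatTime _ ha (yco_ne ha hp))
  · refine far_pt ha ?_
    simpa using hat_hatTime _ ha (yco_ne ha hp)

lemma clampU_expand {a : Fin (k + 1) → ℂ} (ha : a ∈ Chamber (k + 1)) (u : ℝ) {s : ℝ}
    (hs : 0 ≤ s) : clampU a (u + s * (u - clampU a u)) = clampU a u := by
  have h01 := le_re ha (Fin.last k)
  rcases le_total u (a 0).re with h | h
  · have hc : clampU a u = (a 0).re := by
      rw [clampU, min_eq_left (by linarith), max_eq_left (by linarith)]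
    rw [hc]
    have : u + s * (u - (a 0).re) ≤ (a 0).re := by nlinarith
    rw [clampU, min_eq_left (by linarith), max_eq_left (by linarith)]
  rcases le_total u (a (Fin.last k)).re with h' | h'
  · have hc : clampU a u = u := by
      rw [clampU, min_eq_left (by linarith), max_eq_right (by linarith)]
    rw [hc, sub_self, mul_zero, add_zero, hc]
  · have hc : clampU a u = (a (Fin.last k)).re := by
      rw [clampU, min_eq_right (by linarith), max_eq_right (by linarith)]
    rw [hc]
    have : (a (Fin.last k)).re ≤ u + s * (u - (a (Fin.last k)).re) := by nlinarith
    rw [clampU, min_eq_right (by linarith), max_eq_right (by linarith)]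

lemma far_iff_sq {n : ℕ} {a : Fin n → ℂ} {p : ℂ} :
    Far a p ↔ 4 * ‖a‖ ^ 2 < p.re ^ 2 + p.im ^ 2 := by
  have h : p.re ^ 2 + p.im ^ 2 = ‖p‖ ^ 2 := by rw [Complex.sq_norm, Complex.normSq_apply]; ring
  rw [h, Far]
  constructor
  · intro h; nlinarith [norm_nonneg a, norm_nonneg p]
  · intro h; nlinarith [norm_nonneg a, norm_nonneg p]

/-- The end phase of the flow does not approach the configuration. -/
lemma far_pt_expand {a : Fin (k + 1) → ℂ} (ha : a ∈ Chamber (k + 1)) {p : ℂ} (hp : Far a p)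
    {s : ℝ} (hs : 0 ≤ s) {ε : ℝ} (hε : ε * |yco a p| = yco a p) (hε' : ε = 1 ∨ ε = -1) :
    Far a (pt a (p.re + s * (p.re - clampU a p.re),
      ε * (|yco a p| + s * (|yco a p| + beta a p.re)))) := by
  rw [far_iff_sq] at hp ⊢
  have hcl := abs_le.1 (abs_clampU_le a p.re)
  have hcu := abs_le.1 (abs_curve_le ha p.re)
  have e1 : (pt a (p.re + s * (p.re - clampU a p.re),
      ε * (|yco a p| + s * (|yco a p| + beta a p.re)))).re =
      p.re + s * (p.re - clampU a p.re) := rfl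
  have e2 : (pt a (p.re + s * (p.re - clampU a p.re),
      ε * (|yco a p| + s * (|yco a p| + beta a p.re)))).im =
      p.im + s * (yco a p + ε * beta a p.re) := by
    simp only [pt]
    rw [curve_congr (clampU_expand ha p.re hs)]
    have : ε * (|yco a p| + s * (|yco a p| + beta a p.re)) =
      ε * |yco a p| + s * (ε * |yco a p| + ε * beta a p.re) := by ring
    rw [this, hε]
    unfold yco; ring
  rw [e1, e2]
  have hin : 0 ≤ p.re * (p.re - clampU a p.re) + p.im * (yco a p + ε * beta a p.re) := by
    set M := ‖a‖ with hM
    have hM0 : 0 ≤ M := norm_nonneg a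
    by_cases hb : beta a p.re = 0
    · rw [hb, mul_zero, add_zero, yco]
      generalize clampU a p.re = c at *
      generalize curve a p.re = d at *
      nlinarith [sq_nonneg (p.re - c), sq_nonneg (p.im - d),
        mul_nonneg (by linarith : 0 ≤ M - c) (by linarith : 0 ≤ M + c),
        mul_nonneg (by linarith : 0 ≤ M - d) (by linarith : 0 ≤ M + d)]
    · have hbp : 0 < min (p.re - (a 0).re) ((a (Fin.last k)).re - p.re) := by
        by_contra! h; exact hb (max_eq_left h)
      obtain ⟨hb1, hb2⟩ := lt_min_iff.1 hbp
      have hc : clampU a p.re = p.re := by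
        rw [clampU, min_eq_left (by linarith), max_eq_right (by linarith)]
      rw [hc] at hcl ⊢
      have him : M ^ 2 < p.im ^ 2 := by nlinarith
      have him' : M < |p.im| := by
        rw [← abs_of_nonneg hM0]; exact sq_lt_sq.1 him
      have hb0 := beta_nonneg a p.re
      have hyc : yco a p = p.im - curve a p.re := rfl
      rw [sub_self, mul_zero, zero_add]
      rcases lt_abs.1 him' with h | h
      · have hy : 0 < yco a p := by rw [hyc]; linarith
        have : ε = 1 := by
          rcases hε' with h | h
          · exact h
          · rw [h, abs_of_pos hy] at hε; linarith
        rw [this]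
        exact mul_nonneg (by linarith) (by linarith)
      · have hy : yco a p < 0 := by rw [hyc]; linarith
        have : ε = -1 := by
          rcases hε' with h | h
          · rw [h, abs_of_neg hy] at hε; linarith
          · exact h
        rw [this]
        exact mul_nonneg_of_nonpos_of_nonpos (by linarith) (by linarith)
  nlinarith [mul_nonneg hs hin, sq_nonneg (s * (p.re - clampU a p.re)),
    sq_nonneg (s * (yco a p + ε * beta a p.re))]

lemma far_flow_of_atInfty {a : Fin (k + 1) → ℂ} (ha : a ∈ Chamber (k + 1)) {p : ℂ} (hp : Far a p)
    {l : Lab (k + 1)} (hl : atInfty a p l = true) (s : ℝ) : Far a (flow a p l s) := by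
  classical
  unfold atInfty at hl
  unfold flow
  split_ifs at hl ⊢ with h
  · have hl' : l.1 = [] := congrArg Subtype.val (of_decide_eq_true hl)
    rw [hl']
    have := far_pt_expand ha hp (le_max_right s 0) (ε := 1)
      (by rw [one_mul, abs_of_nonneg h]) (Or.inl rfl)
    simpa only [hat, one_mul] using this
  · have hl' : (push (k + 1) (str a p) l).1 = [] := congrArg Subtype.val (of_decide_eq_true hl)
    rw [hl']
    have := far_pt_expand ha hp (le_max_right s 0) (ε := -1)
      (by rw [abs_of_neg (not_le.1 h)]; ring) (Or.inr rfl)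
    simpa only [hat, neg_one_mul] using this

lemma pad_str {a : Fin (k + 1) → ℂ} (ha : a ∈ Chamber (k + 1)) {p : ℂ} :
    pad a p.re (str a p) ≤ p.re ∧ p.re ≤ pad a p.re (str a p + 1) := by
  constructor
  · rw [pad]
    split_ifs with h0 h1
    · linarith [min_le_right (a 0).re p.re]
    · by_contra! h
      have := (str_le_iff ha p ⟨str a p - 1, by omega⟩).2 h.le
      simp only at this
      omega
    · exact absurd (str_le a p) (by omega)
  · rw [pad, if_neg (Nat.succ_ne_zero _)]
    split_ifs with h1
    · exact (str_le_iff ha p ⟨str a p + 1 - 1, by omega⟩).1 (by simp)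
    · have h2 : ((k + 2 : ℕ) : ℝ) ≤ ((str a p + 1 : ℕ) : ℝ) := by exact_mod_cast not_lt.1 h1
      push_cast at h2 ⊢
      linarith [le_max_right (a (Fin.last k)).re p.re]

lemma exists_atInfty (a : Fin (k + 1) → ℂ) (p : ℂ) : ∃ l, atInfty a p l = true := by
  unfold atInfty
  split_ifs
  · exact ⟨Lab.nil _, by simp⟩
  · exact ⟨push (k + 1) (str a p) (Lab.nil _), by simp [push_push]⟩

lemma atInfty_unique {a : Fin (k + 1) → ℂ} {p : ℂ} {l l' : Lab (k + 1)}
    (h : atInfty a p l = true) (h' : atInfty a p l' = true) : l = l' := by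
  classical
  unfold atInfty at h h'
  split_ifs at h h'
  · exact (of_decide_eq_true h).trans (of_decide_eq_true h').symm
  · exact (push (k + 1) (str a p)).injective
      ((of_decide_eq_true h).trans (of_decide_eq_true h').symm)

variable {A : Y → Fin (k + 1) → ℂ} {p : Y → ℂ} {l : Y → Lab (k + 1)}

theorem LabLift.continuous_flow (hl : LabLift A p l) (hA : Continuous A) (hp : Continuous p)
    (hC : ∀ y, A y ∈ Chamber (k + 1)) (hne : ∀ y j, p y ≠ A y j) {s : Y → ℝ} (hs : Continuous s) :
    Continuous fun y => flow (A y) (p y) (l y) (s y) := by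
  have hy := continuous_yco hA hp hC
  have hre : Continuous fun y => (p y).re := by fun_prop
  have hh : ∀ l : List ℕ, Continuous fun y =>
      hat l (A y) (p y).re (yco (A y) (p y)) (max (s y) 0) :=
    fun l => continuous_hat l hA hre hy (by fun_prop)
  rw [continuous_iff_continuousAt]
  intro y
  refine hl.continuousAt_ite hA hp hC hne
    (fun l z => pt (A z) (hat l.1 (A z) (p z).re (yco (A z) (p z)) (max (s z) 0)))
    (fun l z => pt (A z) ((hat l.1 (A z) (p z).re (yco (A z) (p z)) (max (s z) 0)).1,
      -(hat l.1 (A z) (p z).re (yco (A z) (p z)) (max (s z) 0)).2))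
    (fun l => (continuous_pt hA (hh l.1) hC).continuousAt)
    (fun l => (continuous_pt hA ((hh l.1).fst.prodMk (hh l.1).snd.neg) hC).continuousAt) ?_
  intro l h0
  obtain ⟨h1, h2⟩ := pad_str (hC y) (p := p y)
  simp only [h0]
  rw [hat_pushList h1 h2 (le_max_right _ _) l.1]
  rfl

theorem LabLift.continuous_flowTime (hl : LabLift A p l) (hA : Continuous A) (hp : Continuous p)
    (hC : ∀ y, A y ∈ Chamber (k + 1)) (hne : ∀ y j, p y ≠ A y j) :
    Continuous fun y => flowTime (A y) (p y) (l y) := by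
  have hy := continuous_yco hA hp hC
  have hre : Continuous fun y => (p y).re := by fun_prop
  rw [continuous_iff_continuousAt]
  intro y
  have hh : ∀ l : List ℕ, ContinuousAt (fun y =>
      hatTime l (A y) (p y).re (yco (A y) (p y))) y :=
    fun l => continuousAt_hatTime l hA hre hy (hC y) (yco_ne (hC y) (hne y))
  refine hl.continuousAt_ite hA hp hC hne
    (fun l z => hatTime l.1 (A z) (p z).re (yco (A z) (p z)))
    (fun l z => hatTime l.1 (A z) (p z).re (yco (A z) (p z)))
    (fun l => hh l.1) (fun l => hh l.1) ?_
  intro l h0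
  obtain ⟨h1, h2⟩ := pad_str (hC y) (p := p y)
  simp only [h0]
  rw [hatTime_pushList h1 h2 l.1]
  rfl

lemma str_outer {a : Fin (k + 1) → ℂ} (ha : a ∈ Chamber (k + 1)) {p : ℂ} (hp : Far a p)
    (h0 : yco a p = 0) : str a p = 0 ∨ str a p = k + 1 := by
  rw [far_iff_sq] at hp
  have hM0 : 0 ≤ ‖a‖ := norm_nonneg a
  have hcu := abs_le.1 (abs_curve_le ha p.re)
  have him : p.im = curve a p.re := by unfold yco at h0; linarith
  rw [← him] at hcu
  have hre : ‖a‖ < |p.re| := by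
    rw [← abs_of_nonneg hM0]; apply sq_lt_sq.1; nlinarith
  have h1 := abs_le.1 ((Complex.abs_re_le_norm _).trans (norm_le_pi_norm a 0))
  have h2 := abs_le.1 ((Complex.abs_re_le_norm _).trans (norm_le_pi_norm a (Fin.last k)))
  rcases lt_abs.1 hre with h | h
  · right
    have := (str_le_iff ha p (Fin.last k)).not.2 (by linarith)
    have := str_le a p
    simp only [Fin.val_last] at *
    omega
  · left
    have := (str_le_iff ha p 0).2 (by linarith)
    simpa using this

/-- Far away from the punctures, being at infinity is a locally constant property. -/
theorem LabLift.continuousAt_atInfty (hl : LabLift A p l) (hA : Continuous A) (hp : Continuous p)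
    (hC : ∀ y, A y ∈ Chamber (k + 1)) (hne : ∀ y j, p y ≠ A y j) {y : Y} (hy : Far (A y) (p y)) :
    ContinuousAt (fun y => atInfty (A y) (p y) (l y)) y := by
  classical
  refine hl.continuousAt_ite hA hp hC hne (fun l _ => decide (l = Lab.nil _))
    (fun l _ => decide (l = Lab.nil _)) (fun l => continuousAt_const)
    (fun l => continuousAt_const) ?_
  intro l h0
  have hn := push_nil_outer (str_outer (hC y) hy h0)
  simp only [decide_eq_decide]
  constructor
  · rintro rfl; exact hn
  · intro h
    rw [← push_push (k + 1) (str (A y) (p y)) l, h, hn]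

end PlaneFlow

section GoodLoops

variable {n : ℕ}

/-- The periodic path `f` deforms, in the complement of the configuration `x`, to a loop that is
far away, in such a way that the track of the base point deforms to a path that is far away. -/
def GoodLoop (x : Fin n → ℂ) (f : ℝ → ℂ) : Prop :=
  ∃ M N : ℝ × ℝ → ℂ, (Continuous M ∧ (∀ y j, M y ≠ x j) ∧ (∀ t, M (0, t) = f t) ∧
      (∀ τ t, M (τ, t + 1) = M (τ, t)) ∧ ∀ t, Far x (M (1, t))) ∧
    Continuous N ∧ (∀ y j, N y ≠ x j) ∧ (∀ τ, N (τ, 0) = M (τ, 0)) ∧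
      (∀ δ, N (0, δ) = M (0, 0)) ∧ (∀ δ, N (1, δ) = M (1, 0)) ∧ ∀ τ, Far x (N (τ, 1))

lemma GoodLoop.far {x : Fin n → ℂ} {f : ℝ → ℂ} (h : GoodLoop x f) : Far x (f 0) := by
  obtain ⟨M, N, ⟨-, -, hM, -, -⟩, -, -, -, h0, -, hN⟩ := h
  rw [← hM, ← h0 1]; exact hN 0

lemma norm_comp_perm (x : Fin n → ℂ) (σ : Equiv.Perm (Fin n)) : ‖x ∘ σ‖ = ‖x‖ := by
  refine le_antisymm ?_ ?_
  · exact (pi_norm_le_iff_of_nonneg (norm_nonneg _)).2 fun j => norm_le_pi_norm x (σ j)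
  · refine (pi_norm_le_iff_of_nonneg (norm_nonneg _)).2 fun j => ?_
    have := norm_le_pi_norm (x ∘ σ) (σ.symm j)
    simpa using this

lemma far_comp {x : Fin n → ℂ} {p : ℂ} (σ : Equiv.Perm (Fin n)) : Far (x ∘ σ) p ↔ Far x p := by
  rw [Far, Far, norm_comp_perm]

lemma far_rot {x : Fin n → ℂ} {p : ℂ} (θ : ℝ) : Far (rot θ • x) (rot θ * p) ↔ Far x p := by
  rw [Far, Far, norm_smul, norm_mul, norm_rot, one_mul, one_mul]

lemma GoodLoop.comp {x : Fin n → ℂ} {f : ℝ → ℂ} (h : GoodLoop x f) (σ : Equiv.Perm (Fin n)) :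
    GoodLoop (x ∘ σ) f := by
  obtain ⟨M, N, ⟨h1, h2, h3, h4, h5⟩, h6, h7, h8, h9, h10, h11⟩ := h
  exact ⟨M, N, ⟨h1, fun y j => h2 y _, h3, h4, fun t => (far_comp σ).2 (h5 t)⟩, h6,
    fun y j => h7 y _, h8, h9, h10, fun τ => (far_comp σ).2 (h11 τ)⟩

lemma GoodLoop.rot {x : Fin n → ℂ} {f : ℝ → ℂ} (h : GoodLoop x f) (θ : ℝ) :
    GoodLoop (rot θ • x) fun t => rot θ * f t := by
  obtain ⟨M, N, ⟨h1, h2, h3, h4, h5⟩, h6, h7, h8, h9, h10, h11⟩ := h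
  have hne : ∀ {p q : ℂ}, p ≠ q → _root_.rot θ * p ≠ _root_.rot θ * q :=
    fun hpq e => hpq (mul_left_cancel₀ (rot_ne_zero θ) e)
  exact ⟨fun y => _root_.rot θ * M y, fun y => _root_.rot θ * N y,
    ⟨by fun_prop, fun y j => hne (h2 y j), fun t => by simp only [h3], fun τ t => by simp only [h4],
      fun t => (far_rot θ).2 (h5 t)⟩, by fun_prop, fun y j => hne (h7 y j),
    fun τ => by simp only [h8], fun τ => by simp only [h9], fun τ => by simp only [h10],
    fun τ => (far_rot θ).2 (h11 τ)⟩

/-- Loops that deform to a good loop with base point far away are good. -/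
lemma GoodLoop.of_homotopy {x : Fin n → ℂ} {f : ℝ → ℂ} (h : GoodLoop x f) {A : ℝ × ℝ → ℂ}
    (hA : Continuous A) (hne : ∀ y j, A y ≠ x j) (h0 : ∀ t, A (0, t) = f t)
    (hper : ∀ σ t, A (σ, t + 1) = A (σ, t)) (hfar : ∀ σ, Far x (A (σ, 0))) :
    GoodLoop x fun t => A (1, t) := by
  obtain ⟨M, N, ⟨h1, h2, h3, h4, h5⟩, h6, h7, h8, h9, h10, h11⟩ := h
  refine ⟨fun y => if y.1 ≤ 1 / 2 then A (1 - 2 * y.1, y.2) else M (2 * y.1 - 1, y.2),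
    fun y => if y.1 ≤ 1 / 2 then A (1 - 2 * y.1, 0) else N (2 * y.1 - 1, y.2),
    ⟨?_, ?_, ?_, ?_, ?_⟩, ?_, ?_, ?_, ?_, ?_, ?_⟩
  · refine Continuous.if_le (by fun_prop) (by fun_prop) (by fun_prop) (by fun_prop) fun y hy => ?_
    rw [hy]; norm_num [h0, h3]
  · intro y j; dsimp only; split_ifs
    exacts [hne _ _, h2 _ _]
  · intro t; norm_num
  · intro τ t; dsimp only; rw [hper, h4]
  · intro t; norm_num; exact h5 t
  · refine Continuous.if_le (by fun_prop) (by fun_prop) (by fun_prop) (by fun_prop) fun y hy => ?_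
    rw [hy]; norm_num [h0, h3, h9]
  · intro y j; dsimp only; split_ifs
    exacts [hne _ _, h7 _ _]
  · intro τ; dsimp only; rw [h8]
  · intro τ; norm_num
  · intro τ; norm_num [h10]
  · intro τ; dsimp only; split_ifs
    exacts [hfar _, h11 _]

/-- Two homotopies with the same base point track, one of which ends far away. -/
lemma goodLoop_of_track {x : Fin n → ℂ} {A B : ℝ × ℝ → ℂ} (hA : Continuous A) (hB : Continuous B)
    (hAne : ∀ y j, A y ≠ x j) (hBne : ∀ y j, B y ≠ x j) (h0 : ∀ t, A (0, t) = B (0, t))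
    (hAper : ∀ σ t, A (σ, t + 1) = A (σ, t)) (hBper : ∀ σ t, B (σ, t + 1) = B (σ, t))
    (htr : ∀ σ, A (σ, 0) = B (σ, 0)) (hst : ∀ σ, 1 ≤ σ → B (σ, 0) = B (1, 0))
    (hfar : ∀ t, Far x (B (1, t))) : GoodLoop x fun t => A (1, t) := by
  refine ⟨fun y => if y.1 ≤ 1 / 2 then A (1 - 2 * y.1, y.2) else B (2 * y.1 - 1, y.2),
    fun y => B (max |1 - 2 * y.1| y.2, 0),
    ⟨?_, ?_, ?_, ?_, ?_⟩, by fun_prop, fun y j => hBne _ _, ?_, ?_, ?_, ?_⟩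
  · refine Continuous.if_le (by fun_prop) (by fun_prop) (by fun_prop) (by fun_prop) fun y hy => ?_
    rw [hy]; norm_num [h0]
  · intro y j; dsimp only; split_ifs
    exacts [hAne _ _, hBne _ _]
  · intro t; norm_num
  · intro τ t; dsimp only; rw [hAper, hBper]
  · intro t; norm_num; exact hfar t
  · intro τ
    dsimp only
    rw [max_eq_left (abs_nonneg (1 - 2 * τ))]
    split_ifs with h
    · rw [abs_of_nonneg (by linarith), htr]
    · rw [abs_of_nonpos (by linarith), neg_sub]
  · intro δ
    norm_num [htr]
    exact hst _ (le_max_left _ _)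
  · intro δ
    norm_num
    exact hst _ (le_max_left _ _)
  · intro τ
    dsimp only
    rw [hst _ (le_max_right _ _)]
    exact hfar 0

end GoodLoops

section GoodSections

variable {k : ℕ} {Y : Type*} [TopologicalSpace Y]

/-- The added point is at infinity over the configuration `x`. -/
def Good {n : ℕ} (g : (Fin n → ℂ) → ℂ) (x : Fin n → ℂ) : Prop := GoodLoop x (loop g x)

lemma GateLift.atInfty_eq [PreconnectedSpace Y] {a : Fin (k + 1) → ℂ} (ha : a ∈ Chamber (k + 1))
    {p : Y → ℂ} (hp : Continuous p) (hne : ∀ y j, p y ≠ a j) (hfar : ∀ y, Far a (p y))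
    {L : Y → FreeGroup ℕ} (hL : GateLift FreeGroup.of (fun _ => a) p L) (l : Lab (k + 1))
    (y z : Y) : atInfty a (p y) (labHom _ (L y) l) = atInfty a (p z) (labHom _ (L z) l) := by
  have hc : Continuous fun y => atInfty a (p y) (labHom _ (L y) l) :=
    continuous_iff_continuousAt.2 fun y =>
      (hL.labLift l).continuousAt_atInfty continuous_const hp (fun _ => ha) hne (hfar y)
  exact PreconnectedSpace.constant inferInstance hc

lemma GateLift.eq_of_const {a : Fin (k + 1) → ℂ} (ha : a ∈ Chamber (k + 1)) {p : ℝ → ℂ} {q : ℂ}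
    (hp : ∀ t, p t = q) (hne : ∀ j, q ≠ a j) {L : ℝ → FreeGroup ℕ}
    (hL : GateLift FreeGroup.of (fun _ => a) p L) (s t : ℝ) : L s = L t := by
  obtain rfl : p = fun _ => q := funext hp
  have h1 : GateLift FreeGroup.of (fun _ : ℝ => a) (fun _ => q) fun _ => 1 :=
    gateLift_iff.2 ⟨fun y _ => by simp, fun y _ => by simp⟩
  obtain ⟨c, hc⟩ := GateLift.exists_eq_mul (fun _ => ha) (fun _ j => hne j) h1 hL
  rw [hc s, hc t]

theorem Good.atInfty {g : (Fin (k + 1) → ℂ) → ℂ} (hg : IsSec g)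
    {L : Chamber (k + 1) × ℝ → FreeGroup ℕ} {c : FreeGroup ℕ} {l₀ : Lab (k + 1)}
    (hL : GateLift FreeGroup.of (fun y => (y.1 : Fin (k + 1) → ℂ)) (fun y => loop g y.1 y.2) L)
    (hc : ∀ a t, L (a, t + 1) = L (a, t) * c) (hl₀ : ∀ l, labHom (k + 1) c l = l → l = l₀)
    {a : Chamber (k + 1)} (h : Good g a) :
    atInfty (a : Fin (k + 1) → ℂ) (g a) (labHom _ (L (a, 0)) l₀) = true := by
  obtain ⟨M, N, ⟨h1, h2, h3, h4, h5⟩, h6, h7, h8, h9, h10, h11⟩ := h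
  have ha := a.2
  obtain ⟨Λ, hΛ⟩ := exists_gateLift (A := fun _ : ℝ × ℝ => (a : Fin (k + 1) → ℂ)) FreeGroup.of
    continuous_const h1 (fun _ => ha) h2
  obtain ⟨Ξ, hΞ⟩ := exists_gateLift (A := fun _ : ℝ × ℝ => (a : Fin (k + 1) → ℂ)) FreeGroup.of
    continuous_const h6 (fun _ => ha) h7
  obtain ⟨c', hc'⟩ : ∃ c', ∀ y : ℝ × ℝ, Λ (y.1, y.2 + 1) = Λ y * c' := by
    refine GateLift.exists_eq_mul (fun _ => ha) h2 hΛ ?_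
    have := hΛ.comp (f := fun y : ℝ × ℝ => (y.1, y.2 + 1)) (by fun_prop)
    have e : M ∘ (fun y : ℝ × ℝ => (y.1, y.2 + 1)) = M := funext fun y => h4 _ _
    rwa [e] at this
  have hΛ0 := hΛ.comp (f := fun t : ℝ => ((0 : ℝ), t)) (by fun_prop)
  have hΛ1 := hΛ.comp (f := fun t : ℝ => ((1 : ℝ), t)) (by fun_prop)
  obtain ⟨d, hd⟩ : ∃ d, ∀ t : ℝ, Λ (0, t) = L (a, t) * d := by
    refine GateLift.exists_eq_mul (A := fun _ : ℝ => (a : Fin (k + 1) → ℂ)) (fun _ => ha)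
      (fun t j => hg.loop_ne (chamber_injective ha) t j)
      (hL.comp (f := fun t : ℝ => (a, t)) (by fun_prop)) ?_
    have e : M ∘ (fun t : ℝ => ((0 : ℝ), t)) = fun t => loop g a t := funext fun t => h3 t
    rw [e] at hΛ0
    exact hΛ0
  have hcd : c * d = d * c' := by
    have e1 := hd (0 + 1)
    rw [hc, hc' (0, 0), hd 0] at e1
    simpa only [mul_assoc, mul_right_inj] using e1.symm
  obtain ⟨l₁', hl₁'⟩ := exists_atInfty (a : Fin (k + 1) → ℂ) (M (1, 0))
  obtain ⟨l₁, rfl⟩ := (labHom (k + 1) (Λ (1, 0))).surjective l₁'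
  have hfix : labHom (k + 1) c' l₁ = l₁ := by
    have e := hΛ1.atInfty_eq ha (by fun_prop) (fun _ _ => h2 _ _) h5 l₁ 0 (0 + 1)
    simp only [Function.comp] at e
    rw [h4, hc' (1, 0), hl₁', _root_.map_mul] at e
    exact (labHom (k + 1) (Λ (1, 0))).injective (atInfty_unique e.symm hl₁')
  have hdl : labHom (k + 1) d l₁ = l₀ := by
    refine hl₀ _ ?_
    rw [← Equiv.Perm.mul_apply, ← _root_.map_mul, hcd, _root_.map_mul, Equiv.Perm.mul_apply, hfix]
  obtain ⟨e, he⟩ : ∃ e, ∀ τ : ℝ, Λ (τ, 0) = Ξ (τ, 0) * e := by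
    refine GateLift.exists_eq_mul (A := fun _ : ℝ => (a : Fin (k + 1) → ℂ)) (fun _ => ha)
      (fun t j => h7 (t, 0) j) (hΞ.comp (f := fun t : ℝ => (t, (0 : ℝ))) (by fun_prop)) ?_
    have := hΛ.comp (f := fun t : ℝ => (t, (0 : ℝ))) (by fun_prop)
    have e : M ∘ (fun t : ℝ => (t, (0 : ℝ))) = fun t => N (t, 0) := funext fun t => (h8 t).symm
    rw [e] at this
    exact this
  have hΞ0 := (hΞ.comp (f := fun t : ℝ => ((0 : ℝ), t)) (by fun_prop)).eq_of_const ha h9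
    (fun j => h2 _ j) 1 0
  have hΞ1 := (hΞ.comp (f := fun t : ℝ => ((1 : ℝ), t)) (by fun_prop)).eq_of_const ha h10
    (fun j => h2 _ j) 1 0
  have hfin := (hΞ.comp (f := fun t : ℝ => (t, (1 : ℝ))) (by fun_prop)).atInfty_eq ha (by fun_prop)
    (fun _ _ => h7 _ _) h11 (labHom (k + 1) e l₁) 0 1
  simp only [Function.comp] at hΞ0 hΞ1 hfin
  have hm : ∀ w : FreeGroup ℕ, labHom (k + 1) w (labHom (k + 1) e l₁) = labHom (k + 1) (w * e) l₁ :=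
    fun w => by rw [_root_.map_mul, Equiv.Perm.mul_apply]
  rw [hm, hm, hΞ0, hΞ1, ← he, ← he, h9, h10, hl₁', hd 0, _root_.map_mul, Equiv.Perm.mul_apply, hdl,
    h3, loop_zero] at hfin
  exact hfin

end GoodSections

section Homotopies

variable {n : ℕ}

/-- Homotopies of sections, in terms of the added point. -/
structure IsSecHom (G : (Fin n → ℂ) × ℝ → ℂ) : Prop where
  cont : ContinuousOn G {y | Function.Injective y.1}
  avoid : ∀ x, Function.Injective x → ∀ τ j, G (x, τ) ≠ x j
  symm : ∀ x, Function.Injective x → ∀ (σ : Equiv.Perm (Fin n)) τ, G (x ∘ σ, τ) = G (x, τ)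

/-- Two sections are homotopic, in terms of the added point. -/
def SecHom (g g' : (Fin n → ℂ) → ℂ) : Prop :=
  ∃ G : (Fin n → ℂ) × ℝ → ℂ, IsSecHom G ∧ (∀ x, Function.Injective x → G (x, 0) = g x) ∧
    ∀ x, Function.Injective x → G (x, 1) = g' x

lemma IsSecHom.isSec {G : (Fin n → ℂ) × ℝ → ℂ} (hG : IsSecHom G) (τ : ℝ) :
    IsSec fun x => G (x, τ) where
  cont := hG.cont.comp (f := fun x => (x, τ)) (by fun_prop) fun _ hx => hx
  avoid x hx j := hG.avoid x hx τ j
  symm x hx σ := hG.symm x hx σ τ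

lemma IsSecHom.continuous_comp {G : (Fin n → ℂ) × ℝ → ℂ} (hG : IsSecHom G) {Y : Type*}
    [TopologicalSpace Y] {A : Y → (Fin n → ℂ) × ℝ} (hA : Continuous A)
    (hi : ∀ y, Function.Injective (A y).1) : Continuous fun y => G (A y) :=
  hG.cont.comp_continuous hA hi

lemma SecHom.refl {g : (Fin n → ℂ) → ℂ} (hg : IsSec g) : SecHom g g :=
  ⟨fun y => g y.1, ⟨hg.cont.comp (by fun_prop) fun _ hx => hx, fun x hx _ j => hg.avoid x hx j,
    fun x hx σ _ => hg.symm x hx σ⟩, fun _ _ => rfl, fun _ _ => rfl⟩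

lemma SecHom.trans {g g' g'' : (Fin n → ℂ) → ℂ} (h : SecHom g g') (h' : SecHom g' g'') :
    SecHom g g'' := by
  obtain ⟨G, hG, h0, h1⟩ := h
  obtain ⟨G', hG', h0', h1'⟩ := h'
  refine ⟨fun y => if y.2 ≤ 1 / 2 then G (y.1, 2 * y.2) else G' (y.1, 2 * y.2 - 1),
    ⟨?_, ?_, ?_⟩, ?_, ?_⟩
  · rw [continuousOn_iff_continuous_domRestrict]
    refine Continuous.if_le (f' := fun y : {y : (Fin n → ℂ) × ℝ | Function.Injective y.1} =>
        G (y.1.1, 2 * y.1.2)) (g' := fun y => G' (y.1.1, 2 * y.1.2 - 1))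
      (hG.continuous_comp (by fun_prop) fun y => y.2)
      (hG'.continuous_comp (by fun_prop) fun y => y.2) (by fun_prop) (by fun_prop) fun y hy => ?_
    rw [hy]
    norm_num [h1 _ y.2, h0' _ y.2]
  · intro x hx τ j
    dsimp only
    split_ifs
    exacts [hG.avoid x hx _ j, hG'.avoid x hx _ j]
  · intro x hx σ τ
    dsimp only
    rw [hG.symm x hx, hG'.symm x hx]
  · intro x hx
    norm_num [h0 x hx]
  · intro x hx
    norm_num [h1' x hx]

/-- Conjugation of a section by a rotation. -/
noncomputable def twist (θ : ℝ) (g : (Fin n → ℂ) → ℂ) (x : Fin n → ℂ) : ℂ :=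
  rot (-θ) * g (rot θ • x)

lemma twist_twist (θ : ℝ) (g : (Fin n → ℂ) → ℂ) (x : Fin n → ℂ) :
    twist (-θ) (twist θ g) x = g x := by
  rw [twist, twist, neg_neg, smul_smul, rot_mul_rot_neg, one_smul, ← mul_assoc, rot_mul_rot_neg,
    one_mul]

lemma rot_mul_ne {θ : ℝ} {x : Fin n → ℂ} {p : ℂ} {j : Fin n} (h : p ≠ (rot θ • x) j) :
    rot (-θ) * p ≠ x j := by
  intro e
  refine h ?_
  rw [Pi.smul_apply, smul_eq_mul, ← e, ← mul_assoc, rot_mul_rot_neg, one_mul]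

lemma IsSecHom.twist {G : (Fin n → ℂ) × ℝ → ℂ} (hG : IsSecHom G) (θ : ℝ) :
    IsSecHom fun y => rot (-θ) * G (rot θ • y.1, y.2) where
  cont := by
    refine ContinuousOn.mul continuousOn_const (hG.cont.comp (by fun_prop) fun y hy => ?_)
    exact injective_smul hy (rot_ne_zero θ)
  avoid x hx τ j := rot_mul_ne (hG.avoid _ (injective_smul hx (rot_ne_zero θ)) τ j)
  symm x hx σ τ := by
    dsimp only
    rw [← hG.symm _ (injective_smul hx (rot_ne_zero θ)) σ]
    rfl

lemma IsSec.twist {g : (Fin n → ℂ) → ℂ} (hg : IsSec g) (θ : ℝ) : IsSec (twist θ g) := by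
  refine ⟨ContinuousOn.mul continuousOn_const (hg.cont.comp (by fun_prop) fun x hx => ?_),
    fun x hx j => ?_, fun x hx σ => ?_⟩
  · exact injective_smul hx (rot_ne_zero θ)
  · exact rot_mul_ne (hg.avoid _ (injective_smul hx (rot_ne_zero θ)) j)
  · rw [_root_.twist, _root_.twist, ← hg.symm _ (injective_smul hx (rot_ne_zero θ)) σ]
    rfl

lemma SecHom.twist {g g' : (Fin n → ℂ) → ℂ} (h : SecHom g g') (θ : ℝ) :
    SecHom (twist θ g) (twist θ g') := by
  obtain ⟨G, hG, h0, h1⟩ := h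
  refine ⟨_, hG.twist θ, fun x hx => ?_, fun x hx => ?_⟩
  · rw [_root_.twist, h0 _ (injective_smul hx (rot_ne_zero θ))]
  · rw [_root_.twist, h1 _ (injective_smul hx (rot_ne_zero θ))]

lemma loop_twist (θ : ℝ) (g : (Fin n → ℂ) → ℂ) (x : Fin n → ℂ) (t : ℝ) :
    loop (twist θ g) x t = rot (-θ) * loop g (rot θ • x) t := by
  rw [loop, loop, twist, smul_comm (rot θ) (rot t) x, mul_left_comm]

lemma Good.twist {g : (Fin n → ℂ) → ℂ} {θ : ℝ} {x : Fin n → ℂ} (h : Good g (rot θ • x)) :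
    Good (twist θ g) x := by
  have := GoodLoop.rot h (-θ)
  rw [smul_smul, rot_neg_mul_rot, one_smul] at this
  unfold Good
  rw [funext (loop_twist θ g x)]
  exact this

end Homotopies

section Stage

variable {k : ℕ}

/-- Truncation to the unit interval. -/
noncomputable def unitClamp (τ : ℝ) : ℝ := max 0 (min 1 τ)

@[fun_prop] lemma continuous_unitClamp : Continuous unitClamp := by unfold unitClamp; fun_prop

@[simp] lemma unitClamp_zero : unitClamp 0 = 0 := by simp [unitClamp]

lemma unitClamp_of_one_le {τ : ℝ} (h : 1 ≤ τ) : unitClamp τ = 1 := by simp [unitClamp, h]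

@[simp] lemma unitClamp_one : unitClamp 1 = 1 := unitClamp_of_one_le le_rfl

lemma sort_unique {n : ℕ} {x : Fin n → ℂ} {σ τ : Equiv.Perm (Fin n)} (hσ : x ∘ σ ∈ Chamber n)
    (hτ : x ∘ τ ∈ Chamber n) : σ = τ := by
  have h1 : StrictMono ((fun j => (x j).re) ∘ σ) := hσ
  have h2 : StrictMono ((fun j => (x j).re) ∘ τ) := hτ
  have h := Tuple.unique_monotone h1.monotone h2.monotone
  have hinj : Function.Injective fun j => (x j).re := by
    have := h1.injective.comp σ.symm.injective
    rwa [Function.comp_assoc, Equiv.self_comp_symm] at this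
  exact Equiv.ext fun j => hinj (congrFun h j)

/-- The added point, moved along its label. -/
noncomputable def slide (g : (Fin (k + 1) → ℂ) → ℂ) (L : Chamber (k + 1) × ℝ → FreeGroup ℕ)
    (l₀ : Lab (k + 1)) (a : Chamber (k + 1)) (t s : ℝ) : ℂ :=
  flow (a : Fin (k + 1) → ℂ) (loop g a t) (labHom _ (L (a, t)) l₀)
    (s * flowTime (a : Fin (k + 1) → ℂ) (loop g a t) (labHom _ (L (a, t)) l₀))

open Classical in
/-- The added point, moved along its label for a time depending on the configuration, which is
supported where the real parts are distinct. -/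
noncomputable def slideOff (g : (Fin (k + 1) → ℂ) → ℂ) (L : Chamber (k + 1) × ℝ → FreeGroup ℕ)
    (l₀ : Lab (k + 1)) (ρ : (Fin (k + 1) → ℂ) → ℝ) (y : (Fin (k + 1) → ℂ) × ℝ) : ℂ :=
  if h : ∃ σ : Equiv.Perm (Fin (k + 1)), y.1 ∘ σ ∈ Chamber (k + 1) then
    slide g L l₀ ⟨y.1 ∘ h.choose, h.choose_spec⟩ 0 (unitClamp y.2 * ρ y.1) else g y.1

variable {g : (Fin (k + 1) → ℂ) → ℂ} {L : Chamber (k + 1) × ℝ → FreeGroup ℕ}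
  {l₀ : Lab (k + 1)} {ρ : (Fin (k + 1) → ℂ) → ℝ}

lemma slide_zero (a : Chamber (k + 1)) (t : ℝ) : slide g L l₀ a t 0 = loop g a t := by
  rw [slide, zero_mul, flow_zero]

lemma slide_ne (hg : IsSec g) (a : Chamber (k + 1)) (t s : ℝ) (j : Fin (k + 1)) :
    slide g L l₀ a t s ≠ (a : Fin (k + 1) → ℂ) j :=
  flow_ne a.2 (fun j => hg.loop_ne (chamber_injective a.2) t j) _ _ j

lemma far_slide_one (hg : IsSec g) (a : Chamber (k + 1)) (t : ℝ) :
    Far (a : Fin (k + 1) → ℂ) (slide g L l₀ a t 1) := by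
  rw [slide, one_mul]
  exact far_flow_flowTime a.2 (fun j => hg.loop_ne (chamber_injective a.2) t j) _

lemma continuous_slide (hg : IsSec g)
    (hL : GateLift FreeGroup.of (fun y => (y.1 : Fin (k + 1) → ℂ)) (fun y => loop g y.1 y.2) L)
    {Y : Type*} [TopologicalSpace Y] {a : Y → Chamber (k + 1)} {t s : Y → ℝ} (ha : Continuous a)
    (ht : Continuous t) (hs : Continuous s) : Continuous fun y => slide g L l₀ (a y) (t y) (s y) := by
  have hlab := (hL.comp (f := fun y => (a y, t y)) (by fun_prop)).labLift l₀
  have hA : Continuous fun y => (a y : Fin (k + 1) → ℂ) := by fun_prop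
  have hp := hg.continuous_loop hA (fun y => chamber_injective (a y).2) ht
  have hne : ∀ y j, loop g (a y) (t y) ≠ (a y : Fin (k + 1) → ℂ) j :=
    fun y j => hg.loop_ne (chamber_injective (a y).2) _ j
  have hT := hlab.continuous_flowTime hA hp (fun y => (a y).2) hne
  exact hlab.continuous_flow hA hp (fun y => (a y).2) hne (hs.mul hT)

lemma slideOff_eq {x : Fin (k + 1) → ℂ} {σ : Equiv.Perm (Fin (k + 1))}
    (hσ : x ∘ σ ∈ Chamber (k + 1)) (τ : ℝ) :
    slideOff g L l₀ ρ (x, τ) = slide g L l₀ ⟨x ∘ σ, hσ⟩ 0 (unitClamp τ * ρ x) := by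
  have h : ∃ σ : Equiv.Perm (Fin (k + 1)), x ∘ σ ∈ Chamber (k + 1) := ⟨σ, hσ⟩
  have e : h.choose = σ := sort_unique h.choose_spec hσ
  rw [slideOff, dif_pos h]
  congr 3
  exact congrArg _ e

lemma slideOff_of_not {x : Fin (k + 1) → ℂ}
    (h : ¬ ∃ σ : Equiv.Perm (Fin (k + 1)), x ∘ σ ∈ Chamber (k + 1)) (τ : ℝ) :
    slideOff g L l₀ ρ (x, τ) = g x := dif_neg h

lemma slideOff_of_mul_eq_zero (hg : IsSec g) {x : Fin (k + 1) → ℂ} (hx : Function.Injective x)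
    {τ : ℝ} (h : unitClamp τ * ρ x = 0) : slideOff g L l₀ ρ (x, τ) = g x := by
  by_cases hs : ∃ σ : Equiv.Perm (Fin (k + 1)), x ∘ σ ∈ Chamber (k + 1)
  · obtain ⟨σ, hσ⟩ := hs
    rw [slideOff_eq hσ, h, slide_zero, loop_zero]
    exact hg.symm x hx σ
  · exact slideOff_of_not hs τ

lemma isSecHom_slideOff (hg : IsSec g)
    (hL : GateLift FreeGroup.of (fun y => (y.1 : Fin (k + 1) → ℂ)) (fun y => loop g y.1 y.2) L)
    (hρ : ContinuousOn ρ {x | Function.Injective x})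
    (hρs : ∀ x (σ : Equiv.Perm (Fin (k + 1))), ρ (x ∘ σ) = ρ x)
    (hρ0 : ∀ x, Function.Injective x → ¬ Function.Injective (fun j => (x j).re) →
      ∀ᶠ z in 𝓝 x, ρ z = 0) : IsSecHom (slideOff g L l₀ ρ) where
  cont := by
    rintro ⟨x, τ⟩ hx
    replace hx : Function.Injective x := hx
    by_cases hs : ∃ σ : Equiv.Perm (Fin (k + 1)), x ∘ σ ∈ Chamber (k + 1)
    · obtain ⟨σ, hσ⟩ := hs
      have hc : Continuous fun y : (Fin (k + 1) → ℂ) × ℝ => y.1 ∘ σ := by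
        refine continuous_pi fun j => ?_
        simp only [Function.comp]
        fun_prop
      have hU : IsOpen {y : (Fin (k + 1) → ℂ) × ℝ | y.1 ∘ σ ∈ Chamber (k + 1)} :=
        isOpen_chamber.preimage hc
      refine (ContinuousOn.continuousAt ?_ (hU.mem_nhds hσ)).continuousWithinAt
      rw [continuousOn_iff_continuous_domRestrict]
      have hinj : ∀ y : {y : (Fin (k + 1) → ℂ) × ℝ | y.1 ∘ σ ∈ Chamber (k + 1)},
          Function.Injective y.1.1 := fun y => by
        have := (chamber_injective y.2).comp σ.symm.injective
        rwa [Function.comp_assoc, Equiv.self_comp_symm] at this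
      have hr : Continuous fun y : {y : (Fin (k + 1) → ℂ) × ℝ | y.1 ∘ σ ∈ Chamber (k + 1)} =>
          ρ y.1.1 := hρ.comp_continuous (by fun_prop) hinj
      have := continuous_slide (l₀ := l₀) hg hL
        (a := fun y : {y : (Fin (k + 1) → ℂ) × ℝ | y.1 ∘ σ ∈ Chamber (k + 1)} =>
          ⟨y.1.1 ∘ σ, y.2⟩) (t := fun _ => 0) (s := fun y => unitClamp y.1.2 * ρ y.1.1)
        ((hc.comp continuous_subtype_val).subtype_mk _) continuous_const
        ((continuous_unitClamp.comp (by fun_prop)).mul hr)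
      refine this.congr fun y => ?_
      exact (slideOff_eq (x := y.1.1) y.2 y.1.2).symm
    · have hz := hρ0 x hx fun h => hs (exists_sort h)
      have hg1 : ContinuousWithinAt (fun y : (Fin (k + 1) → ℂ) × ℝ => g y.1)
          {y | Function.Injective y.1} (x, τ) :=
        (hg.cont x hx).comp (f := Prod.fst) (t := {x | Function.Injective x})
          continuousWithinAt_fst fun y hy => hy
      refine hg1.congr_of_eventuallyEq ?_ (slideOff_of_not hs τ)
      have hz' : ∀ᶠ y : (Fin (k + 1) → ℂ) × ℝ in 𝓝 (x, τ), ρ y.1 = 0 :=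
        (continuousAt_fst (p := (x, τ))).eventually hz
      filter_upwards [mem_nhdsWithin_of_mem_nhds hz', self_mem_nhdsWithin] with y hy hy'
      exact slideOff_of_mul_eq_zero hg hy' (by rw [hy, mul_zero])
  avoid x hx τ j := by
    by_cases hs : ∃ σ : Equiv.Perm (Fin (k + 1)), x ∘ σ ∈ Chamber (k + 1)
    · obtain ⟨σ, hσ⟩ := hs
      rw [slideOff_eq hσ]
      have := slide_ne (L := L) (l₀ := l₀) hg ⟨x ∘ σ, hσ⟩ 0 (unitClamp τ * ρ x) (σ.symm j)
      simpa using this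
    · rw [slideOff_of_not hs]
      exact hg.avoid x hx j
  symm x hx σ τ := by
    by_cases hs : ∃ σ : Equiv.Perm (Fin (k + 1)), x ∘ σ ∈ Chamber (k + 1)
    · obtain ⟨π, hπ⟩ := hs
      have e : (x ∘ σ) ∘ (σ⁻¹ * π : Equiv.Perm (Fin (k + 1))) = x ∘ π := by
        funext j; simp
      have hπ' : (x ∘ σ) ∘ (σ⁻¹ * π : Equiv.Perm (Fin (k + 1))) ∈ Chamber (k + 1) := by rwa [e]
      rw [slideOff_eq hπ, slideOff_eq hπ', hρs]
      congr 2
    · have hs' : ¬ ∃ π : Equiv.Perm (Fin (k + 1)), (x ∘ σ) ∘ π ∈ Chamber (k + 1) := by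
        rintro ⟨π, hπ⟩
        exact hs ⟨σ * π, hπ⟩
      rw [slideOff_of_not hs, slideOff_of_not hs', hg.symm x hx]

lemma Good.comp {g : (Fin (k + 1) → ℂ) → ℂ} (hg : IsSec g) {x : Fin (k + 1) → ℂ}
    (hx : Function.Injective x) (h : Good g x) (σ : Equiv.Perm (Fin (k + 1))) :
    Good g (x ∘ σ) := by
  unfold Good
  rw [funext (hg.loop_comp hx σ)]
  exact GoodLoop.comp h σ

lemma Good.far_slideOff (hg : IsSec g)
    (hL : GateLift FreeGroup.of (fun y => (y.1 : Fin (k + 1) → ℂ)) (fun y => loop g y.1 y.2) L)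
    {c : FreeGroup ℕ} (hc : ∀ a t, L (a, t + 1) = L (a, t) * c)
    (hl₀ : ∀ l, labHom (k + 1) c l = l → l = l₀) {x : Fin (k + 1) → ℂ}
    (hx : Function.Injective x) (h : Good g x) (τ : ℝ) : Far x (slideOff g L l₀ ρ (x, τ)) := by
  by_cases hs : ∃ σ : Equiv.Perm (Fin (k + 1)), x ∘ σ ∈ Chamber (k + 1)
  · obtain ⟨σ, hσ⟩ := hs
    rw [slideOff_eq hσ, ← far_comp σ]
    have h' : Good g (⟨x ∘ σ, hσ⟩ : Chamber (k + 1)) := h.comp hg hx σ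
    have hat := Good.atInfty hg hL hc hl₀ h'
    rw [slide, loop_zero]
    refine far_flow_of_atInfty hσ ?_ hat _
    rw [← loop_zero (g := g)]
    exact GoodLoop.far h'
  · rw [slideOff_of_not hs, ← loop_zero (g := g)]
    exact GoodLoop.far h

/-- The homotopy of rotation loops induced by a homotopy of sections. -/
lemma IsSecHom.continuous_loop {n : ℕ} {G : (Fin n → ℂ) × ℝ → ℂ} (hG : IsSecHom G)
    {x : Fin n → ℂ} (hx : Function.Injective x) :
    Continuous fun y : ℝ × ℝ => loop (fun z => G (z, y.1)) x y.2 := by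
  unfold loop
  refine Continuous.mul (by fun_prop) (hG.continuous_comp (by fun_prop) fun y => ?_)
  exact injective_smul hx (rot_ne_zero _)

/-- A section can be made good where `ρ = 1`, and stays good where it already is, if `ρ` is
supported on the configurations with distinct real parts. -/
theorem IsSec.exists_stage_zero (hk : 2 ≤ k) (hg : IsSec g)
    (hρ : ContinuousOn ρ {x | Function.Injective x})
    (hρs : ∀ x (σ : Equiv.Perm (Fin (k + 1))), ρ (x ∘ σ) = ρ x)
    (hρ0 : ∀ x, Function.Injective x → ¬ Function.Injective (fun j => (x j).re) →
      ∀ᶠ z in 𝓝 x, ρ z = 0) :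
    ∃ g', IsSec g' ∧ SecHom g g' ∧ (∀ x, Function.Injective x → Good g x → Good g' x) ∧
      ∀ x, Function.Injective x → ρ x = 1 → Good g' x := by
  obtain ⟨L, c, hL, hc, l₀, hl₀, hl₀'⟩ := hg.exists_lift_fixed hk
  have hG := isSecHom_slideOff (l₀ := l₀) hg hL hρ hρs hρ0
  have hG0 : ∀ x, Function.Injective x → slideOff g L l₀ ρ (x, 0) = g x :=
    fun x hx => slideOff_of_mul_eq_zero hg hx (by rw [unitClamp_zero, zero_mul])
  have hloop0 : ∀ x, Function.Injective x → ∀ t,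
      loop (fun z => slideOff g L l₀ ρ (z, 0)) x t = loop g x t := fun x hx t => by
    rw [loop, loop, hG0 _ (injective_smul hx (rot_ne_zero t))]
  refine ⟨fun x => slideOff g L l₀ ρ (x, 1), hG.isSec 1, ⟨_, hG, hG0, fun _ _ => rfl⟩,
    fun x hx h => ?_, fun x hx h => ?_⟩
  · refine GoodLoop.of_homotopy h (hG.continuous_loop hx)
      (fun y j => (hG.isSec _).loop_ne hx _ j) (hloop0 x hx) (fun σ t => loop_add_one _ _)
      fun σ => ?_
    rw [loop_zero]
    exact h.far_slideOff hg hL hc hl₀' hx σ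
  · have hex : ∃ σ : Equiv.Perm (Fin (k + 1)), x ∘ σ ∈ Chamber (k + 1) := by
      by_contra hs
      have := (hρ0 x hx fun h' => hs (exists_sort h')).self_of_nhds
      rw [h] at this
      exact one_ne_zero this
    obtain ⟨σ, hσ⟩ := hex
    have hxσ : Function.Injective (x ∘ σ) := chamber_injective hσ
    suffices hgood : Good (fun x => slideOff g L l₀ ρ (x, 1)) (x ∘ σ) by
      have := hgood.comp (hG.isSec 1) hxσ σ⁻¹
      rwa [Function.comp_assoc, ← Equiv.Perm.coe_mul, mul_inv_cancel, Equiv.Perm.coe_one,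
        Function.comp_id] at this
    refine goodLoop_of_track (B := fun y => slide g L l₀ ⟨x ∘ σ, hσ⟩ y.2 (unitClamp y.1))
      (hG.continuous_loop hxσ)
      (continuous_slide hg hL continuous_const (by fun_prop) (by fun_prop))
      (fun y j => (hG.isSec _).loop_ne hxσ _ j)
      (fun y j => slide_ne hg ⟨x ∘ σ, hσ⟩ _ _ j) (fun t => ?_) (fun s t => loop_add_one _ _)
      (fun s t => ?_) (fun s => ?_) (fun s hs => ?_) (fun t => ?_)
    · dsimp only
      rw [unitClamp_zero, slide_zero, hloop0 _ hxσ]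
    · dsimp only
      rw [slide, slide, loop_add_one, hc, _root_.map_mul, Equiv.Perm.mul_apply, hl₀]
    · dsimp only
      rw [loop_zero, slideOff_eq (x := x ∘ σ) (σ := 1) hσ, hρs, h, mul_one]
      rfl
    · dsimp only
      rw [unitClamp_of_one_le hs, unitClamp_one]
    · dsimp only
      rw [unitClamp_one]
      exact far_slide_one hg ⟨x ∘ σ, hσ⟩ t

/-- The same in an arbitrary direction. -/
theorem IsSec.exists_stage (hk : 2 ≤ k) (hg : IsSec g) (θ : ℝ)
    (hρ : ContinuousOn ρ {x | Function.Injective x})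
    (hρs : ∀ x (σ : Equiv.Perm (Fin (k + 1))), ρ (x ∘ σ) = ρ x)
    (hρ0 : ∀ x, Function.Injective x → ¬ Function.Injective (fun j => (rot (-θ) * x j).re) →
      ∀ᶠ z in 𝓝 x, ρ z = 0) :
    ∃ g', IsSec g' ∧ SecHom g g' ∧ (∀ x, Function.Injective x → Good g x → Good g' x) ∧
      ∀ x, Function.Injective x → ρ x = 1 → Good g' x := by
  have hcancel : ∀ x : Fin (k + 1) → ℂ, rot θ • rot (-θ) • x = x := fun x => by
    rw [smul_smul, rot_mul_rot_neg, one_smul]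
  obtain ⟨g', h1, h2, h3, h4⟩ := (hg.twist θ).exists_stage_zero (ρ := fun x => ρ (rot θ • x)) hk
    (hρ.comp (by fun_prop) fun x hx => injective_smul hx (rot_ne_zero θ))
    (fun x σ => hρs (rot θ • x) σ) (fun x hx h => by
      have hc : Continuous fun z : Fin (k + 1) → ℂ => rot θ • z := by fun_prop
      refine hc.continuousAt.eventually (hρ0 _ (injective_smul hx (rot_ne_zero θ)) ?_)
      simpa [← mul_assoc, rot_neg_mul_rot] using h)
  have e : _root_.twist (-θ) (_root_.twist θ g) = g := funext (twist_twist θ g)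
  refine ⟨_root_.twist (-θ) g', h1.twist _, e ▸ h2.twist (-θ), fun x hx h => ?_, fun x hx h => ?_⟩
  · refine Good.twist (h3 _ (injective_smul hx (rot_ne_zero _)) (Good.twist ?_))
    rwa [hcancel]
  · refine Good.twist (h4 _ (injective_smul hx (rot_ne_zero _)) ?_)
    rwa [hcancel]

end Stage

section Assembly

variable {n k : ℕ}

/-- How distinct the real parts of a configuration are after a rotation. -/
noncomputable def spread (l : ℕ) (x : Fin n → ℂ) : ℝ :=
  ∏ q ∈ (Finset.univ : Finset (Fin n)).offDiag, |(rot (-dir n l) * (x q.1 - x q.2)).re|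

@[fun_prop] lemma continuous_spread (l : ℕ) : Continuous (spread (n := n) l) := by
  unfold spread; fun_prop

lemma spread_nonneg (l : ℕ) (x : Fin n → ℂ) : 0 ≤ spread l x :=
  Finset.prod_nonneg fun _ _ => abs_nonneg _

lemma spread_comp (l : ℕ) (x : Fin n → ℂ) (σ : Equiv.Perm (Fin n)) :
    spread l (x ∘ σ) = spread l x :=
  Finset.prod_equiv (Equiv.prodCongr σ σ) (fun q => by simp) fun q _ => rfl

lemma spread_ne_zero_iff {l : ℕ} {x : Fin n → ℂ} :
    spread l x ≠ 0 ↔ Function.Injective fun j => (rot (-dir n l) * x j).re := by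
  rw [spread, Finset.prod_ne_zero_iff]
  constructor
  · intro h i j hij
    by_contra hne
    refine h (i, j) (by simpa using hne) ?_
    rw [mul_sub, Complex.sub_re, abs_eq_zero]
    exact sub_eq_zero.2 hij
  · intro h q hq e
    rw [mul_sub, Complex.sub_re, abs_eq_zero] at e
    exact (Finset.mem_offDiag.1 hq).2.2 (h (sub_eq_zero.1 e))

/-- The sum of the spreads over a family of directions. -/
noncomputable def totalSpread (x : Fin n → ℂ) : ℝ := ∑ l ∈ Finset.range (n ^ 2 + 1), spread l x

@[fun_prop] lemma continuous_totalSpread : Continuous (totalSpread (n := n)) := by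
  unfold totalSpread; fun_prop

lemma totalSpread_pos {x : Fin n → ℂ} (hx : Function.Injective x) : 0 < totalSpread x := by
  obtain ⟨l, hl, h⟩ := exists_dir hx
  exact Finset.sum_pos' (fun l _ => spread_nonneg l x)
    ⟨l, Finset.mem_range.2 hl, (spread_nonneg l x).lt_of_ne' (spread_ne_zero_iff.2 h)⟩

/-- The bump functions subordinate to the directions. -/
noncomputable def bump (l : ℕ) (x : Fin n → ℂ) : ℝ :=
  unitClamp (2 * (n ^ 2 + 1) * spread l x / totalSpread x - 1)

lemma continuousOn_bump (l : ℕ) :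
    ContinuousOn (bump (n := n) l) {x | Function.Injective x} := by
  refine continuous_unitClamp.comp_continuousOn (ContinuousOn.sub (ContinuousOn.div ?_ ?_ ?_) ?_)
  · fun_prop
  · fun_prop
  · exact fun x hx => (totalSpread_pos hx).ne'
  · fun_prop

lemma bump_comp (l : ℕ) (x : Fin n → ℂ) (σ : Equiv.Perm (Fin n)) :
    bump l (x ∘ σ) = bump l x := by
  simp only [bump, totalSpread, spread_comp]

lemma bump_eventually_zero {l : ℕ} {x : Fin n → ℂ} (hx : Function.Injective x)
    (h : ¬ Function.Injective fun j => (rot (-dir n l) * x j).re) : ∀ᶠ z in 𝓝 x, bump l z = 0 := by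
  have h0 : spread l x = 0 := by
    by_contra h0
    exact h (spread_ne_zero_iff.1 h0)
  have hc : ContinuousAt (fun z : Fin n → ℂ => 2 * (n ^ 2 + 1) * spread l z / totalSpread z) x :=
    ContinuousAt.div (by fun_prop) (by fun_prop) (totalSpread_pos hx).ne'
  have : ∀ᶠ z in 𝓝 x, 2 * (n ^ 2 + 1) * spread l z / totalSpread z < 1 :=
    hc.eventually_lt_const (by dsimp only; rw [h0]; norm_num)
  filter_upwards [this] with z hz
  rw [bump, unitClamp, max_eq_left]
  exact (min_le_right _ _).trans (by linarith)

lemma exists_bump_eq_one {x : Fin n → ℂ} (hx : Function.Injective x) :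
    ∃ l < n ^ 2 + 1, bump l x = 1 := by
  have hpos := totalSpread_pos hx
  obtain ⟨l, hl, h⟩ : ∃ l ∈ Finset.range (n ^ 2 + 1), totalSpread x / (n ^ 2 + 1) ≤ spread l x := by
    refine Finset.exists_le_of_sum_le (by simp) ?_
    rw [Finset.sum_const, Finset.card_range, nsmul_eq_mul]
    push_cast
    rw [mul_div_cancel₀ _ (by positivity)]
    exact le_rfl
  refine ⟨l, Finset.mem_range.1 hl, unitClamp_of_one_le ?_⟩
  rw [div_le_iff₀ (by positivity)] at h
  have : 2 ≤ 2 * ((n : ℝ) ^ 2 + 1) * spread l x / totalSpread x := by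
    rw [le_div_iff₀ hpos]
    linarith
  linarith

/-- Every section is homotopic to one with the added point far away. -/
theorem IsSec.exists_far (hk : 2 ≤ k) {g : (Fin (k + 1) → ℂ) → ℂ} (hg : IsSec g) :
    ∃ g', IsSec g' ∧ SecHom g g' ∧ ∀ x, Function.Injective x → Far x (g' x) := by
  have key : ∀ N : ℕ, ∃ g', IsSec g' ∧ SecHom g g' ∧
      ∀ x, Function.Injective x → (∃ l < N, bump l x = 1) → Good g' x := by
    intro N
    induction N with
    | zero => exact ⟨g, hg, SecHom.refl hg, fun x _ ⟨l, hl, _⟩ => absurd hl (Nat.not_lt_zero l)⟩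
    | succ N ih =>
      obtain ⟨g₁, h1, h2, h3⟩ := ih
      obtain ⟨g₂, h4, h5, h6, h7⟩ := h1.exists_stage hk (dir (k + 1) N) (continuousOn_bump N)
        (bump_comp N) fun x hx h => bump_eventually_zero hx h
      refine ⟨g₂, h4, h2.trans h5, fun x hx ⟨l, hl, hb⟩ => ?_⟩
      rcases Nat.lt_succ_iff_lt_or_eq.1 hl with hl | rfl
      · exact h6 x hx (h3 x hx ⟨l, hl, hb⟩)
      · exact h7 x hx hb
  obtain ⟨g', h1, h2, h3⟩ := key ((k + 1) ^ 2 + 1)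
  refine ⟨g', h1, h2, fun x hx => ?_⟩
  rw [← loop_zero (g := g')]
  exact GoodLoop.far (h3 x hx (exists_bump_eq_one hx))

end Assembly

section Reduction

variable {n : ℕ} {S : Type*}

/-- The added point of an element of `UConf n S`. -/
def addedPoint : UConf n S → S :=
  Quotient.lift (fun x => x.1 0) fun x y ⟨σ, h⟩ => by rw [h]; rfl

lemma continuous_addedPoint [TopologicalSpace S] : Continuous (addedPoint : UConf n S → S) :=
  ((continuous_apply 0).comp continuous_subtype_val).quotient_lift _

/-- Adding a point to a configuration. -/
def addPoint (p : S) (y : PConf n S) (h : ∀ j, p ≠ y.1 j) : PConf (n + 1) S :=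
  ⟨Fin.cons p y.1, Fin.cons_injective_iff.2 ⟨fun ⟨j, hj⟩ => h j hj.symm, y.2⟩⟩

lemma mk_addPoint_eq {p : S} {x y : PConf n S} {hx : ∀ j, p ≠ x.1 j} {hy : ∀ j, p ≠ y.1 j}
    (h : confSetoid n S x y) :
    (Quotient.mk _ (addPoint p x hx) : UConf n S) = Quotient.mk _ (addPoint p y hy) := by
  obtain ⟨σ, h⟩ := h
  refine Quotient.sound ⟨σ, funext fun i => ?_⟩
  induction i using Fin.cases with
  | zero => rfl
  | succ j => exact congrFun h j

lemma exists_addPoint_eq {u : UConf n S} {y : PConf n S} (h : forgetQ n S u = Quotient.mk _ y) :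
    ∃ hy : ∀ j, addedPoint u ≠ y.1 j, Quotient.mk _ (addPoint (addedPoint u) y hy) = u := by
  induction u using Quotient.inductionOn with
  | h w =>
    have hrel : confSetoid n S (forgetPoint n w) y := Quotient.exact h
    have hw : ∀ j, w.1 0 ≠ (forgetPoint n w).1 j := fun j e => Fin.succ_ne_zero j (w.2 e).symm
    have hy : ∀ j, w.1 0 ≠ y.1 j := by
      obtain ⟨σ, hσ⟩ := (confSetoid n S).symm hrel
      intro j
      rw [hσ]
      exact hw (σ j)
    have hcons : addPoint (w.1 0) (forgetPoint n w) hw = w := by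
      refine Subtype.ext (funext fun i => ?_)
      induction i using Fin.cases <;> rfl
    refine ⟨hy, ?_⟩
    exact (mk_addPoint_eq (hx := hw) hrel).symm.trans (congrArg _ hcons)

lemma continuous_addPoint [TopologicalSpace S] {Y : Type*} [TopologicalSpace Y] {p : Y → S}
    {y : Y → PConf n S} (hp : Continuous p) (hy : Continuous y) (h : ∀ z j, p z ≠ (y z).1 j) :
    Continuous fun z => addPoint (p z) (y z) (h z) := by
  refine Continuous.subtype_mk (continuous_pi fun i => ?_) _
  induction i using Fin.cases with
  | zero => exact hp
  | succ j => exact (continuous_apply j).comp (continuous_subtype_val.comp hy)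

lemma isOpenQuotientMap_mk_conf [TopologicalSpace S] :
    IsOpenQuotientMap (Quotient.mk (confSetoid n S)) := by
  refine ⟨Quotient.mk_surjective, continuous_quotient_mk', fun U hU => ?_⟩
  have : Quotient.mk (confSetoid n S) ⁻¹' (Quotient.mk (confSetoid n S) '' U) =
      ⋃ σ : Equiv.Perm (Fin n), {x : PConf n S | (⟨x.1 ∘ σ, x.2.comp σ.injective⟩ : PConf n S) ∈ U} := by
    ext x
    simp only [Set.mem_preimage, Set.mem_image, Set.mem_iUnion]
    constructor
    · rintro ⟨y, hy, e⟩
      obtain ⟨σ, hσ⟩ : confSetoid n S y x := Quotient.exact e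
      refine ⟨σ, ?_⟩
      have : (⟨x.1 ∘ σ, x.2.comp σ.injective⟩ : PConf n S) = y := Subtype.ext hσ.symm
      rw [Set.mem_ofPred_eq, this]
      exact hy
    · rintro ⟨σ, hσ⟩
      exact ⟨_, hσ, Quotient.sound ⟨σ, rfl⟩⟩
  rw [← isQuotientMap_quotient_mk'.isOpen_preimage]
  change IsOpen (Quotient.mk (confSetoid n S) ⁻¹' (Quotient.mk (confSetoid n S) '' U))
  rw [this]
  refine isOpen_iUnion fun σ => hU.preimage ?_
  refine Continuous.subtype_mk (continuous_pi fun j => ?_) _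
  exact (continuous_apply (σ j)).comp continuous_subtype_val

end Reduction

section Plane

variable {n : ℕ}

/-- The identification of the complex numbers with the Euclidean plane. -/
noncomputable def planeEquiv : ℂ ≃ₗᵢ[ℝ] EuclideanSpace ℝ (Fin 2) :=
  Complex.orthonormalBasisOneI.repr

/-- The complex coordinates of a configuration in the plane. -/
noncomputable def toComplex (y : PConf n (EuclideanSpace ℝ (Fin 2))) (j : Fin n) : ℂ :=
  planeEquiv.symm (y.1 j)

lemma toComplex_injective (y : PConf n (EuclideanSpace ℝ (Fin 2))) :
    Function.Injective (toComplex y) := planeEquiv.symm.injective.comp y.2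

lemma continuous_toComplex :
    Continuous (toComplex : PConf n (EuclideanSpace ℝ (Fin 2)) → Fin n → ℂ) :=
  continuous_pi fun j => planeEquiv.symm.continuous.comp
    ((continuous_apply j).comp continuous_subtype_val)

/-- The configuration in the plane with given complex coordinates. -/
noncomputable def ofComplex (x : {x : Fin n → ℂ // Function.Injective x}) :
    PConf n (EuclideanSpace ℝ (Fin 2)) :=
  ⟨fun j => planeEquiv (x.1 j), planeEquiv.injective.comp x.2⟩

lemma continuous_ofComplex : Continuous (ofComplex (n := n)) :=
  Continuous.subtype_mk (continuous_pi fun j => planeEquiv.continuous.comp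
    ((continuous_apply j).comp continuous_subtype_val)) _

lemma ofComplex_toComplex (y : PConf n (EuclideanSpace ℝ (Fin 2))) :
    ofComplex ⟨toComplex y, toComplex_injective y⟩ = y :=
  Subtype.ext (funext fun j => planeEquiv.apply_symm_apply (y.1 j))

lemma planeEquiv_ne {p : ℂ} {y : PConf n (EuclideanSpace ℝ (Fin 2))} {j : Fin n}
    (h : p ≠ toComplex y j) : planeEquiv p ≠ y.1 j := by
  rintro e
  refine h ?_
  rw [toComplex, ← e, LinearIsometryEquiv.symm_apply_apply]

variable {G : (Fin n → ℂ) × ℝ → ℂ}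

/-- The homotopy of sections given by a homotopy of added points. -/
noncomputable def IsSecHom.toSection (hG : IsSecHom G)
    (z : Conf n (EuclideanSpace ℝ (Fin 2)) × ℝ) : UConf n (EuclideanSpace ℝ (Fin 2)) :=
  Quotient.lift (fun y => (Quotient.mk _ (addPoint (planeEquiv (G (toComplex y, z.2))) y
      fun j => planeEquiv_ne (hG.avoid _ (toComplex_injective y) z.2 j)) :
        UConf n (EuclideanSpace ℝ (Fin 2))))
    (fun x y h => by
      obtain ⟨σ, hσ⟩ := h
      have e : G (toComplex x, z.2) = G (toComplex y, z.2) := by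
        rw [← hG.symm _ (toComplex_injective y) σ]
        congr 2
        funext j
        exact congrArg planeEquiv.symm (congrFun hσ j)
      simp only [e]
      exact mk_addPoint_eq ⟨σ, hσ⟩) z.1

lemma IsSecHom.continuous_toSection (hG : IsSecHom G) : Continuous hG.toSection := by
  have hq := (isOpenQuotientMap_mk_conf (n := n) (S := EuclideanSpace ℝ (Fin 2))).prodMap
    (IsOpenQuotientMap.id (X := ℝ))
  rw [hq.isQuotientMap.continuous_iff]
  refine continuous_quotient_mk'.comp (continuous_addPoint (p := fun z :
    PConf n (EuclideanSpace ℝ (Fin 2)) × ℝ => planeEquiv (G (toComplex z.1, z.2)))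
    (planeEquiv.continuous.comp (hG.continuous_comp ?_ fun z => toComplex_injective z.1))
    continuous_fst _)
  exact (continuous_toComplex.comp continuous_fst).prodMk continuous_snd

lemma IsSecHom.forgetQ_toSection (hG : IsSecHom G) (q : Conf n (EuclideanSpace ℝ (Fin 2))) (τ : ℝ) :
    forgetQ n _ (hG.toSection (q, τ)) = q := by
  induction q using Quotient.inductionOn
  rfl

lemma winfty_addPoint {p : ℂ} {y : PConf n (EuclideanSpace ℝ (Fin 2))} (h : Far (toComplex y) p)
    (hp : ∀ j, planeEquiv p ≠ y.1 j) : Winfty n (addPoint (planeEquiv p) y hp) := by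
  intro i hi
  obtain ⟨j, rfl⟩ := Fin.exists_succ_eq.2 hi
  change ‖y.1 j‖ < ‖planeEquiv p‖
  have h1 : ‖y.1 j‖ ≤ ‖toComplex y‖ := by
    rw [← planeEquiv.symm.norm_map]
    exact norm_le_pi_norm (toComplex y) j
  have h2 : 2 * ‖toComplex y‖ < ‖p‖ := h
  rw [planeEquiv.norm_map]
  linarith [norm_nonneg (toComplex y)]

open Classical in
/-- The added point of a section, in complex coordinates. -/
noncomputable def sectionPoint
    (t : Conf n (EuclideanSpace ℝ (Fin 2)) → UConf n (EuclideanSpace ℝ (Fin 2)))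
    (x : Fin n → ℂ) : ℂ :=
  if h : Function.Injective x then
    planeEquiv.symm (addedPoint (t (Quotient.mk _ (ofComplex ⟨x, h⟩)))) else 0

lemma sectionPoint_toComplex
    (t : Conf n (EuclideanSpace ℝ (Fin 2)) → UConf n (EuclideanSpace ℝ (Fin 2)))
    (y : PConf n (EuclideanSpace ℝ (Fin 2))) :
    planeEquiv (sectionPoint t (toComplex y)) = addedPoint (t (Quotient.mk _ y)) := by
  rw [sectionPoint, dif_pos (toComplex_injective y), ofComplex_toComplex,
    LinearIsometryEquiv.apply_symm_apply]

lemma isSec_sectionPoint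
    {t : Conf n (EuclideanSpace ℝ (Fin 2)) → UConf n (EuclideanSpace ℝ (Fin 2))}
    (ht : Continuous t) (htsec : ∀ x, forgetQ n (EuclideanSpace ℝ (Fin 2)) (t x) = x) :
    IsSec (sectionPoint t) where
  cont := by
    rw [continuousOn_iff_continuous_domRestrict]
    have : Continuous fun x : {x : Fin n → ℂ // Function.Injective x} =>
        planeEquiv.symm (addedPoint (t (Quotient.mk _ (ofComplex x)))) :=
      planeEquiv.symm.continuous.comp (continuous_addedPoint.comp (ht.comp
        (continuous_quotient_mk'.comp continuous_ofComplex)))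
    refine this.congr fun x => ?_
    rw [Set.domRestrict_apply, sectionPoint, dif_pos x.2]
  avoid x hx j := by
    rw [sectionPoint, dif_pos hx]
    obtain ⟨hy, -⟩ := exists_addPoint_eq (htsec (Quotient.mk _ (ofComplex ⟨x, hx⟩)))
    intro e
    refine hy j ?_
    rw [← planeEquiv.apply_symm_apply (addedPoint _), e]
    rfl
  symm x hx σ := by
    rw [sectionPoint, dif_pos (hx.comp σ.injective), sectionPoint, dif_pos hx]
    congr 3
    exact Quotient.sound ⟨σ, rfl⟩

end Plane

theorem section_classification_unordered_R2 (n : ℕ) (hn : 3 < n)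
    (t : Conf n (EuclideanSpace ℝ (Fin 2)) → UConf n (EuclideanSpace ℝ (Fin 2)))
    (ht : Continuous t) (htsec : ∀ x, forgetQ n (EuclideanSpace ℝ (Fin 2)) (t x) = x) :
    ∃ t' : Conf n (EuclideanSpace ℝ (Fin 2)) → UConf n (EuclideanSpace ℝ (Fin 2)),
      Continuous t' ∧ (∀ x, forgetQ n (EuclideanSpace ℝ (Fin 2)) (t' x) = x) ∧
      (∀ x, ∃ y : PConf (n + 1) (EuclideanSpace ℝ (Fin 2)),
        Winfty n y ∧ Quotient.mk (uconfSetoid n (EuclideanSpace ℝ (Fin 2))) y = t' x) ∧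
      HomotopicThroughSectionsQ n (EuclideanSpace ℝ (Fin 2)) t t' := by
  obtain ⟨k, rfl⟩ : ∃ k, n = k + 1 := ⟨n - 1, by omega⟩
  obtain ⟨g', hg', ⟨G, hG, h0, h1⟩, hfar⟩ :=
    (isSec_sectionPoint ht htsec).exists_far (by omega : 2 ≤ k)
  refine ⟨fun q => hG.toSection (q, 1), hG.continuous_toSection.comp (by fun_prop),
    fun q => hG.forgetQ_toSection q 1, fun q => ?_,
    fun z => hG.toSection (z.1, z.2), hG.continuous_toSection.comp (by fun_prop), fun q => ?_,
    fun q => rfl, fun q τ => hG.forgetQ_toSection q τ⟩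
  · induction q using Quotient.inductionOn with
    | h y =>
      refine ⟨_, winfty_addPoint ?_ fun j =>
        planeEquiv_ne (hG.avoid _ (toComplex_injective y) 1 j), rfl⟩
      rw [h1 _ (toComplex_injective y)]
      exact hfar _ (toComplex_injective y)
  · induction q using Quotient.inductionOn with
    | h y =>
      obtain ⟨hy, e⟩ := exists_addPoint_eq (htsec (Quotient.mk _ y))
      rw [← e]
      have e' : planeEquiv (G (toComplex y, 0)) = addedPoint (t (Quotient.mk _ y)) := by
        rw [h0 _ (toComplex_injective y), sectionPoint_toComplex]
      change Quotient.mk _ (addPoint (planeEquiv (G (toComplex y, 0))) y _) = _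
      simp only [e']
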